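/- Let (T²,g) be a Riemannian torus and let c: [0,∞) → ℝ² be a geodesic ray on the universal covering which intersects a minimal axis α and a disjoint translate τα (with τ(α(ℝ)) ∩ α(ℝ) = ∅) each infinitely many times. Then the geodesic flow of g has positive topological entropy. -/

import Mathlib

open Filter Topology Set
open scoped ENNReal

noncomputable section

/-- The Euclidean norm of a point of `ℝ × ℝ` (the universal covering of `T²`). -/
def norm2 (p : ℝ × ℝ) : ℝ := Real.sqrt (p.1 ^ 2 + p.2 ^ 2)

/-- The translation vector of the covering transformation `τ_{(m,n)}` of `T² = ℝ²/ℤ²`. -/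
def lat (k : ℤ × ℤ) : ℝ × ℝ := ((k.1 : ℝ), (k.2 : ℝ))

/-- The transl of a curve in `ℝ²` by the covering transformation `τ_k`. -/
def transl (k : ℤ × ℤ) (c : ℝ → ℝ × ℝ) : ℝ → ℝ × ℝ := fun t => c t + lat k

/-- The asymptotic direction `δ(τ_k)` of the axes of the translation element `τ_k`. -/
def latDir (k : ℤ × ℤ) : ℝ × ℝ := (norm2 (lat k))⁻¹ • lat k

/-- A smooth Riemannian metric on the torus `T² = ℝ²/ℤ²`, described through its lift to the
universal covering `ℝ²`: a smooth family of positive definite symmetric bilinear forms on the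
tangent spaces of `ℝ²`, invariant under the deck transformation group `ℤ²`. -/
structure TorusMetric where
  g : (ℝ × ℝ) → (ℝ × ℝ) → (ℝ × ℝ) → ℝ
  smooth : ContDiff ℝ (⊤ : ℕ∞) fun p : (ℝ × ℝ) × (ℝ × ℝ) × (ℝ × ℝ) => g p.1 p.2.1 p.2.2
  symm : ∀ x v w, g x v w = g x w v
  linear : ∀ x w, IsLinearMap ℝ fun v => g x v w
  posdef : ∀ x v, v ≠ 0 → 0 < g x v v
  periodic : ∀ (k : ℤ × ℤ) (x v w : ℝ × ℝ), g (x + lat k) v w = g x v w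

namespace TorusMetric

/-- The Riemannian length of the curve `c` between the parameters `a` and `b`. -/
def length (M : TorusMetric) (c : ℝ → ℝ × ℝ) (a b : ℝ) : ℝ :=
  ∫ t in a..b, Real.sqrt (M.g (c t) (deriv c t) (deriv c t))

/-- The Riemannian distance on the universal covering `ℝ²` (hence also on `T²`). -/
def dist (M : TorusMetric) (x y : ℝ × ℝ) : ℝ :=
  sInf {L | ∃ c : ℝ → ℝ × ℝ, ContDiff ℝ 1 c ∧ c 0 = x ∧ c 1 = y ∧ L = M.length c 0 1}

/-- A (complete, unit speed) geodesic of the lifted metric on the universal covering `ℝ²`: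
a smooth curve with constant unit speed which is locally length minimizing. -/
def IsGeodesic (M : TorusMetric) (c : ℝ → ℝ × ℝ) : Prop :=
  ContDiff ℝ (⊤ : ℕ∞) c ∧ (∀ t, M.g (c t) (deriv c t) (deriv c t) = 1) ∧
    ∀ t : ℝ, ∃ ε > 0, ∀ s₁ s₂, t - ε ≤ s₁ → s₁ ≤ s₂ → s₂ ≤ t + ε →
      M.dist (c s₁) (c s₂) = M.length c s₁ s₂

end TorusMetric

/-- The distance between two points of the unit tangent bundle `ST²` of the torus; points of
`ST²` are represented by points of the tangent bundle `ℝ² × ℝ²` of the universal covering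
(the deck transformations act trivially on the vector component). -/
def phaseDist (p q : (ℝ × ℝ) × (ℝ × ℝ)) : ℝ :=
  sInf {r : ℝ | ∃ k : ℤ × ℤ, r = norm2 (p.1 - (q.1 + lat k)) + norm2 (p.2 - q.2)}

/-- A `(φ,ε)`-separated set with respect to time `T` for the geodesic flow `φ` of `M` on
`ST²`: a finite family of geodesics (each geodesic `c` representing the phase point
`(c 0, ċ 0) ∈ ST²`, of which `t ↦ (c t, ċ t)` is the flow orbit) such that any two distinct
members satisfy `max_{0 ≤ t ≤ T} d(φᵗ v, φᵗ w) > ε`. -/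
def IsSeparated (M : TorusMetric) (ε T : ℝ) (F : Finset (ℝ → ℝ × ℝ)) : Prop :=
  (∀ c ∈ F, M.IsGeodesic c) ∧
    ∀ c₁ ∈ F, ∀ c₂ ∈ F, c₁ ≠ c₂ →
      ∃ t ∈ Set.Icc (0 : ℝ) T, ε < phaseDist (c₁ t, deriv c₁ t) (c₂ t, deriv c₂ t)

/-- `r_T(φ, ε)`: the maximal cardinality of `(φ,ε)`-separated sets with respect to `T`. -/
def sepCount (M : TorusMetric) (ε T : ℝ) : ℝ≥0∞ :=
  ⨆ (F : Finset (ℝ → ℝ × ℝ)) (_ : IsSeparated M ε T F), (F.card : ℝ≥0∞)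

/-- Extended real logarithm of an extended nonnegative real. -/
def elog (x : ℝ≥0∞) : EReal :=
  if x = 0 then ⊥ else if x = ⊤ then ⊤ else ((Real.log x.toReal : ℝ) : EReal)

/-- Bowen's topological entropy `h_top(g)` of the geodesic flow of `g` on `ST²`:
`lim_{ε → 0} limsup_{T → ∞} (1/T) log r_T(φ,ε)`; since `r_T(φ,ε)` is monotone in `ε`,
the limit `ε → 0` is realized as the supremum over `ε > 0`. -/
def topEnt (M : TorusMetric) : EReal :=
  ⨆ (ε : ℝ) (_ : 0 < ε),
    Filter.limsup (fun T : ℝ => ((T⁻¹ : ℝ) : EReal) * elog (sepCount M ε T)) Filter.atTop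

/-- The forward ray `c⁺` of `c` is escaping: `‖c(t)‖ → ∞` as `t → ∞`. -/
def EscapesForward (c : ℝ → ℝ × ℝ) : Prop :=
  Filter.Tendsto (fun t => norm2 (c t)) Filter.atTop Filter.atTop

/-- The backward ray `c⁻` of `c` is escaping: `‖c(-t)‖ → ∞` as `t → ∞`. -/
def EscapesBackward (c : ℝ → ℝ × ℝ) : Prop :=
  Filter.Tendsto (fun t => norm2 (c (-t))) Filter.atTop Filter.atTop

/-- `z ∈ S¹` is the asymptotic direction `δ(c⁺) = lim_{t → ∞} c(t)/‖c(t)‖` of the forward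
ray of `c`. -/
def HasDirection (c : ℝ → ℝ × ℝ) (z : ℝ × ℝ) : Prop :=
  norm2 z = 1 ∧ Filter.Tendsto (fun t => (norm2 (c t))⁻¹ • c t) Filter.atTop (nhds z)

/-- The canonical projection `π : S¹ → P¹(ℝ) ≅ ℝ ∪ {∞}`, sending `(x, y)` to `y/x` if
`x ≠ 0` and to `∞` otherwise; `ℝ ∪ {∞}` is the one-point compactification of `ℝ`. -/
def projPt (z : ℝ × ℝ) : OnePoint ℝ :=
  if z.1 = 0 then OnePoint.infty else ((z.2 / z.1 : ℝ) : OnePoint ℝ)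

/-- `crossDet v w ≠ 0` expresses transversality of two directions in `ℝ²`. -/
def crossDet (v w : ℝ × ℝ) : ℝ := v.1 * w.2 - v.2 * w.1

/-- The set of points at which the curve `c₁` (restricted to parameters in `D₁`) and the
curve `c₂` (restricted to parameters in `D₂`) intersect transversally. -/
def transInter (c₁ c₂ : ℝ → ℝ × ℝ) (D₁ D₂ : Set ℝ) : Set (ℝ × ℝ) :=
  {x | ∃ s ∈ D₁, ∃ t ∈ D₂, c₁ s = x ∧ c₂ t = x ∧ crossDet (deriv c₁ s) (deriv c₂ t) ≠ 0}

/-- The geodesic `c` is an axis of the (nontrivial) translation element `τ_k`: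
`τ_k c(t) = c(t + ℓ)` for some `ℓ` and all `t`. -/
def IsAxisOf (M : TorusMetric) (c : ℝ → ℝ × ℝ) (k : ℤ × ℤ) : Prop :=
  M.IsGeodesic c ∧ k ≠ 0 ∧ ∃ ℓ : ℝ, ∀ t, c (t + ℓ) = c t + lat k

/-- The geodesic `c` is an axis of some nontrivial translation element. -/
def IsAxis (M : TorusMetric) (c : ℝ → ℝ × ℝ) : Prop := ∃ k : ℤ × ℤ, IsAxisOf M c k

/-- The curve `c` is minimal: each of its segments minimizes the Riemannian length between
its endpoints. -/
def IsMinimal (M : TorusMetric) (c : ℝ → ℝ × ℝ) : Prop :=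
  ∀ s t : ℝ, s ≤ t → M.dist (c s) (c t) = M.length c s t

/-- Equivalence of translation elements: `τ₁^a = τ₂^b` for some nonzero integers `a, b`. -/
def TransEquiv (k₁ k₂ : ℤ × ℤ) : Prop := ∃ a b : ℤ, a ≠ 0 ∧ b ≠ 0 ∧ a • k₁ = b • k₂

/-- A translation element is primitive if it is not a nontrivial power of another
translation element. -/
def IsPrimitive (k : ℤ × ℤ) : Prop := k ≠ 0 ∧ ∀ (j : ℤ × ℤ) (n : ℤ), k = n • j → IsUnit n

/-- The metric `g` on `T²` is flat, i.e. its Gaussian curvature vanishes identically;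
equivalently (by the theorems of Myers–Steenrod and Cartan–Hadamard), the universal covering
`ℝ²` with the induced Riemannian distance is isometric to the Euclidean plane. -/
def IsFlat (M : TorusMetric) : Prop :=
  ∃ F : (ℝ × ℝ) ≃ (ℝ × ℝ), ∀ x y, M.dist x y = norm2 (F x - F y)

namespace TorusMetric

section Coefficients

lemma add_left (M : TorusMetric) (x v v' w : ℝ × ℝ) :
    M.g x (v + v') w = M.g x v w + M.g x v' w := (M.linear x w).map_add v v'

lemma smul_left (M : TorusMetric) (x v w : ℝ × ℝ) (a : ℝ) :
    M.g x (a • v) w = a * M.g x v w := (M.linear x w).map_smul a v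

lemma add_right (M : TorusMetric) (x v w w' : ℝ × ℝ) :
    M.g x v (w + w') = M.g x v w + M.g x v w' := by
  rw [M.symm, M.add_left, M.symm x w, M.symm x w']

lemma smul_right (M : TorusMetric) (x v w : ℝ × ℝ) (a : ℝ) :
    M.g x v (a • w) = a * M.g x v w := by
  rw [M.symm, M.smul_left, M.symm x w]

lemma neg_left (M : TorusMetric) (x v w : ℝ × ℝ) : M.g x (-v) w = - M.g x v w := by
  have := M.smul_left x v w (-1); simpa using this

lemma neg_right (M : TorusMetric) (x v w : ℝ × ℝ) : M.g x v (-w) = - M.g x v w := by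
  have := M.smul_right x v w (-1); simpa using this

lemma sub_left (M : TorusMetric) (x v v' w : ℝ × ℝ) :
    M.g x (v - v') w = M.g x v w - M.g x v' w := by
  rw [sub_eq_add_neg, M.add_left, M.neg_left]; ring

lemma sub_right (M : TorusMetric) (x v w w' : ℝ × ℝ) :
    M.g x v (w - w') = M.g x v w - M.g x v w' := by
  rw [sub_eq_add_neg, M.add_right, M.neg_right]; ring

lemma zero_left (M : TorusMetric) (x w : ℝ × ℝ) : M.g x 0 w = 0 := by
  have := M.smul_left x 0 w 0; simpa using this

lemma zero_right (M : TorusMetric) (x w : ℝ × ℝ) : M.g x w 0 = 0 := by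
  rw [M.symm, M.zero_left]

/-- The coefficient `E` of the first fundamental form. -/
def cE (M : TorusMetric) (x : ℝ × ℝ) : ℝ := M.g x (1, 0) (1, 0)
/-- The coefficient `F` of the first fundamental form. -/
def cF (M : TorusMetric) (x : ℝ × ℝ) : ℝ := M.g x (1, 0) (0, 1)
/-- The coefficient `G` of the first fundamental form. -/
def cG (M : TorusMetric) (x : ℝ × ℝ) : ℝ := M.g x (0, 1) (0, 1)

lemma g_eq (M : TorusMetric) (x v w : ℝ × ℝ) :
    M.g x v w = M.cE x * (v.1 * w.1) + M.cF x * (v.1 * w.2 + v.2 * w.1)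
      + M.cG x * (v.2 * w.2) := by
  have hv : v = v.1 • ((1 : ℝ), (0 : ℝ)) + v.2 • ((0 : ℝ), (1 : ℝ)) := by ext <;> simp
  have hw : w = w.1 • ((1 : ℝ), (0 : ℝ)) + w.2 • ((0 : ℝ), (1 : ℝ)) := by ext <;> simp
  conv_lhs => rw [hv, hw]
  simp only [M.add_left, M.add_right, M.smul_left, M.smul_right, cE, cF, cG]
  rw [M.symm x (0, 1) (1, 0)]; ring

lemma contDiff_cE (M : TorusMetric) : ContDiff ℝ (⊤ : ℕ∞) M.cE :=
  M.smooth.comp (contDiff_id.prodMk contDiff_const : ContDiff ℝ (⊤ : ℕ∞)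
    fun x : ℝ × ℝ => (x, ((1 : ℝ), (0 : ℝ)), ((1 : ℝ), (0 : ℝ))))
lemma contDiff_cF (M : TorusMetric) : ContDiff ℝ (⊤ : ℕ∞) M.cF :=
  M.smooth.comp (contDiff_id.prodMk contDiff_const : ContDiff ℝ (⊤ : ℕ∞)
    fun x : ℝ × ℝ => (x, ((1 : ℝ), (0 : ℝ)), ((0 : ℝ), (1 : ℝ))))
lemma contDiff_cG (M : TorusMetric) : ContDiff ℝ (⊤ : ℕ∞) M.cG :=
  M.smooth.comp (contDiff_id.prodMk contDiff_const : ContDiff ℝ (⊤ : ℕ∞)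
    fun x : ℝ × ℝ => (x, ((0 : ℝ), (1 : ℝ)), ((0 : ℝ), (1 : ℝ))))

lemma cE_periodic (M : TorusMetric) (k : ℤ × ℤ) (x : ℝ × ℝ) : M.cE (x + lat k) = M.cE x :=
  M.periodic k x _ _
lemma cF_periodic (M : TorusMetric) (k : ℤ × ℤ) (x : ℝ × ℝ) : M.cF (x + lat k) = M.cF x :=
  M.periodic k x _ _
lemma cG_periodic (M : TorusMetric) (k : ℤ × ℤ) (x : ℝ × ℝ) : M.cG (x + lat k) = M.cG x :=
  M.periodic k x _ _

end Coefficients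

end TorusMetric

lemma exists_lat_sub_mem (x : ℝ × ℝ) :
    ∃ k : ℤ × ℤ, x + lat k ∈ Icc (0 : ℝ) 1 ×ˢ Icc (0 : ℝ) 1 := by
  refine ⟨(-⌊x.1⌋, -⌊x.2⌋), ?_⟩
  have h1 := Int.floor_le x.1
  have h2 := Int.lt_floor_add_one x.1
  have h3 := Int.floor_le x.2
  have h4 := Int.lt_floor_add_one x.2
  simp only [lat, mem_prod, mem_Icc, Prod.fst_add, Prod.snd_add, Int.cast_neg]
  constructor <;> constructor <;> linarith

lemma bounded_of_periodic {F : Type*} [NormedAddCommGroup F] {f : ℝ × ℝ → F}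
    (hf : Continuous f) (hp : ∀ k x, f (x + lat k) = f x) : ∃ C > 0, ∀ x, ‖f x‖ ≤ C := by
  obtain ⟨C, hC⟩ := ((isCompact_Icc (a := (0 : ℝ)) (b := 1)).prod
    (isCompact_Icc (a := (0 : ℝ)) (b := 1))).exists_bound_of_continuousOn hf.continuousOn
  refine ⟨max C 1, by positivity, fun x => ?_⟩
  obtain ⟨k, hk⟩ := exists_lat_sub_mem x
  rw [← hp k x]
  exact (hC _ hk).trans (le_max_left _ _)

lemma lipschitz_of_periodic {f : ℝ × ℝ → ℝ} (hf : ContDiff ℝ (⊤ : ℕ∞) f)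
    (hp : ∀ k x, f (x + lat k) = f x) : ∃ C > 0, ∀ x y, |f x - f y| ≤ C * ‖x - y‖ := by
  have hd : Continuous (fderiv ℝ f) := hf.continuous_fderiv (by simp)
  obtain ⟨C, hC0, hC⟩ := bounded_of_periodic hd (fun k x => by
    have : (fun y => f (y + lat k)) = f := funext (hp k)
    conv_rhs => rw [← this]
    rw [fderiv_comp_add_right])
  refine ⟨C, hC0, fun x y => ?_⟩
  have := Convex.norm_image_sub_le_of_norm_fderiv_le (𝕜 := ℝ) (f := f) (s := univ) (C := C)
    (fun z _ => (hf.differentiable (by simp)).differentiableAt) (fun z _ => hC z) convex_univ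
    (mem_univ y) (mem_univ x)
  simpa using this

lemma abs_fst_le (v : ℝ × ℝ) : |v.1| ≤ ‖v‖ := norm_fst_le v
lemma abs_snd_le (v : ℝ × ℝ) : |v.2| ≤ ‖v‖ := norm_snd_le v

namespace TorusMetric

section Bounds

lemma abs_form_le {a b c C : ℝ} (ha : |a| ≤ C) (hb : |b| ≤ C) (hc : |c| ≤ C) (v w : ℝ × ℝ) :
    |a * (v.1 * w.1) + b * (v.1 * w.2 + v.2 * w.1) + c * (v.2 * w.2)| ≤ 4 * C * (‖v‖ * ‖w‖) := by
  have h (x y z : ℝ) (hx : |x| ≤ C) (hy : |y| ≤ ‖v‖) (hz : |z| ≤ ‖w‖) :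
      |x * (y * z)| ≤ C * (‖v‖ * ‖w‖) := by
    rw [abs_mul, abs_mul]; gcongr
    exact (abs_nonneg x).trans hx
  have h1 := abs_le.1 (h a v.1 w.1 ha (abs_fst_le v) (abs_fst_le w))
  have h2 := abs_le.1 (h b v.1 w.2 hb (abs_fst_le v) (abs_snd_le w))
  have h3 := abs_le.1 (h b v.2 w.1 hb (abs_snd_le v) (abs_fst_le w))
  have h4 := abs_le.1 (h c v.2 w.2 hc (abs_snd_le v) (abs_snd_le w))
  rw [abs_le]; constructor <;> linarith

lemma exists_upper (M : TorusMetric) : ∃ C > 0, ∀ x v w, |M.g x v w| ≤ C * (‖v‖ * ‖w‖) := by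
  obtain ⟨A, hA0, hA⟩ := bounded_of_periodic M.contDiff_cE.continuous M.cE_periodic
  obtain ⟨B, hB0, hB⟩ := bounded_of_periodic M.contDiff_cF.continuous M.cF_periodic
  obtain ⟨C, hC0, hC⟩ := bounded_of_periodic M.contDiff_cG.continuous M.cG_periodic
  refine ⟨4 * (A + B + C), by positivity, fun x v w => ?_⟩
  rw [M.g_eq]
  apply abs_form_le
  · linarith [hA x, Real.norm_eq_abs (M.cE x)]
  · linarith [hB x, Real.norm_eq_abs (M.cF x)]
  · linarith [hC x, Real.norm_eq_abs (M.cG x)]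

lemma exists_lip (M : TorusMetric) :
    ∃ C > 0, ∀ x y v w, |M.g x v w - M.g y v w| ≤ C * ‖x - y‖ * (‖v‖ * ‖w‖) := by
  obtain ⟨A, hA0, hA⟩ := lipschitz_of_periodic M.contDiff_cE M.cE_periodic
  obtain ⟨B, hB0, hB⟩ := lipschitz_of_periodic M.contDiff_cF M.cF_periodic
  obtain ⟨C, hC0, hC⟩ := lipschitz_of_periodic M.contDiff_cG M.cG_periodic
  refine ⟨4 * (A + B + C), by positivity, fun x y v w => ?_⟩
  rw [M.g_eq, M.g_eq]
  have h := abs_form_le (C := (A + B + C) * ‖x - y‖) (a := M.cE x - M.cE y)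
    (b := M.cF x - M.cF y) (c := M.cG x - M.cG y)
    ((hA x y).trans (by gcongr; linarith)) ((hB x y).trans (by gcongr; linarith))
    ((hC x y).trans (by gcongr; linarith)) v w
  calc _ = _ := by congr 1; ring
    _ ≤ _ := h
    _ = _ := by ring

lemma exists_lower (M : TorusMetric) : ∃ c > 0, ∀ x v, c * ‖v‖ ^ 2 ≤ M.g x v v := by
  let S : Set ((ℝ × ℝ) × (ℝ × ℝ)) :=
    (Icc (0 : ℝ) 1 ×ˢ Icc (0 : ℝ) 1) ×ˢ Metric.sphere (0 : ℝ × ℝ) 1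
  have hS : IsCompact S := (isCompact_Icc.prod isCompact_Icc).prod (isCompact_sphere _ _)
  have hne : S.Nonempty := ⟨((0, 0), (1, 0)), by simp [S]⟩
  have hcont : Continuous fun p : (ℝ × ℝ) × (ℝ × ℝ) => M.g p.1 p.2 p.2 :=
    M.smooth.continuous.comp (continuous_fst.prodMk (continuous_snd.prodMk continuous_snd))
  obtain ⟨p, hp, hmin⟩ := hS.exists_isMinOn hne hcont.continuousOn
  have hp2 : p.2 ≠ 0 := by
    intro h; have : ‖p.2‖ = 1 := by simpa using hp.2
    rw [h, norm_zero] at this; norm_num at this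
  refine ⟨M.g p.1 p.2 p.2, M.posdef _ _ hp2, fun x v => ?_⟩
  by_cases hv : v = 0
  · simp [hv, M.zero_left]
  have hv' : 0 < ‖v‖ := norm_pos_iff.2 hv
  obtain ⟨k, hk⟩ := exists_lat_sub_mem x
  have := hmin (show (x + lat k, ‖v‖⁻¹ • v) ∈ S from ⟨hk, by simp [norm_smul, hv]⟩)
  simp only [mem_ofPred_eq] at this
  rw [M.periodic, M.smul_left, M.smul_right] at this
  calc _ ≤ _ := mul_le_mul_of_nonneg_right this (by positivity)
    _ = _ := by field_simp

/-- The norm of the metric at the point `x`. -/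
def nrm (M : TorusMetric) (x v : ℝ × ℝ) : ℝ := √(M.g x v v)

/-- Lower and upper comparison constants with the sup norm, and a Lipschitz constant. -/
lemma exists_consts (M : TorusMetric) : ∃ k : ℝ × ℝ × ℝ, 0 < k.1 ∧ 0 < k.2.1 ∧ 0 < k.2.2 ∧
    (∀ x v, k.1 * ‖v‖ ≤ M.nrm x v) ∧ (∀ x v, M.nrm x v ≤ k.2.1 * ‖v‖) ∧
    (∀ x y v, |M.nrm x v - M.nrm y v| ≤ k.2.2 * ‖x - y‖ * ‖v‖) := by
  obtain ⟨c, hc0, hc⟩ := M.exists_lower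
  obtain ⟨C, hC0, hC⟩ := M.exists_upper
  obtain ⟨L, hL0, hL⟩ := M.exists_lip
  have hlow : ∀ x v, √c * ‖v‖ ≤ M.nrm x v := fun x v => by
    apply Real.le_sqrt_of_sq_le
    rw [mul_pow, Real.sq_sqrt hc0.le]; exact hc x v
  refine ⟨(√c, √C, L / √c), by positivity, by positivity, by positivity, hlow, ?_, ?_⟩
  · intro x v
    rw [nrm, Real.sqrt_le_left (by positivity), mul_pow, Real.sq_sqrt hC0.le]
    have := (le_abs_self _).trans (hC x v v)
    nlinarith
  · intro x y v
    by_cases hv : v = 0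
    · simp [hv, nrm, M.zero_left]
    have hv' : 0 < ‖v‖ := norm_pos_iff.2 hv
    have hx := hlow x v
    have hy := hlow y v
    have hcv : 0 < √c * ‖v‖ := by positivity
    have hmul : (M.nrm x v - M.nrm y v) * (M.nrm x v + M.nrm y v) = M.g x v v - M.g y v v := by
      have h1 : M.nrm x v ^ 2 = M.g x v v := Real.sq_sqrt (M.posdef x v hv).le
      have h2 : M.nrm y v ^ 2 = M.g y v v := Real.sq_sqrt (M.posdef y v hv).le
      rw [← h1, ← h2]; ring
    have h3 := hL x y v v
    rw [← hmul, abs_mul, abs_of_pos (a := M.nrm x v + M.nrm y v) (by linarith)] at h3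
    have h4 : |M.nrm x v - M.nrm y v| * (√c * ‖v‖) ≤ L * ‖x - y‖ * (‖v‖ * ‖v‖) := by
      refine le_trans ?_ h3
      gcongr; linarith
    have h5 : |M.nrm x v - M.nrm y v| ≤ L * ‖x - y‖ * (‖v‖ * ‖v‖) / (√c * ‖v‖) :=
      (le_div_iff₀ hcv).2 h4
    refine h5.trans (le_of_eq ?_)
    field_simp

/-- Lower comparison constant between the metric and the sup norm. -/
def lo (M : TorusMetric) : ℝ := (Classical.choose M.exists_consts).1
/-- Upper comparison constant between the metric and the sup norm. -/
def hi (M : TorusMetric) : ℝ := (Classical.choose M.exists_consts).2.1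
/-- Lipschitz constant of the metric in the base point. -/
def lip (M : TorusMetric) : ℝ := (Classical.choose M.exists_consts).2.2

lemma lo_pos (M : TorusMetric) : 0 < M.lo := (Classical.choose_spec M.exists_consts).1
lemma hi_pos (M : TorusMetric) : 0 < M.hi := (Classical.choose_spec M.exists_consts).2.1
lemma lip_pos (M : TorusMetric) : 0 < M.lip := (Classical.choose_spec M.exists_consts).2.2.1
lemma lo_le (M : TorusMetric) (x v : ℝ × ℝ) : M.lo * ‖v‖ ≤ M.nrm x v :=
  (Classical.choose_spec M.exists_consts).2.2.2.1 x v
lemma le_hi (M : TorusMetric) (x v : ℝ × ℝ) : M.nrm x v ≤ M.hi * ‖v‖ :=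
  (Classical.choose_spec M.exists_consts).2.2.2.2.1 x v
lemma nrm_lip (M : TorusMetric) (x y v : ℝ × ℝ) :
    |M.nrm x v - M.nrm y v| ≤ M.lip * ‖x - y‖ * ‖v‖ :=
  (Classical.choose_spec M.exists_consts).2.2.2.2.2 x y v

lemma g_nonneg (M : TorusMetric) (x v : ℝ × ℝ) : 0 ≤ M.g x v v := by
  by_cases hv : v = 0
  · simp [hv, M.zero_left]
  · exact (M.posdef x v hv).le

lemma nrm_nonneg (M : TorusMetric) (x v : ℝ × ℝ) : 0 ≤ M.nrm x v := Real.sqrt_nonneg _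

lemma nrm_sq (M : TorusMetric) (x v : ℝ × ℝ) : M.nrm x v ^ 2 = M.g x v v :=
  Real.sq_sqrt (M.g_nonneg x v)

lemma nrm_smul (M : TorusMetric) (x v : ℝ × ℝ) (a : ℝ) : M.nrm x (a • v) = |a| * M.nrm x v := by
  rw [nrm, M.smul_left, M.smul_right, ← mul_assoc, Real.sqrt_mul (mul_self_nonneg a),
    Real.sqrt_mul_self_eq_abs, nrm]

lemma nrm_neg (M : TorusMetric) (x v : ℝ × ℝ) : M.nrm x (-v) = M.nrm x v := by
  rw [nrm, M.neg_left, M.neg_right, neg_neg, nrm]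

lemma cauchy_schwarz (M : TorusMetric) (x v w : ℝ × ℝ) :
    M.g x v w ≤ M.nrm x v * M.nrm x w := by
  by_cases hv : v = 0
  · simp [hv, M.zero_left, nrm]
  by_cases hw : w = 0
  · simp [hw, M.zero_right, nrm]
  have h1 : 0 < M.nrm x v := Real.sqrt_pos.2 (M.posdef x v hv)
  have h2 : 0 < M.nrm x w := Real.sqrt_pos.2 (M.posdef x w hw)
  have h := M.g_nonneg x (M.nrm x w • v - M.nrm x v • w)
  simp only [M.sub_left, M.sub_right, M.smul_left, M.smul_right, ← M.nrm_sq] at h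
  rw [M.symm x w v] at h
  have : 0 ≤ (2 * (M.nrm x v * M.nrm x w)) * (M.nrm x v * M.nrm x w - M.g x v w) := by
    nlinarith
  have := (mul_nonneg_iff_of_pos_left (by positivity)).1 this
  linarith

lemma continuous_g (M : TorusMetric) {X : Type*} [TopologicalSpace X] {a v w : X → ℝ × ℝ}
    (ha : Continuous a) (hv : Continuous v) (hw : Continuous w) :
    Continuous fun t => M.g (a t) (v t) (w t) :=
  M.smooth.continuous.comp (ha.prodMk (hv.prodMk hw))

lemma continuous_nrm (M : TorusMetric) {X : Type*} [TopologicalSpace X] {a v : X → ℝ × ℝ}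
    (ha : Continuous a) (hv : Continuous v) : Continuous fun t => M.nrm (a t) (v t) :=
  (M.continuous_g ha hv hv).sqrt

end Bounds

end TorusMetric

namespace TorusMetric

section Length

lemma length_def (M : TorusMetric) (c : ℝ → ℝ × ℝ) (a b : ℝ) :
    M.length c a b = ∫ t in a..b, M.nrm (c t) (deriv c t) := rfl

lemma continuous_speed (M : TorusMetric) {c : ℝ → ℝ × ℝ} (hc : ContDiff ℝ 1 c) :
    Continuous fun t => M.nrm (c t) (deriv c t) :=
  M.continuous_nrm hc.continuous (hc.continuous_deriv le_rfl)

lemma length_add (M : TorusMetric) {c : ℝ → ℝ × ℝ} (hc : ContDiff ℝ 1 c) (a b e : ℝ) :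
    M.length c a b + M.length c b e = M.length c a e :=
  intervalIntegral.integral_add_adjacent_intervals
    ((M.continuous_speed hc).intervalIntegrable _ _)
    ((M.continuous_speed hc).intervalIntegrable _ _)

lemma length_nonneg (M : TorusMetric) (c : ℝ → ℝ × ℝ) {a b : ℝ} (h : a ≤ b) :
    0 ≤ M.length c a b :=
  intervalIntegral.integral_nonneg h fun _ _ => M.nrm_nonneg _ _

lemma integral_deriv (c : ℝ → ℝ × ℝ) (hc : ContDiff ℝ 1 c) (a b : ℝ) :
    ∫ t in a..b, deriv c t = c b - c a :=
  intervalIntegral.integral_deriv_eq_sub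
    (fun _ _ => (hc.differentiable one_ne_zero).differentiableAt)
    ((hc.continuous_deriv le_rfl).intervalIntegrable _ _)

lemma lo_mul_norm_le_length (M : TorusMetric) {c : ℝ → ℝ × ℝ} (hc : ContDiff ℝ 1 c) {a b : ℝ}
    (h : a ≤ b) : M.lo * ‖c b - c a‖ ≤ M.length c a b := by
  have h1 : ‖c b - c a‖ ≤ ∫ t in a..b, ‖deriv c t‖ := by
    rw [← integral_deriv c hc]; exact intervalIntegral.norm_integral_le_integral_norm h
  calc M.lo * ‖c b - c a‖ ≤ M.lo * ∫ t in a..b, ‖deriv c t‖ := by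
        gcongr; exact M.lo_pos.le
    _ = ∫ t in a..b, M.lo * ‖deriv c t‖ := by rw [intervalIntegral.integral_const_mul]
    _ ≤ M.length c a b := by
        apply intervalIntegral.integral_mono_on h
        · exact ((hc.continuous_deriv le_rfl).norm.const_mul _ |>.intervalIntegrable _ _)
        · exact (M.continuous_speed hc).intervalIntegrable _ _
        · intro t _; exact M.lo_le _ _

lemma length_comp (M : TorusMetric) {c : ℝ → ℝ × ℝ} (hc : ContDiff ℝ 1 c) {σ : ℝ → ℝ}
    (hσ : ContDiff ℝ 1 σ) (hm : Monotone σ) (a b : ℝ) :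
    M.length (c ∘ σ) a b = M.length c (σ a) (σ b) := by
  have hd : ∀ t, HasDerivAt σ (deriv σ t) t := fun t =>
    ((hσ.differentiable one_ne_zero).differentiableAt).hasDerivAt
  rw [length_def, length_def, ← intervalIntegral.integral_comp_mul_deriv (fun t _ => hd t)
    (hσ.continuous_deriv le_rfl).continuousOn (M.continuous_speed hc)]
  congr 1; ext t
  have h1 : deriv (c ∘ σ) t = deriv σ t • deriv c (σ t) :=
    (((hc.differentiable one_ne_zero).differentiableAt.hasDerivAt).scomp t (hd t)).deriv
  rw [h1, M.nrm_smul, abs_of_nonneg (hm.deriv_nonneg), mul_comm]; rfl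

lemma length_congr (M : TorusMetric) {c c' : ℝ → ℝ × ℝ} {a b : ℝ} (hab : a ≤ b)
    (h : ∀ t ∈ Ioo a b, c t = c' t) : M.length c a b = M.length c' a b := by
  apply intervalIntegral.integral_congr_Ioo_of_le hab
  intro t ht
  have : c =ᶠ[𝓝 t] c' := by
    filter_upwards [isOpen_Ioo.mem_nhds ht] with s hs using h s hs
  simp only [h t ht, this.deriv_eq]

lemma length_add_const (M : TorusMetric) (c : ℝ → ℝ × ℝ) (k : ℤ × ℤ) (a b : ℝ) :
    M.length (fun t => c t + lat k) a b = M.length c a b := by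
  simp only [length_def, nrm, M.periodic]
  congr 1; ext t; rw [deriv_add_const]

end Length

section Dist

lemma bddBelow_lengths (M : TorusMetric) (x y : ℝ × ℝ) : BddBelow
    {L | ∃ c : ℝ → ℝ × ℝ, ContDiff ℝ 1 c ∧ c 0 = x ∧ c 1 = y ∧ L = M.length c 0 1} := by
  refine ⟨0, ?_⟩
  rintro L ⟨c, -, -, -, rfl⟩
  exact M.length_nonneg c zero_le_one

/-- The straight segment. -/
lemma exists_straight (x y : ℝ × ℝ) : ∃ c : ℝ → ℝ × ℝ, ContDiff ℝ 1 c ∧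
    c 0 = x ∧ c 1 = y ∧ (∀ t, c t = x + t • (y - x)) ∧ ∀ t, deriv c t = y - x := by
  refine ⟨fun t => x + t • (y - x), by fun_prop, by simp, by simp, fun _ => rfl, fun t => ?_⟩
  have : HasDerivAt (fun t : ℝ => x + t • (y - x)) ((1 : ℝ) • (y - x)) t :=
    ((hasDerivAt_id t).smul_const _).const_add _
  simpa using this.deriv

lemma lengths_nonempty (M : TorusMetric) (x y : ℝ × ℝ) : Set.Nonempty
    {L | ∃ c : ℝ → ℝ × ℝ, ContDiff ℝ 1 c ∧ c 0 = x ∧ c 1 = y ∧ L = M.length c 0 1} := by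
  obtain ⟨c, h1, h2, h3, -⟩ := exists_straight x y
  exact ⟨_, c, h1, h2, h3, rfl⟩

lemma dist_le_of_curve (M : TorusMetric) {c : ℝ → ℝ × ℝ} (hc : ContDiff ℝ 1 c) :
    M.dist (c 0) (c 1) ≤ M.length c 0 1 :=
  csInf_le (M.bddBelow_lengths _ _) ⟨c, hc, rfl, rfl, rfl⟩

lemma dist_le_length (M : TorusMetric) {c : ℝ → ℝ × ℝ} (hc : ContDiff ℝ 1 c) {a b : ℝ}
    (h : a ≤ b) : M.dist (c a) (c b) ≤ M.length c a b := by
  have hσ : ContDiff ℝ 1 (fun t : ℝ => a + (b - a) * t) := by fun_prop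
  have hm : Monotone (fun t : ℝ => a + (b - a) * t) := fun s t hst => by
    have := mul_le_mul_of_nonneg_left hst (sub_nonneg.2 h); simpa using this
  have h1 := M.dist_le_of_curve (hc.comp hσ)
  rw [M.length_comp hc hσ hm] at h1
  simpa using h1

lemma exists_curve (M : TorusMetric) (x y : ℝ × ℝ) {ε : ℝ} (hε : 0 < ε) :
    ∃ c : ℝ → ℝ × ℝ, ContDiff ℝ 1 c ∧ c 0 = x ∧ c 1 = y ∧ M.length c 0 1 < M.dist x y + ε := by
  obtain ⟨L, ⟨c, h1, h2, h3, rfl⟩, h⟩ := Real.lt_sInf_add_pos (M.lengths_nonempty x y) hε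
  exact ⟨c, h1, h2, h3, h⟩

lemma dist_nonneg (M : TorusMetric) (x y : ℝ × ℝ) : 0 ≤ M.dist x y := by
  apply Real.sInf_nonneg
  rintro L ⟨c, -, -, -, rfl⟩
  exact M.length_nonneg c zero_le_one

lemma lo_le_dist (M : TorusMetric) (x y : ℝ × ℝ) : M.lo * ‖x - y‖ ≤ M.dist x y := by
  apply le_csInf (M.lengths_nonempty x y)
  rintro L ⟨c, h, rfl, rfl, rfl⟩
  rw [norm_sub_rev]
  exact M.lo_mul_norm_le_length h zero_le_one

lemma length_le_of_nrm_le (M : TorusMetric) {c : ℝ → ℝ × ℝ} (hc : ContDiff ℝ 1 c) {C : ℝ}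
    (h : ∀ t ∈ Icc (0 : ℝ) 1, M.nrm (c t) (deriv c t) ≤ C) : M.length c 0 1 ≤ C := by
  have : M.length c 0 1 ≤ ∫ _ in (0 : ℝ)..1, C := by
    apply intervalIntegral.integral_mono_on zero_le_one
    · exact (M.continuous_speed hc).intervalIntegrable _ _
    · exact intervalIntegrable_const
    · exact h
  simpa using this

lemma dist_le_hi (M : TorusMetric) (x y : ℝ × ℝ) : M.dist x y ≤ M.hi * ‖x - y‖ := by
  obtain ⟨c, h1, rfl, rfl, -, h4⟩ := exists_straight x y
  refine (M.dist_le_of_curve h1).trans (M.length_le_of_nrm_le h1 fun t _ => ?_)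
  refine (M.le_hi _ _).trans_eq ?_
  rw [h4, norm_sub_rev]

lemma dist_self (M : TorusMetric) (x : ℝ × ℝ) : M.dist x x = 0 :=
  le_antisymm (by simpa using M.dist_le_hi x x) (M.dist_nonneg _ _)

lemma eq_of_dist_le_zero (M : TorusMetric) {x y : ℝ × ℝ} (h : M.dist x y ≤ 0) : x = y := by
  have h1 := (M.lo_le_dist x y).trans h
  have : ‖x - y‖ ≤ 0 := by
    by_contra hn; push Not at hn
    linarith [mul_pos M.lo_pos hn]
  exact sub_eq_zero.1 (norm_le_zero_iff.1 this)

lemma length_reverse (M : TorusMetric) (c : ℝ → ℝ × ℝ) :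
    M.length (fun t => c (1 - t)) 0 1 = M.length c 0 1 := by
  rw [length_def, length_def]
  have := intervalIntegral.integral_comp_sub_left (a := 0) (b := 1)
    (fun t => M.nrm (c t) (deriv c t)) 1
  simp only [sub_self, sub_zero] at this
  rw [← this]
  congr 1; ext t
  rw [deriv_comp_const_sub, M.nrm_neg]

lemma dist_comm (M : TorusMetric) (x y : ℝ × ℝ) : M.dist x y = M.dist y x := by
  have key : ∀ x y, M.dist x y ≤ M.dist y x := fun x y => by
    apply le_csInf (M.lengths_nonempty y x)
    rintro L ⟨c, h, rfl, rfl, rfl⟩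
    have := M.dist_le_of_curve (c := fun t => c (1 - t)) (h.comp (by fun_prop))
    rw [M.length_reverse] at this
    simpa using this
  exact le_antisymm (key x y) (key y x)

lemma dist_triangle (M : TorusMetric) (x y z : ℝ × ℝ) :
    M.dist x z ≤ M.dist x y + M.dist y z := by
  apply le_of_forall_pos_le_add
  intro ε hε
  obtain ⟨c, hc, hc0, hc1, hcl⟩ := M.exists_curve x y (half_pos hε)
  obtain ⟨e, he, he0, he1, hel⟩ := M.exists_curve y z (half_pos hε)
  let S := Real.smoothTransition
  have hS : ContDiff ℝ 1 S := Real.smoothTransition.contDiff (n := 1)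
  have hσ : ContDiff ℝ 1 fun t : ℝ => S (2 * t) := hS.comp (by fun_prop)
  have hσ' : ContDiff ℝ 1 fun t : ℝ => S (2 * t - 1) := hS.comp (by fun_prop)
  have hm : Monotone fun t : ℝ => S (2 * t) := fun s t h =>
    Real.smoothTransition.monotone (by linarith)
  have hm' : Monotone fun t : ℝ => S (2 * t - 1) := fun s t h =>
    Real.smoothTransition.monotone (by linarith)
  let f : ℝ → ℝ × ℝ := fun t => c (S (2 * t)) + e (S (2 * t - 1)) - y
  have hf : ContDiff ℝ 1 f := ((hc.comp hσ).add (he.comp hσ')).sub contDiff_const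
  have S0 : ∀ t, t ≤ 0 → S t = 0 := fun t h => Real.smoothTransition.zero_of_nonpos h
  have S1 : ∀ t, 1 ≤ t → S t = 1 := fun t h => Real.smoothTransition.one_of_one_le h
  have h1 : M.length f 0 (1 / 2) = M.length c 0 1 := by
    rw [M.length_congr (c' := c ∘ fun t => S (2 * t)) (by norm_num), M.length_comp hc hσ hm,
      S0 _ (by norm_num), S1 _ (by norm_num)]
    intro t ht
    simp only [f, Function.comp]
    rw [S0 (2 * t - 1) (by linarith [ht.2]), he0]; abel
  have h2 : M.length f (1 / 2) 1 = M.length e 0 1 := by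
    rw [M.length_congr (c' := e ∘ fun t => S (2 * t - 1)) (by norm_num), M.length_comp he hσ' hm',
      S0 _ (by norm_num), S1 _ (by norm_num)]
    intro t ht
    simp only [f, Function.comp]
    rw [S1 (2 * t) (by linarith [ht.1]), hc1]; abel
  have h3 := M.dist_le_of_curve hf
  rw [← M.length_add hf 0 (1 / 2) 1, h1, h2] at h3
  have hf0 : f 0 = x := by
    simp only [f]; rw [S0 _ (by norm_num), S0 _ (by norm_num), hc0, he0]; abel
  have hf1 : f 1 = z := by
    simp only [f]; rw [S1 _ (by norm_num), S1 _ (by norm_num), hc1, he1]; abel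
  rw [hf0, hf1] at h3
  linarith

lemma dist_add_lat (M : TorusMetric) (k : ℤ × ℤ) (x y : ℝ × ℝ) :
    M.dist (x + lat k) (y + lat k) = M.dist x y := by
  have key : ∀ (k : ℤ × ℤ) x y, M.dist (x + lat k) (y + lat k) ≤ M.dist x y := fun k x y => by
    apply le_csInf (M.lengths_nonempty x y)
    rintro L ⟨c, h, rfl, rfl, rfl⟩
    rw [← M.length_add_const c k]
    exact M.dist_le_of_curve (c := fun t => c t + lat k) (h.add contDiff_const)
  refine le_antisymm (key k x y) ?_
  have h := key (-k) (x + lat k) (y + lat k)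
  have e : lat (-k) = - lat k := by ext <;> simp [lat]
  simpa [e] using h

lemma abs_dist_sub_le (M : TorusMetric) (x y x' y' : ℝ × ℝ) :
    |M.dist x y - M.dist x' y'| ≤ M.hi * (‖x - x'‖ + ‖y - y'‖) := by
  have h1 := M.dist_triangle x x' y
  have h2 := M.dist_triangle x' y' y
  have h3 := M.dist_triangle x' x y'
  have h4 := M.dist_triangle x y y'
  have h5 := M.dist_le_hi x x'
  have h6 := M.dist_le_hi y y'
  rw [M.dist_comm x' x] at h3
  rw [M.dist_comm y' y] at h2
  rw [abs_le]; constructor <;> linarith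

lemma continuous_dist (M : TorusMetric) :
    Continuous fun p : (ℝ × ℝ) × (ℝ × ℝ) => M.dist p.1 p.2 := by
  have : LipschitzWith (Real.toNNReal (2 * M.hi)) fun p : (ℝ × ℝ) × (ℝ × ℝ) => M.dist p.1 p.2 := by
    apply LipschitzWith.of_dist_le_mul
    intro p q
    rw [Real.coe_toNNReal _ (by linarith [M.hi_pos]), Real.dist_eq, dist_eq_norm]
    refine (M.abs_dist_sub_le _ _ _ _).trans ?_
    have h1 : ‖p.1 - q.1‖ ≤ ‖p - q‖ := norm_fst_le (p - q)
    have h2 : ‖p.2 - q.2‖ ≤ ‖p - q‖ := norm_snd_le (p - q)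
    nlinarith [M.hi_pos]
  exact this.continuous

lemma tendsto_dist (M : TorusMetric) {ι : Type*} {l : Filter ι} {u v : ι → ℝ × ℝ} {x y : ℝ × ℝ}
    (hu : Tendsto u l (𝓝 x)) (hv : Tendsto v l (𝓝 y)) :
    Tendsto (fun i => M.dist (u i) (v i)) l (𝓝 (M.dist x y)) := by
  have h := (M.continuous_dist.tendsto (x, y)).comp (hu.prodMk_nhds hv)
  simp only [Function.comp_def] at h
  exact h

end Dist

end TorusMetric

/-- A fixed free ultrafilter on `ℕ`, used to extract limits. -/
abbrev ulf : Filter ℕ := ((hyperfilter ℕ : Ultrafilter ℕ) : Filter ℕ)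

lemma ulf_le_atTop : ulf ≤ atTop := Nat.hyperfilter_le_atTop

lemma exists_ulim {E : Type*} [NormedAddCommGroup E] [ProperSpace E] {u : ℕ → E} {C : ℝ}
    (h : ∀ᶠ n in ulf, ‖u n‖ ≤ C) : ∃ x, Tendsto u ulf (𝓝 x) := by
  obtain ⟨x, -, hx⟩ := (isCompact_closedBall (0 : E) C).ultrafilter_le_nhds
    ((hyperfilter ℕ).map u) (by
      rw [le_principal_iff, Ultrafilter.coe_map, mem_map]
      filter_upwards [h] with n hn
      simpa using hn)
  exact ⟨x, hx⟩

namespace TorusMetric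

section LocalEstimate

lemma lo_le_hi (M : TorusMetric) : M.lo ≤ M.hi := by
  have h1 := M.lo_le 0 (1, 0)
  have h2 := M.le_hi 0 (1, 0)
  have : ‖((1 : ℝ), (0 : ℝ))‖ = 1 := by simp [Prod.norm_def]
  rw [this] at h1 h2; linarith

lemma nrm_le_integral (M : TorusMetric) (p : ℝ × ℝ) {c : ℝ → ℝ × ℝ} (hc : ContDiff ℝ 1 c) :
    M.nrm p (c 1 - c 0) ≤ ∫ t in (0 : ℝ)..1, M.nrm p (deriv c t) := by
  set v := c 1 - c 0 with hv
  have hcd : Continuous (deriv c) := hc.continuous_deriv le_rfl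
  by_cases h0 : M.nrm p v = 0
  · rw [h0]; exact intervalIntegral.integral_nonneg zero_le_one fun _ _ => M.nrm_nonneg _ _
  have hpos : 0 < M.nrm p v := lt_of_le_of_ne (M.nrm_nonneg _ _) (Ne.symm h0)
  let L : (ℝ × ℝ) →L[ℝ] ℝ := LinearMap.toContinuousLinearMap
    { toFun := fun w => M.g p v w, map_add' := M.add_right p v,
      map_smul' := fun a w => by simpa using M.smul_right p v w a }
  have hL : ∀ w, L w = M.g p v w := fun w => rfl
  have h1 : M.g p v v = ∫ t in (0 : ℝ)..1, M.g p v (deriv c t) := by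
    have := L.intervalIntegral_comp_comm (hcd.intervalIntegrable (μ := MeasureTheory.volume) 0 1)
    rw [integral_deriv c hc, hL, ← hv] at this
    rw [← this]; rfl
  have h2 : M.g p v v ≤ M.nrm p v * ∫ t in (0 : ℝ)..1, M.nrm p (deriv c t) := by
    rw [h1, ← intervalIntegral.integral_const_mul]
    apply intervalIntegral.integral_mono_on zero_le_one
    · exact (M.continuous_g continuous_const continuous_const hcd).intervalIntegrable _ _
    · exact ((M.continuous_nrm continuous_const hcd).const_mul _).intervalIntegrable _ _
    · intro t _; exact M.cauchy_schwarz _ _ _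
  rw [← M.nrm_sq, sq] at h2
  exact le_of_mul_le_mul_left h2 hpos

/-- Constant in the local comparison of the distance with the norms of the metric. -/
def lc (M : TorusMetric) : ℝ := M.lip * (M.hi / M.lo) ^ 2

lemma lc_pos (M : TorusMetric) : 0 < M.lc := by
  have := M.lip_pos; have := M.lo_pos; have := M.hi_pos; unfold lc; positivity

lemma nrm_le_of_curve (M : TorusMetric) (p x y : ℝ × ℝ) {ε : ℝ} (hε : 0 < ε) :
    M.nrm p (y - x) ≤ (M.dist x y + ε) +
      M.lip * (‖x - p‖ + (M.dist x y + ε) / M.lo) * ((M.dist x y + ε) / M.lo) := by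
  obtain ⟨c, hc, rfl, rfl, hl⟩ := M.exists_curve x y hε
  set D := M.dist (c 0) (c 1) + ε
  have hlo := M.lo_pos
  have hcd : Continuous (deriv c) := hc.continuous_deriv le_rfl
  have hI : ∫ t in (0 : ℝ)..1, ‖deriv c t‖ ≤ D / M.lo := by
    rw [le_div_iff₀ hlo, mul_comm, ← intervalIntegral.integral_const_mul]
    refine le_trans ?_ hl.le
    apply intervalIntegral.integral_mono_on zero_le_one
    · exact (hcd.norm.const_mul _).intervalIntegrable _ _
    · exact (M.continuous_speed hc).intervalIntegrable _ _
    · intro t _; exact M.lo_le _ _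
  have hR : ∀ t ∈ Icc (0 : ℝ) 1, ‖c t - p‖ ≤ ‖c 0 - p‖ + D / M.lo := by
    intro t ht
    have h1 := M.lo_mul_norm_le_length hc ht.1
    have h2 := M.length_add hc 0 t 1
    have h3 := M.length_nonneg c ht.2
    have h4 : ‖c t - c 0‖ ≤ D / M.lo := by rw [le_div_iff₀ hlo]; linarith
    calc ‖c t - p‖ = ‖(c t - c 0) + (c 0 - p)‖ := by congr 1; abel
      _ ≤ _ := norm_add_le _ _
      _ ≤ _ := by linarith
  set R := ‖c 0 - p‖ + D / M.lo
  have hD : 0 ≤ D / M.lo :=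
    div_nonneg (by have := M.dist_nonneg (c 0) (c 1); simp only [D]; linarith) hlo.le
  have hR0 : 0 ≤ R := by positivity
  refine (M.nrm_le_integral p hc).trans ?_
  calc ∫ t in (0 : ℝ)..1, M.nrm p (deriv c t)
      ≤ ∫ t in (0 : ℝ)..1, (M.nrm (c t) (deriv c t) + M.lip * R * ‖deriv c t‖) := by
        apply intervalIntegral.integral_mono_on zero_le_one
        · exact (M.continuous_nrm continuous_const hcd).intervalIntegrable _ _
        · exact ((M.continuous_speed hc).add (hcd.norm.const_mul _)).intervalIntegrable _ _
        · intro t ht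
          have h1 := (abs_le.1 (M.nrm_lip (c t) p (deriv c t))).1
          have h2 : M.lip * ‖c t - p‖ * ‖deriv c t‖ ≤ M.lip * R * ‖deriv c t‖ := by
            gcongr
            · exact M.lip_pos.le
            · exact hR t ht
          linarith
    _ = M.length c 0 1 + M.lip * R * ∫ t in (0 : ℝ)..1, ‖deriv c t‖ := by
        rw [intervalIntegral.integral_add, intervalIntegral.integral_const_mul]; rfl
        · exact (M.continuous_speed hc).intervalIntegrable _ _
        · exact (hcd.norm.const_mul _).intervalIntegrable _ _
    _ ≤ D + M.lip * R * (D / M.lo) := by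
        have := M.lip_pos
        gcongr

lemma abs_dist_sub_nrm_le (M : TorusMetric) (p x y : ℝ × ℝ) :
    |M.dist x y - M.nrm p (y - x)| ≤ M.lc * (‖x - p‖ + ‖x - y‖) * ‖x - y‖ := by
  have hlo := M.lo_pos
  have hhi := M.hi_pos
  have hlip := M.lip_pos
  have hr : 1 ≤ M.hi / M.lo := (one_le_div hlo).2 M.lo_le_hi
  have hlc : M.lip ≤ M.lc := by
    have : (1 : ℝ) ≤ (M.hi / M.lo) ^ 2 := one_le_pow₀ hr
    have := mul_le_mul_of_nonneg_left this hlip.le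
    rw [mul_one] at this; exact this
  rw [abs_le]
  constructor
  · have h1 : M.nrm p (y - x) ≤ M.dist x y +
        M.lip * (‖x - p‖ + M.dist x y / M.lo) * (M.dist x y / M.lo) := by
      have hc : Continuous fun ε : ℝ => (M.dist x y + ε) +
        M.lip * (‖x - p‖ + (M.dist x y + ε) / M.lo) * ((M.dist x y + ε) / M.lo) := by fun_prop
      have ht := (hc.tendsto 0).mono_left (nhdsWithin_le_nhds (s := Ioi 0))
      simp only [add_zero] at ht
      refine ge_of_tendsto ht ?_
      filter_upwards [self_mem_nhdsWithin] with ε hε using M.nrm_le_of_curve p x y hε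
    have h2 : M.dist x y / M.lo ≤ M.hi / M.lo * ‖x - y‖ := by
      rw [div_mul_eq_mul_div]; gcongr; exact M.dist_le_hi x y
    have h0 : 0 ≤ M.dist x y / M.lo := div_nonneg (M.dist_nonneg _ _) hlo.le
    have h3 : M.lip * (‖x - p‖ + M.dist x y / M.lo) * (M.dist x y / M.lo) ≤
        M.lip * (M.hi / M.lo * ‖x - p‖ + M.hi / M.lo * ‖x - y‖) * (M.hi / M.lo * ‖x - y‖) := by
      gcongr
      nlinarith [norm_nonneg (x - p)]
    have h4 : M.lip * (M.hi / M.lo * ‖x - p‖ + M.hi / M.lo * ‖x - y‖) * (M.hi / M.lo * ‖x - y‖)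
      = M.lc * (‖x - p‖ + ‖x - y‖) * ‖x - y‖ := by unfold lc; ring
    linarith
  · obtain ⟨c, h1, rfl, rfl, h5, h4⟩ := exists_straight x y
    have h6 : M.dist (c 0) (c 1) ≤ M.nrm p (c 1 - c 0) +
        M.lip * (‖c 0 - p‖ + ‖c 0 - c 1‖) * ‖c 0 - c 1‖ := by
      refine (M.dist_le_of_curve h1).trans (M.length_le_of_nrm_le h1 fun t ht => ?_)
      rw [h4]
      have h7 := (abs_le.1 (M.nrm_lip (c t) p (c 1 - c 0))).2
      have h8 : ‖c t - p‖ ≤ ‖c 0 - p‖ + ‖c 0 - c 1‖ := by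
        rw [h5 t]
        calc ‖c 0 + t • (c 1 - c 0) - p‖ = ‖(c 0 - p) + t • (c 1 - c 0)‖ := by congr 1; abel
          _ ≤ ‖c 0 - p‖ + ‖t • (c 1 - c 0)‖ := norm_add_le _ _
          _ ≤ _ := by
            rw [norm_smul, norm_sub_rev (c 1), Real.norm_eq_abs, abs_of_nonneg ht.1]
            nlinarith [norm_nonneg (c 0 - c 1), ht.2]
      have h9 : M.lip * ‖c t - p‖ * ‖c 1 - c 0‖ ≤
          M.lip * (‖c 0 - p‖ + ‖c 0 - c 1‖) * ‖c 0 - c 1‖ := by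
        rw [norm_sub_rev (c 1)]; gcongr
      linarith
    have h7 : M.lip * (‖c 0 - p‖ + ‖c 0 - c 1‖) * ‖c 0 - c 1‖ ≤
       M.lc * (‖c 0 - p‖ + ‖c 0 - c 1‖) * ‖c 0 - c 1‖ := by gcongr
    linarith

end LocalEstimate

section Segments

/-- Existence of minimal segments: any two points are joined by an isometric path. -/
lemma exists_segment (M : TorusMetric) (x y : ℝ × ℝ) : ∃ γ : ℝ → ℝ × ℝ,
    γ 0 = x ∧ γ (M.dist x y) = y ∧
    ∀ s ∈ Icc 0 (M.dist x y), ∀ t ∈ Icc 0 (M.dist x y), M.dist (γ s) (γ t) = |s - t| := by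
  set D := M.dist x y with hD
  have hD0 : 0 ≤ D := M.dist_nonneg _ _
  choose c hc h0 h1 hl using fun n : ℕ =>
    M.exists_curve x y (ε := 1 / ((n : ℝ) + 1)) (by positivity)
  have hivt : ∀ (n : ℕ) (a : ℝ), ∃ t ∈ Icc (0 : ℝ) 1, a ∈ Icc 0 D → M.length (c n) 0 t = a := by
    intro n a
    by_cases ha : a ∈ Icc 0 D
    · have hcont : ContinuousOn (fun t => M.length (c n) 0 t) (Icc 0 1) :=
        (intervalIntegral.continuous_primitive
          (fun a b => (M.continuous_speed (hc n)).intervalIntegrable a b) 0).continuousOn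
      have := intermediate_value_Icc zero_le_one hcont
      have hm : a ∈ Icc (M.length (c n) 0 0) (M.length (c n) 0 1) := by
        constructor
        · simpa [length_def] using ha.1
        · refine ha.2.trans ?_
          have := M.dist_le_of_curve (hc n); rwa [h0, h1] at this
      obtain ⟨t, ht, h⟩ := this hm
      exact ⟨t, ht, fun _ => h⟩
    · exact ⟨0, by simp, fun h => absurd h ha⟩
  choose τ hτ hτl using hivt
  have hz : ∀ n a b, a ∈ Icc 0 D → b ∈ Icc 0 D → M.dist (c n (τ n a)) (c n (τ n b)) ≤ |a - b| := by
    intro n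
    have key : ∀ a b, a ∈ Icc 0 D → b ∈ Icc 0 D → τ n a ≤ τ n b →
        M.dist (c n (τ n a)) (c n (τ n b)) ≤ |a - b| := by
      intro a b ha hb h
      refine (M.dist_le_length (hc n) h).trans ?_
      have := M.length_add (hc n) 0 (τ n a) (τ n b)
      rw [hτl n a ha, hτl n b hb] at this
      rw [abs_sub_comm]; exact (le_abs_self _).trans' (by linarith)
    intro a b ha hb
    rcases le_total (τ n a) (τ n b) with h | h
    · exact key a b ha hb h
    · rw [M.dist_comm, abs_sub_comm]; exact key b a hb ha h
  have hx : ∀ n a, a ∈ Icc 0 D → M.dist x (c n (τ n a)) ≤ a := by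
    intro n a ha
    have := M.dist_le_length (hc n) (hτ n a).1
    rwa [h0, hτl n a ha] at this
  have hy : ∀ n a, a ∈ Icc 0 D → M.dist (c n (τ n a)) y ≤ D + 1 / ((n : ℝ) + 1) - a := by
    intro n a ha
    have h2 := M.dist_le_length (hc n) (hτ n a).2
    have h3 := M.length_add (hc n) 0 (τ n a) 1
    rw [hτl n a ha] at h3
    rw [h1] at h2
    linarith [hl n]
  have hlim : ∀ a, ∃ z, a ∈ Icc 0 D → Tendsto (fun n => c n (τ n a)) ulf (𝓝 z) := by
    intro a
    by_cases ha : a ∈ Icc 0 D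
    · obtain ⟨z, hz⟩ := exists_ulim (u := fun n => c n (τ n a)) (C := ‖x‖ + a / M.lo)
        (Eventually.of_forall fun n => by
          have h1 := (M.lo_le_dist x (c n (τ n a))).trans (hx n a ha)
          have h2 : ‖x - c n (τ n a)‖ ≤ a / M.lo := by
            rw [le_div_iff₀ M.lo_pos]; linarith
          have h3 := norm_sub_norm_le (c n (τ n a)) x
          rw [norm_sub_rev] at h3; linarith)
      exact ⟨z, fun _ => hz⟩
    · exact ⟨0, fun h => absurd h ha⟩
  choose γ hγ using hlim
  have g1 : ∀ s ∈ Icc 0 D, ∀ t ∈ Icc 0 D, M.dist (γ s) (γ t) ≤ |s - t| := fun s hs t ht =>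
    le_of_tendsto (M.tendsto_dist (hγ s hs) (hγ t ht))
      (Eventually.of_forall fun n => hz n s t hs ht)
  have g2 : ∀ s ∈ Icc 0 D, M.dist x (γ s) ≤ s := fun s hs =>
    le_of_tendsto (M.tendsto_dist tendsto_const_nhds (hγ s hs))
      (Eventually.of_forall fun n => hx n s hs)
  have g3 : ∀ s ∈ Icc 0 D, M.dist (γ s) y ≤ D - s := fun s hs => by
    have ht : Tendsto (fun n : ℕ => D + 1 / ((n : ℝ) + 1) - s) ulf (𝓝 (D + 0 - s)) :=
      ((tendsto_one_div_add_atTop_nhds_zero_nat.const_add D).sub_const s).mono_left ulf_le_atTop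
    rw [add_zero] at ht
    exact le_of_tendsto_of_tendsto (M.tendsto_dist (hγ s hs) tendsto_const_nhds) ht
      (Eventually.of_forall fun n => hy n s hs)
  have m0 : (0 : ℝ) ∈ Icc 0 D := ⟨le_rfl, hD0⟩
  have mD : D ∈ Icc 0 D := ⟨hD0, le_rfl⟩
  refine ⟨γ, (M.eq_of_dist_le_zero (g2 0 m0)).symm,
    M.eq_of_dist_le_zero (by simpa using g3 D mD), ?_⟩
  have key : ∀ s ∈ Icc 0 D, ∀ t ∈ Icc 0 D, s ≤ t → M.dist (γ s) (γ t) = |s - t| := by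
    intro s hs t ht hst
    refine le_antisymm (g1 s hs t ht) ?_
    have h1 := M.dist_triangle x (γ s) y
    have h2 := M.dist_triangle (γ s) (γ t) y
    have h3 := g2 s hs
    have h4 := g3 t ht
    rw [abs_sub_comm, abs_of_nonneg (by linarith)]
    rw [← hD] at h1; linarith
  intro s hs t ht
  rcases le_total s t with h | h
  · exact key s hs t ht h
  · rw [M.dist_comm, abs_sub_comm]; exact key t ht s hs h

end Segments

end TorusMetric

section AlmostAffine

variable {E : Type*} [NormedAddCommGroup E] [NormedSpace ℝ E]

/-- `f` is affine on `[a, b]` up to an error of order `3/2`. -/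
def AlmostAffine (f : ℝ → E) (a b C : ℝ) : Prop :=
  ∀ s ∈ Icc a b, ∀ t ∈ Icc a b, ∀ l ∈ Icc (0 : ℝ) 1,
    ‖f (s + l * (t - s)) - f s - l • (f t - f s)‖ ≤ C * (|t - s| * √|t - s|)

/-- Difference quotients. -/
def dquot (f : ℝ → E) (t h : ℝ) : E := h⁻¹ • (f (t + h) - f t)

lemma add_mul_mem_Icc {a b t h l : ℝ} (ht : t ∈ Icc a b) (hh : t + h ∈ Icc a b)
    (hl : l ∈ Icc (0 : ℝ) 1) : t + l * h ∈ Icc a b := by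
  have := (convex_Icc a b) ht hh (sub_nonneg.2 hl.2) hl.1 (by ring)
  simp only [smul_eq_mul] at this
  convert this using 1; ring

lemma AlmostAffine.dquot_half {f : ℝ → E} {a b C : ℝ} (hf : AlmostAffine f a b C)
    {t h l : ℝ} (ht : t ∈ Icc a b) (hh : t + h ∈ Icc a b) (h0 : h ≠ 0) (hl : 1 / 2 ≤ l)
    (hl1 : l ≤ 1) : ‖dquot f t (l * h) - dquot f t h‖ ≤ 2 * C * √|h| := by
  have hl0 : 0 < l := by linarith
  have h1 := hf t ht _ hh l ⟨hl0.le, hl1⟩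
  simp only [add_sub_cancel_left] at h1
  have h2 : dquot f t (l * h) - dquot f t h =
      (l * h)⁻¹ • (f (t + l * h) - f t - l • (f (t + h) - f t)) := by
    unfold dquot
    rw [smul_sub ((l * h)⁻¹) (_ - _), smul_smul, show (l * h)⁻¹ * l = h⁻¹ by field_simp]
  have h3 : 0 < |h| := abs_pos.2 h0
  rw [h2, norm_smul, norm_inv, Real.norm_eq_abs, abs_mul, abs_of_pos hl0]
  calc (l * |h|)⁻¹ * _ ≤ (1 / 2 * |h|)⁻¹ * (C * (|h| * √|h|)) := by gcongr
    _ = 2 * C * √|h| := by field_simp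

lemma AlmostAffine.dquot_le {f : ℝ → E} {a b C : ℝ} (hC : 0 ≤ C) (hf : AlmostAffine f a b C)
    {t : ℝ} (ht : t ∈ Icc a b) (k : ℕ) : ∀ h l : ℝ, t + h ∈ Icc a b → h ≠ 0 → (1 / 2) ^ k ≤ l →
    l ≤ 1 → ‖dquot f t (l * h) - dquot f t h‖ ≤ 8 * C * √|h| := by
  induction k with
  | zero =>
    intro h l _ _ h1 h2
    have : l = 1 := le_antisymm h2 (by simpa using h1)
    simp [this]; positivity
  | succ k ih =>
    intro h l hh h0 h1 h2
    rcases le_or_gt (1 / 2) l with hl | hl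
    · refine (hf.dquot_half ht hh h0 hl h2).trans ?_
      have := Real.sqrt_nonneg |h|
      nlinarith [mul_nonneg hC this]
    · have e1 := ih (1 / 2 * h) (2 * l) (add_mul_mem_Icc ht hh ⟨by norm_num, by norm_num⟩)
        (by simpa using h0) (by rw [pow_succ] at h1; linarith) (by linarith)
      have e2 := hf.dquot_half ht hh h0 (l := 1 / 2) le_rfl (by norm_num)
      rw [show 2 * l * (1 / 2 * h) = l * h by ring] at e1
      have e3 : √|1 / 2 * h| ≤ 0.72 * √|h| := by
        rw [Real.sqrt_le_left (by positivity), mul_pow, Real.sq_sqrt (abs_nonneg _), abs_mul]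
        norm_num
        nlinarith [abs_nonneg h]
      calc _ = ‖(dquot f t (l * h) - dquot f t (1 / 2 * h)) +
            (dquot f t (1 / 2 * h) - dquot f t h)‖ := by congr 1; abel
        _ ≤ _ := norm_add_le _ _
        _ ≤ 8 * C * √|1 / 2 * h| + 2 * C * √|h| := add_le_add e1 e2
        _ ≤ 8 * C * (0.72 * √|h|) + 2 * C * √|h| := by gcongr
        _ ≤ _ := by nlinarith [mul_nonneg hC (Real.sqrt_nonneg |h|)]

lemma AlmostAffine.dquot_le' {f : ℝ → E} {a b C : ℝ} (hC : 0 ≤ C) (hf : AlmostAffine f a b C)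
    {t h l : ℝ} (ht : t ∈ Icc a b) (hh : t + h ∈ Icc a b) (h0 : h ≠ 0) (hl : 0 < l)
    (hl1 : l ≤ 1) : ‖dquot f t (l * h) - dquot f t h‖ ≤ 8 * C * √|h| := by
  obtain ⟨k, hk⟩ := exists_pow_lt_of_lt_one hl (show (1 / 2 : ℝ) < 1 by norm_num)
  exact hf.dquot_le hC ht k h l hh h0 hk.le hl1

lemma AlmostAffine.dquot_neg {f : ℝ → E} {a b C : ℝ} (hC : 0 ≤ C) (hf : AlmostAffine f a b C)
    {t h : ℝ} (hh : t + h ∈ Icc a b) (hh' : t - h ∈ Icc a b) (h0 : 0 < h) :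
    ‖dquot f t (-h) - dquot f t h‖ ≤ 8 * C * √h := by
  have h1 := hf (t - h) hh' (t + h) hh (1 / 2) ⟨by norm_num, by norm_num⟩
  rw [show t - h + 1 / 2 * (t + h - (t - h)) = t by ring,
    show t + h - (t - h) = 2 * h by ring, abs_of_pos (by linarith)] at h1
  have h2 : dquot f t (-h) - dquot f t h =
      (2 * h⁻¹) • (f t - f (t - h) - (1 / 2 : ℝ) • (f (t + h) - f (t - h))) := by
    unfold dquot
    rw [← sub_eq_add_neg, inv_neg]
    module
  have e3 : √(2 * h) ≤ 2 * √h := by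
    rw [Real.sqrt_le_left (by positivity), mul_pow, Real.sq_sqrt h0.le]; linarith
  rw [h2, norm_smul, Real.norm_eq_abs, abs_of_pos (by positivity)]
  calc 2 * h⁻¹ * _ ≤ 2 * h⁻¹ * (C * (2 * h * (2 * √h))) := by
        gcongr; exact h1.trans (by gcongr)
    _ = _ := by field_simp; ring

lemma AlmostAffine.exists_deriv [CompleteSpace E] {f : ℝ → E} {a b C : ℝ} (hC : 0 ≤ C)
    (hf : AlmostAffine f a b C) {t : ℝ} (ht : t ∈ Ioo a b) :
    ∃ v, HasDerivAt f v t ∧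
      ∀ s ∈ Icc a b, ‖f s - f t - (s - t) • v‖ ≤ 8 * C * (|s - t| * √|s - t|) := by
  have htI : t ∈ Icc a b := Ioo_subset_Icc_self ht
  set δ := min (t - a) (b - t)
  have hδ : 0 < δ := lt_min (by linarith [ht.1]) (by linarith [ht.2])
  have hδ1 : δ ≤ t - a := min_le_left _ _
  have hδ2 : δ ≤ b - t := min_le_right _ _
  let η : ℕ → ℝ := fun n => (1 / 2) ^ n * δ
  have hη0 : ∀ n, 0 < η n := fun n => by positivity
  have hη1 : ∀ n, η n ≤ δ := fun n =>
    mul_le_of_le_one_left hδ.le (pow_le_one₀ (by norm_num) (by norm_num))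
  have hmem : ∀ n, t + η n ∈ Icc a b := fun n =>
    ⟨by linarith [hη0 n, ht.1], by linarith [hη1 n]⟩
  have hmem' : ∀ n, t - η n ∈ Icc a b := fun n =>
    ⟨by linarith [hη1 n], by linarith [hη0 n, ht.2]⟩
  have hηt : Tendsto η atTop (𝓝 0) := by
    have := (tendsto_pow_atTop_nhds_zero_of_lt_one (r := (1 / 2 : ℝ)) (by norm_num)
      (by norm_num)).mul_const δ
    rwa [zero_mul] at this
  have hsq : Tendsto (fun n => 8 * C * √(η n)) atTop (𝓝 0) := by
    have := ((Real.continuous_sqrt.tendsto 0).comp hηt).const_mul (8 * C)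
    simpa using this
  have hle : ∀ n m, n ≤ m → ‖dquot f t (η m) - dquot f t (η n)‖ ≤ 8 * C * √(η n) := by
    intro n m hnm
    have := hf.dquot_le' hC htI (hmem n) (hη0 n).ne' (l := (1 / 2) ^ (m - n)) (by positivity)
      (pow_le_one₀ (by norm_num) (by norm_num))
    have e : (1 / 2 : ℝ) ^ (m - n) * η n = η m := by
      simp only [η]; rw [← mul_assoc, ← pow_add, Nat.sub_add_cancel hnm]
    rwa [e, abs_of_pos (hη0 n)] at this
  have hcs : CauchySeq fun n => dquot f t (η n) := by
    apply cauchySeq_of_le_tendsto_0' (fun n => 8 * C * √(η n)) _ hsq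
    intro n m hnm
    rw [dist_eq_norm, norm_sub_rev]; exact hle n m hnm
  obtain ⟨v, hv⟩ := cauchySeq_tendsto_of_complete hcs
  have hv' : Tendsto (fun n => dquot f t (-η n)) atTop (𝓝 v) := by
    have : Tendsto (fun n => dquot f t (-η n) - dquot f t (η n)) atTop (𝓝 0) :=
      squeeze_zero_norm (fun n => hf.dquot_neg hC (hmem n) (hmem' n) (hη0 n)) hsq
    simpa using this.add hv
  have hbound : ∀ h, h ≠ 0 → t + h ∈ Icc a b → ‖v - dquot f t h‖ ≤ 8 * C * √|h| := by
    intro h h0 hh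
    have hev : ∀ᶠ n in atTop, η n ≤ |h| := by
      filter_upwards [hηt.eventually (gt_mem_nhds (abs_pos.2 h0))] with n hn using hn.le
    rcases lt_or_gt_of_ne h0 with hneg | hpos
    · refine le_of_tendsto (hv'.sub_const _).norm ?_
      filter_upwards [hev] with n hn
      have := hf.dquot_le' hC htI hh h0 (l := η n / |h|) (div_pos (hη0 n) (abs_pos.2 h0))
        ((div_le_one (abs_pos.2 h0)).2 hn)
      rwa [show η n / |h| * h = -η n by rw [abs_of_neg hneg]; field_simp] at this
    · refine le_of_tendsto (hv.sub_const _).norm ?_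
      filter_upwards [hev] with n hn
      have := hf.dquot_le' hC htI hh h0 (l := η n / |h|) (div_pos (hη0 n) (abs_pos.2 h0))
        ((div_le_one (abs_pos.2 h0)).2 hn)
      rwa [show η n / |h| * h = η n by rw [abs_of_pos hpos]; field_simp] at this
  have hfin : ∀ s ∈ Icc a b, ‖f s - f t - (s - t) • v‖ ≤ 8 * C * (|s - t| * √|s - t|) := by
    intro s hs
    by_cases h0 : s - t = 0
    · have : s = t := by linarith
      simp [this]
    have h1 := hbound (s - t) h0 (by simpa using hs)
    have h2 : f s - f t - (s - t) • v = -((s - t) • (v - dquot f t (s - t))) := by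
      unfold dquot
      rw [smul_sub, smul_inv_smul₀ h0, add_sub_cancel]; abel
    rw [h2, norm_neg, norm_smul, Real.norm_eq_abs]
    calc _ ≤ |s - t| * (8 * C * √|s - t|) := by gcongr
      _ = _ := by ring
  refine ⟨v, ?_, hfin⟩
  rw [hasDerivAt_iff_isLittleO, Asymptotics.isLittleO_iff]
  intro c hc
  have ht0 : Tendsto (fun s => 8 * C * √|s - t|) (𝓝 t) (𝓝 0) := by
    have : Continuous fun s => 8 * C * √|s - t| := by fun_prop
    simpa using this.tendsto t
  filter_upwards [Icc_mem_nhds ht.1 ht.2, ht0.eventually (gt_mem_nhds hc)] with s hs hs2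
  refine (hfin s hs).trans ?_
  rw [Real.norm_eq_abs]
  nlinarith [abs_nonneg (s - t)]

end AlmostAffine

section DuBoisReymond

lemma hasDerivAt_primitive {f : ℝ → ℝ} (hf : Continuous f) (a t : ℝ) :
    HasDerivAt (fun t => ∫ s in a..t, f s) (f t) t :=
  intervalIntegral.integral_hasDerivAt_right (hf.intervalIntegrable _ _)
    (hf.stronglyMeasurableAtFilter _ _) hf.continuousAt

lemma contDiff_one_of_hasDerivAt {E : Type*} [NormedAddCommGroup E] [NormedSpace ℝ E]
    {f f' : ℝ → E} (h : ∀ t, HasDerivAt f (f' t) t) (hf : Continuous f') : ContDiff ℝ 1 f := by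
  rw [contDiff_one_iff_deriv]
  refine ⟨fun t => (h t).differentiableAt, ?_⟩
  rwa [show deriv f = f' from funext fun t => (h t).deriv]

/-- The du Bois-Reymond lemma. -/
lemma hasDerivAt_of_duBoisReymond {P Q : ℝ → ℝ} (hP : Continuous P) (hQ : Continuous Q) {a b : ℝ}
    (hab : a < b) (h : ∀ φ : ℝ → ℝ, ContDiff ℝ 1 φ → φ a = 0 → φ b = 0 →
      ∫ t in a..b, (Q t * φ t + P t * deriv φ t) = 0) :
    ∀ t ∈ Ioo a b, HasDerivAt P (Q t) t := by
  let W : ℝ → ℝ := fun t => ∫ s in a..t, Q s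
  have hW : ∀ t, HasDerivAt W (Q t) t := hasDerivAt_primitive hQ a
  have hWc : Continuous W := continuous_iff_continuousAt.2 fun t => (hW t).continuousAt
  let R : ℝ → ℝ := fun t => P t - W t
  have hR : Continuous R := hP.sub hWc
  let m : ℝ := (∫ t in a..b, R t) / (b - a)
  have hRm : Continuous fun t => R t - m := hR.sub continuous_const
  let φ : ℝ → ℝ := fun t => ∫ s in a..t, (R s - m)
  have hφ : ∀ t, HasDerivAt φ (R t - m) t := hasDerivAt_primitive hRm a
  have hφ1 : ContDiff ℝ 1 φ := contDiff_one_of_hasDerivAt hφ hRm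
  have hφa : φ a = 0 := by simp [φ]
  have hφb : φ b = 0 := by
    simp only [φ]
    rw [intervalIntegral.integral_sub (hR.intervalIntegrable _ _) intervalIntegrable_const,
      intervalIntegral.integral_const, smul_eq_mul]
    simp only [m]
    have : b - a ≠ 0 := by linarith
    field_simp; ring
  have h1 := h φ hφ1 hφa hφb
  have h2 : ∫ t in a..b, (Q t * φ t + W t * (R t - m)) = 0 := by
    rw [intervalIntegral.integral_eq_sub_of_hasDerivAt (f := fun t => W t * φ t)
      (fun t _ => (hW t).mul (hφ t))]
    · simp [hφa, hφb]
    · exact ((hQ.mul hφ1.continuous).add (hWc.mul hRm)).intervalIntegrable _ _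
  have h3 : ∫ t in a..b, (R t - m) ^ 2 = 0 := by
    have e : ∀ t, (R t - m) ^ 2 = (Q t * φ t + P t * deriv φ t) - (Q t * φ t + W t * (R t - m))
        - m * (R t - m) := by
      intro t; rw [(hφ t).deriv]; simp only [R]; ring
    simp_rw [e]
    have c1 : Continuous fun t => Q t * φ t + P t * deriv φ t :=
      (hQ.mul hφ1.continuous).add (hP.mul (hφ1.continuous_deriv le_rfl))
    have c2 : Continuous fun t => Q t * φ t + W t * (R t - m) :=
      (hQ.mul hφ1.continuous).add (hWc.mul hRm)
    have c3 : Continuous fun t => Q t * φ t + P t * deriv φ t - (Q t * φ t + W t * (R t - m)) :=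
      c1.sub c2
    rw [intervalIntegral.integral_sub (c3.intervalIntegrable _ _)
      ((hRm.const_mul m).intervalIntegrable _ _),
      intervalIntegral.integral_sub (c1.intervalIntegrable _ _) (c2.intervalIntegrable _ _), h1, h2,
      intervalIntegral.integral_const_mul]
    change 0 - 0 - m * φ b = 0
    rw [hφb]; ring
  have hsq : Continuous fun t => (R t - m) ^ 2 := hRm.pow 2
  have hzero : ∀ t ∈ Icc a b, ∫ s in a..t, (R s - m) ^ 2 = 0 := by
    intro t ht
    have e := intervalIntegral.integral_add_adjacent_intervals (hsq.intervalIntegrable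
      (μ := MeasureTheory.volume) a t) (hsq.intervalIntegrable t b)
    have e1 : 0 ≤ ∫ s in a..t, (R s - m) ^ 2 :=
      intervalIntegral.integral_nonneg ht.1 fun _ _ => sq_nonneg _
    have e2 : 0 ≤ ∫ s in t..b, (R s - m) ^ 2 :=
      intervalIntegral.integral_nonneg ht.2 fun _ _ => sq_nonneg _
    linarith
  have hRm0 : ∀ t ∈ Ioo a b, R t = m := by
    intro t ht
    have e1 := hasDerivAt_primitive hsq a t
    have e2 : HasDerivAt (fun t => ∫ s in a..t, (R s - m) ^ 2) 0 t := by
      apply (hasDerivAt_const t (0 : ℝ)).congr_of_eventuallyEq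
      filter_upwards [Icc_mem_nhds ht.1 ht.2] with s hs using hzero s hs
    have e3 := e1.unique e2
    have := pow_eq_zero_iff (two_ne_zero) |>.1 e3
    linarith
  intro t ht
  have : HasDerivAt (fun s => m + W s) (Q t) t := (hW t).const_add m
  apply this.congr_of_eventuallyEq
  filter_upwards [isOpen_Ioo.mem_nhds ht] with s hs
  have := hRm0 s hs
  simp only [R] at this; linarith

end DuBoisReymond

namespace TorusMetric

/-- `z` is isometric on the interval `[a, b]`. -/
def IsoOn (M : TorusMetric) (z : ℝ → ℝ × ℝ) (a b : ℝ) : Prop :=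
  ∀ s ∈ Icc a b, ∀ t ∈ Icc a b, M.dist (z s) (z t) = |s - t|

/-- `z` is locally isometric. -/
def LocIso (M : TorusMetric) (z : ℝ → ℝ × ℝ) : Prop :=
  ∀ t, ∃ ε > 0, M.IsoOn z (t - ε) (t + ε)

section Regularity

lemma IsoOn.mono {M : TorusMetric} {z : ℝ → ℝ × ℝ} {a b a' b' : ℝ} (h : M.IsoOn z a b)
    (ha : a ≤ a') (hb : b' ≤ b) : M.IsoOn z a' b' := fun s hs t ht =>
  h s (Icc_subset_Icc ha hb hs) t (Icc_subset_Icc ha hb ht)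

lemma stewart (M : TorusMetric) (p A B : ℝ × ℝ) (l : ℝ) :
    M.nrm p (A - l • B) ^ 2 = (1 - l) * M.nrm p A ^ 2 + l * M.nrm p (B - A) ^ 2
      - l * (1 - l) * M.nrm p B ^ 2 := by
  simp only [M.nrm_sq, M.sub_left, M.sub_right, M.smul_left, M.smul_right]
  rw [M.symm p B A]; ring

/-- Quadratic defect constant. -/
def qc (M : TorusMetric) : ℝ := 2 * M.lc / M.lo ^ 2

lemma qc_pos (M : TorusMetric) : 0 < M.qc := by
  have := M.lc_pos; have := M.lo_pos; unfold qc; positivity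

/-- Constant in the almost affine estimate for isometric paths. -/
def ac (M : TorusMetric) : ℝ := √(6 * M.qc + 2 * M.qc ^ 2) / M.lo

lemma ac_nonneg (M : TorusMetric) : 0 ≤ M.ac := div_nonneg (Real.sqrt_nonneg _) M.lo_pos.le

lemma IsoOn.norm_sub_le {M : TorusMetric} {z : ℝ → ℝ × ℝ} {a b : ℝ} (h : M.IsoOn z a b) {s t : ℝ}
    (hs : s ∈ Icc a b) (ht : t ∈ Icc a b) : ‖z s - z t‖ ≤ |s - t| / M.lo := by
  rw [le_div_iff₀ M.lo_pos, mul_comm, ← h s hs t ht]; exact M.lo_le_dist _ _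

lemma IsoOn.abs_nrm_sub_le {M : TorusMetric} {z : ℝ → ℝ × ℝ} {a b : ℝ} (h : M.IsoOn z a b)
    {s r t : ℝ} (hs : s ∈ Icc a b) (hr : r ∈ Icc a b) (ht : t ∈ Icc a b) {H : ℝ}
    (h1 : |r - s| ≤ H) (h2 : |r - t| ≤ H) :
    |(M.nrm (z s) (z t - z r) - |r - t|)| ≤ M.qc * H ^ 2 := by
  have e := M.abs_dist_sub_nrm_le (z s) (z r) (z t)
  rw [h r hr t ht, abs_sub_comm] at e
  have hlo := M.lo_pos
  have hlc := M.lc_pos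
  have hH : 0 ≤ H := (abs_nonneg _).trans h1
  have a1 : ‖z r - z s‖ ≤ H / M.lo := (h.norm_sub_le hr hs).trans (by gcongr)
  have a2 : ‖z r - z t‖ ≤ H / M.lo := (h.norm_sub_le hr ht).trans (by gcongr)
  refine e.trans ?_
  calc _ ≤ M.lc * (H / M.lo + H / M.lo) * (H / M.lo) := by gcongr
    _ = _ := by unfold qc; field_simp; ring

lemma IsoOn.almostAffine {M : TorusMetric} {z : ℝ → ℝ × ℝ} {a b : ℝ} (h : M.IsoOn z a b)
    (hab : b - a ≤ 1) : AlmostAffine z a b M.ac := by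
  intro s hs t ht l hl
  set H := |t - s| with hH
  have hH0 : 0 ≤ H := abs_nonneg _
  have hH1 : H ≤ 1 := by rw [hH, abs_le]; constructor <;> linarith [hs.1, hs.2, ht.1, ht.2]
  have hr : s + l * (t - s) ∈ Icc a b := add_mul_mem_Icc hs (by simpa using ht) hl
  set r := s + l * (t - s) with hrd
  have d1 : |r - s| = l * H := by
    rw [hrd, add_sub_cancel_left, abs_mul, abs_of_nonneg hl.1]
  have d2 : |r - t| = (1 - l) * H := by
    rw [hrd, show s + l * (t - s) - t = -((1 - l) * (t - s)) by ring, abs_neg, abs_mul,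
      abs_of_nonneg (by linarith [hl.2])]
  have l0 := hl.1
  have l1 := hl.2
  have hlH : l * H ≤ H := by nlinarith
  have hlH' : (1 - l) * H ≤ H := by nlinarith
  have e1 := h.abs_nrm_sub_le hs hs hr (H := H) (by simpa using hH0)
    (by rw [abs_sub_comm, d1]; exact hlH)
  have e2 := h.abs_nrm_sub_le hs hr ht (H := H) (by rw [d1]; exact hlH) (by rw [d2]; exact hlH')
  have e3 := h.abs_nrm_sub_le hs hs ht (H := H) (by simpa using hH0)
    (by rw [abs_sub_comm])
  rw [abs_sub_comm s r, d1] at e1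
  rw [d2] at e2
  rw [abs_sub_comm s t, ← hH] at e3
  have hst := M.stewart (z s) (z r - z s) (z t - z s) l
  rw [show z t - z s - (z r - z s) = z t - z r by abel] at hst
  set α := M.nrm (z s) (z r - z s)
  set β := M.nrm (z s) (z t - z r)
  set γ := M.nrm (z s) (z t - z s)
  have hq := M.qc_pos
  set K := M.qc with hK
  obtain ⟨x, hx⟩ : ∃ x, x = α - l * H := ⟨_, rfl⟩
  obtain ⟨y, hy⟩ : ∃ y, y = β - (1 - l) * H := ⟨_, rfl⟩
  obtain ⟨w, hw⟩ : ∃ w, w = γ - H := ⟨_, rfl⟩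
  rw [← hx] at e1; rw [← hy] at e2; rw [← hw] at e3
  have hα : α = l * H + x := by rw [hx]; ring
  have hβ : β = (1 - l) * H + y := by rw [hy]; ring
  have hγ : γ = H + w := by rw [hw]; ring
  have hbound : M.nrm (z s) (z r - z s - l • (z t - z s)) ^ 2 ≤ (6 * K + 2 * K ^ 2) * H ^ 3 := by
    rw [hst, hα, hβ, hγ]
    have ll : l * (1 - l) ≤ 1 := by nlinarith
    have ll0 : 0 ≤ l * (1 - l) := mul_nonneg l0 (by linarith)
    have sx : x ^ 2 ≤ (K * H ^ 2) ^ 2 := sq_le_sq' (abs_le.1 e1).1 (abs_le.1 e1).2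
    have sy : y ^ 2 ≤ (K * H ^ 2) ^ 2 := sq_le_sq' (abs_le.1 e2).1 (abs_le.1 e2).2
    have h34 : (K * H ^ 2) ^ 2 ≤ K ^ 2 * H ^ 3 := by
      have : H ^ 4 ≤ H ^ 3 := pow_le_pow_of_le_one hH0 hH1 (by norm_num)
      nlinarith [sq_nonneg K]
    have key : (1 - l) * (l * H + x) ^ 2 + l * ((1 - l) * H + y) ^ 2 - l * (1 - l) * (H + w) ^ 2
      = l * (1 - l) * (2 * H * (x + y - w)) + (1 - l) * x ^ 2 + l * y ^ 2 -
        l * (1 - l) * w ^ 2 := by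
      ring
    rw [key]
    have t1 : 2 * H * (x + y - w) ≤ 6 * K * H ^ 3 := by
      have : x + y - w ≤ 3 * (K * H ^ 2) := by
        linarith [(abs_le.1 e1).2, (abs_le.1 e2).2, (abs_le.1 e3).1]
      calc _ ≤ 2 * H * (3 * (K * H ^ 2)) := by gcongr
        _ = _ := by ring
    have t1' : l * (1 - l) * (2 * H * (x + y - w)) ≤ 6 * K * H ^ 3 := by
      have h0 : 0 ≤ 6 * K * H ^ 3 := by positivity
      calc _ ≤ l * (1 - l) * (6 * K * H ^ 3) := by gcongr
        _ ≤ 1 * (6 * K * H ^ 3) := by gcongr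
        _ = _ := one_mul _
    have t2 : (1 - l) * x ^ 2 ≤ K ^ 2 * H ^ 3 := by
      have : (1 - l) * x ^ 2 ≤ 1 * x ^ 2 := by gcongr; linarith
      linarith
    have t3 : l * y ^ 2 ≤ K ^ 2 * H ^ 3 := by
      have : l * y ^ 2 ≤ 1 * y ^ 2 := by gcongr
      linarith
    have t4 : 0 ≤ l * (1 - l) * w ^ 2 := by positivity
    nlinarith
  have hlo := M.lo_pos
  have h5 := M.lo_le (z s) (z r - z s - l • (z t - z s))
  have h6 : M.nrm (z s) (z r - z s - l • (z t - z s)) ≤ √(6 * K + 2 * K ^ 2) * (H * √H) := by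
    apply le_of_sq_le_sq _ (by positivity)
    rw [mul_pow, mul_pow, Real.sq_sqrt (by positivity), Real.sq_sqrt hH0]
    refine hbound.trans (le_of_eq (by ring))
  unfold ac
  rw [div_mul_eq_mul_div, le_div_iff₀ hlo, mul_comm]
  exact h5.trans h6

lemma nrm_tendsto {M : TorusMetric} {z : ℝ → ℝ × ℝ} {a b t : ℝ} (h : M.IsoOn z a b)
    (ht : t ∈ Ioo a b) {v : ℝ × ℝ} (hv : HasDerivAt z v t) : M.nrm (z t) v = 1 := by
  have h1 : Tendsto (fun s => M.nrm (z t) (slope z t s)) (𝓝[>] t) (𝓝 (M.nrm (z t) v)) := by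
    have h2 := (hasDerivAt_iff_tendsto_slope.1 hv).mono_left (nhdsGT_le_nhdsNE t)
    have hc : Continuous fun v => M.nrm (z t) v := M.continuous_nrm continuous_const continuous_id
    exact (hc.tendsto v).comp h2
  refine tendsto_nhds_unique h1 ?_
  rw [tendsto_iff_norm_sub_tendsto_zero]
  have h3 : Tendsto (fun s => M.qc * (s - t)) (𝓝[>] t) (𝓝 0) := by
    have : Continuous fun s => M.qc * (s - t) := by fun_prop
    simpa using (this.tendsto t).mono_left (nhdsWithin_le_nhds (s := Ioi t))
  refine squeeze_zero' (Eventually.of_forall fun _ => norm_nonneg _) ?_ h3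
  have hmem : ∀ᶠ s in 𝓝[>] t, s ∈ Icc a b :=
    nhdsWithin_le_nhds (Icc_mem_nhds ht.1 ht.2)
  filter_upwards [self_mem_nhdsWithin, hmem] with s (hs : t < s) hsI
  have htI := Ioo_subset_Icc_self ht
  have hpos : 0 < s - t := by linarith
  have e := h.abs_nrm_sub_le htI htI hsI (H := s - t) (by simpa using hpos.le)
    (by rw [abs_sub_comm, abs_of_pos hpos])
  rw [abs_sub_comm t s, abs_of_pos hpos] at e
  rw [slope_def_module, M.nrm_smul, abs_of_pos (inv_pos.2 hpos), Real.norm_eq_abs,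
    show (s - t)⁻¹ * M.nrm (z t) (z s - z t) - 1 =
      (s - t)⁻¹ * (M.nrm (z t) (z s - z t) - (s - t)) by field_simp, abs_mul,
    abs_of_pos (inv_pos.2 hpos)]
  calc _ ≤ (s - t)⁻¹ * (M.qc * (s - t) ^ 2) := by gcongr
    _ = _ := by field_simp

lemma IsoOn.exists_deriv {M : TorusMetric} {z : ℝ → ℝ × ℝ} {a b : ℝ} (h : M.IsoOn z a b)
    (hab : b - a ≤ 1) {t : ℝ} (ht : t ∈ Ioo a b) : HasDerivAt z (deriv z t) t ∧
      M.nrm (z t) (deriv z t) = 1 ∧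
      ∀ s ∈ Icc a b, ‖z s - z t - (s - t) • deriv z t‖ ≤ 8 * M.ac * (|s - t| * √|s - t|) := by
  obtain ⟨v, hv, hb⟩ := (h.almostAffine hab).exists_deriv M.ac_nonneg ht
  rw [hv.deriv]
  exact ⟨hv, M.nrm_tendsto h ht hv, hb⟩

lemma LocIso.exists_small {M : TorusMetric} {z : ℝ → ℝ × ℝ} (h : M.LocIso z) (t : ℝ) :
    ∃ a b, a < t ∧ t < b ∧ b - a ≤ 1 ∧ M.IsoOn z a b := by
  obtain ⟨ε, hε, hi⟩ := h t
  refine ⟨t - min ε (1 / 2), t + min ε (1 / 2), ?_, ?_, ?_, hi.mono ?_ ?_⟩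
  · have : 0 < min ε (1 / 2) := lt_min hε (by norm_num)
    linarith
  · have : 0 < min ε (1 / 2) := lt_min hε (by norm_num)
    linarith
  · linarith [min_le_right ε (1 / 2)]
  · linarith [min_le_left ε (1 / 2)]
  · linarith [min_le_left ε (1 / 2)]

lemma LocIso.hasDerivAt {M : TorusMetric} {z : ℝ → ℝ × ℝ} (h : M.LocIso z) (t : ℝ) :
    HasDerivAt z (deriv z t) t := by
  obtain ⟨a, b, h1, h2, h3, h4⟩ := h.exists_small t
  exact (h4.exists_deriv h3 ⟨h1, h2⟩).1

lemma LocIso.nrm_deriv {M : TorusMetric} {z : ℝ → ℝ × ℝ} (h : M.LocIso z) (t : ℝ) :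
    M.nrm (z t) (deriv z t) = 1 := by
  obtain ⟨a, b, h1, h2, h3, h4⟩ := h.exists_small t
  exact (h4.exists_deriv h3 ⟨h1, h2⟩).2.1

lemma LocIso.contDiff_one {M : TorusMetric} {z : ℝ → ℝ × ℝ} (h : M.LocIso z) :
    ContDiff ℝ 1 z := by
  refine contDiff_one_of_hasDerivAt h.hasDerivAt ?_
  rw [continuous_iff_continuousAt]
  intro t
  obtain ⟨a, b, h1, h2, h3, h4⟩ := h.exists_small t
  rw [ContinuousAt, tendsto_iff_norm_sub_tendsto_zero]
  have hlim : Tendsto (fun s => 16 * M.ac * √|s - t|) (𝓝 t) (𝓝 0) := by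
    have : Continuous fun s => 16 * M.ac * √|s - t| := by fun_prop
    simpa using this.tendsto t
  refine squeeze_zero' (Eventually.of_forall fun _ => norm_nonneg _) ?_ hlim
  filter_upwards [Ioo_mem_nhds h1 h2] with s hs
  by_cases hst : s = t
  · simp [hst]
  have e1 := (h4.exists_deriv h3 ⟨h1, h2⟩).2.2 s (Ioo_subset_Icc_self hs)
  have e2 := (h4.exists_deriv h3 hs).2.2 t ⟨h1.le, h2.le⟩
  rw [abs_sub_comm t s] at e2
  have hpos : 0 < |s - t| := abs_pos.2 (sub_ne_zero.2 hst)
  have e3 : |s - t| * ‖deriv z s - deriv z t‖ ≤ |s - t| * (16 * M.ac * √|s - t|) := by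
    rw [← Real.norm_eq_abs, ← norm_smul]
    calc _ = ‖(z s - z t - (s - t) • deriv z t) + (z t - z s - (t - s) • deriv z s)‖ := by
          congr 1; module
      _ ≤ _ := norm_add_le _ _
      _ ≤ _ := add_le_add e1 e2
      _ = _ := by rw [Real.norm_eq_abs]; ring
  exact le_of_mul_le_mul_left e3 hpos

end Regularity

section EulerLagrange

/-- The derivative of `x ↦ g x v v` in the direction `e`. -/
def dx (M : TorusMetric) (x v e : ℝ × ℝ) : ℝ :=
  fderiv ℝ M.cE x e * (v.1 * v.1) + fderiv ℝ M.cF x e * (2 * (v.1 * v.2))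
    + fderiv ℝ M.cG x e * (v.2 * v.2)

lemma hasDerivAt_energy (M : TorusMetric) (x v φ ψ : ℝ × ℝ) (ε : ℝ) :
    HasDerivAt (fun ε : ℝ => M.g (x + ε • φ) (v + ε • ψ) (v + ε • ψ))
      (M.dx (x + ε • φ) (v + ε • ψ) φ + 2 * M.g (x + ε • φ) (v + ε • ψ) ψ) ε := by
  have hx : HasDerivAt (fun ε : ℝ => x + ε • φ) φ ε := by
    simpa using ((hasDerivAt_id ε).smul_const φ).const_add x
  have hv1 : HasDerivAt (fun ε : ℝ => v.1 + ε * ψ.1) ψ.1 ε := by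
    simpa using ((hasDerivAt_id ε).mul_const ψ.1).const_add v.1
  have hv2 : HasDerivAt (fun ε : ℝ => v.2 + ε * ψ.2) ψ.2 ε := by
    simpa using ((hasDerivAt_id ε).mul_const ψ.2).const_add v.2
  have hE := ((M.contDiff_cE.differentiable (by simp)).differentiableAt
    (x := x + ε • φ)).hasFDerivAt.comp_hasDerivAt ε hx
  have hF := ((M.contDiff_cF.differentiable (by simp)).differentiableAt
    (x := x + ε • φ)).hasFDerivAt.comp_hasDerivAt ε hx
  have hG := ((M.contDiff_cG.differentiable (by simp)).differentiableAt
    (x := x + ε • φ)).hasFDerivAt.comp_hasDerivAt ε hx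
  have h := ((hE.mul (hv1.mul hv1)).add (hF.mul ((hv1.mul hv2).add (hv2.mul hv1)))).add
    (hG.mul (hv2.mul hv2))
  refine (h.congr_of_eventuallyEq (Eventually.of_forall fun ε => ?_)).congr_deriv ?_
  · simp [M.g_eq (x + ε • φ)]
  · simp only [dx, M.g_eq, Prod.fst_add, Prod.snd_add, Prod.smul_fst, Prod.smul_snd, smul_eq_mul,
      Pi.mul_apply, Function.comp, Pi.add_apply]
    ring

lemma continuous_dx (M : TorusMetric) {X : Type*} [TopologicalSpace X] {x v e : X → ℝ × ℝ}
    (hx : Continuous x) (hv : Continuous v) (he : Continuous e) :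
    Continuous fun t => M.dx (x t) (v t) (e t) := by
  have hE : Continuous fun t => fderiv ℝ M.cE (x t) (e t) :=
    ((M.contDiff_cE.continuous_fderiv (by simp)).comp hx).clm_apply he
  have hF : Continuous fun t => fderiv ℝ M.cF (x t) (e t) :=
    ((M.contDiff_cF.continuous_fderiv (by simp)).comp hx).clm_apply he
  have hG : Continuous fun t => fderiv ℝ M.cG (x t) (e t) :=
    ((M.contDiff_cG.continuous_fderiv (by simp)).comp hx).clm_apply he
  unfold dx
  fun_prop

lemma energy_ge (M : TorusMetric) {z : ℝ → ℝ × ℝ} (hz : ContDiff ℝ 1 z) {a b : ℝ} (hab : a ≤ b)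
    (hd : M.dist (z a) (z b) = b - a) : b - a ≤ ∫ t in a..b, M.g (z t) (deriv z t) (deriv z t) := by
  have h1 := M.dist_le_length hz hab
  have hc : Continuous fun t => M.g (z t) (deriv z t) (deriv z t) :=
    M.continuous_g hz.continuous (hz.continuous_deriv le_rfl) (hz.continuous_deriv le_rfl)
  have h2 : M.length z a b ≤ ∫ t in a..b, (1 / 2 + 1 / 2 * M.g (z t) (deriv z t) (deriv z t)) := by
    apply intervalIntegral.integral_mono_on hab
    · exact (M.continuous_speed hz).intervalIntegrable _ _
    · exact (continuous_const.add (hc.const_mul _)).intervalIntegrable _ _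
    · intro t _
      change M.nrm (z t) (deriv z t) ≤ _
      rw [← M.nrm_sq]
      nlinarith [sq_nonneg (M.nrm (z t) (deriv z t) - 1)]
  rw [intervalIntegral.integral_add intervalIntegrable_const
    ((hc.const_mul _).intervalIntegrable _ _), intervalIntegral.integral_const_mul,
    intervalIntegral.integral_const, smul_eq_mul] at h2
  linarith

lemma euler_lagrange_weak {M : TorusMetric} {z : ℝ → ℝ × ℝ} (h : M.LocIso z) {a b : ℝ}
    (hab : a < b) (hI : M.IsoOn z a b) {φ : ℝ → ℝ × ℝ} (hφ : ContDiff ℝ 1 φ) (ha : φ a = 0)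
    (hb : φ b = 0) :
    ∫ t in a..b, (M.dx (z t) (deriv z t) (φ t) + 2 * M.g (z t) (deriv z t) (deriv φ t)) = 0 := by
  have hz := h.contDiff_one
  have cz := hz.continuous
  have cz' := hz.continuous_deriv le_rfl
  have cφ := hφ.continuous
  have cφ' := hφ.continuous_deriv le_rfl
  let J : ℝ → ℝ → ℝ := fun ε t =>
    M.g (z t + ε • φ t) (deriv z t + ε • deriv φ t) (deriv z t + ε • deriv φ t)
  let J' : ℝ → ℝ → ℝ := fun ε t => M.dx (z t + ε • φ t) (deriv z t + ε • deriv φ t) (φ t) +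
    2 * M.g (z t + ε • φ t) (deriv z t + ε • deriv φ t) (deriv φ t)
  have hJc : ∀ ε, Continuous (J ε) := fun ε =>
    M.continuous_g (by fun_prop) (by fun_prop) (by fun_prop)
  have hJ'c : Continuous fun p : ℝ × ℝ => J' p.1 p.2 :=
    (M.continuous_dx (by fun_prop) (by fun_prop) (by fun_prop)).add
      ((M.continuous_g (by fun_prop) (by fun_prop) (by fun_prop)).const_mul 2)
  obtain ⟨C, hC⟩ := ((isCompact_Icc (a := (-1 : ℝ)) (b := 1)).prod
    (isCompact_Icc (a := a) (b := b))).exists_bound_of_continuousOn hJ'c.continuousOn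
  have hder : HasDerivAt (fun ε => ∫ t in a..b, J ε t) (∫ t in a..b, J' 0 t) 0 := by
    refine (intervalIntegral.hasDerivAt_integral_of_dominated_loc_of_deriv_le
      (μ := MeasureTheory.volume) (F := J) (F' := J')
      (s := Icc (-1) 1) (bound := fun _ => C) (Icc_mem_nhds (by norm_num) (by norm_num))
      (Eventually.of_forall fun ε => (hJc ε).aestronglyMeasurable)
      ((hJc 0).intervalIntegrable _ _) ?_ ?_ intervalIntegrable_const ?_).2
    · exact (hJ'c.comp (Continuous.prodMk_right 0)).aestronglyMeasurable
    · refine Eventually.of_forall fun t ht ε hε => hC (ε, t) ⟨hε, ?_⟩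
      rw [uIoc_of_le hab.le] at ht; exact Ioc_subset_Icc_self ht
    · exact Eventually.of_forall fun t _ ε _ => M.hasDerivAt_energy _ _ _ _ _
  have hmin : IsLocalMin (fun ε => ∫ t in a..b, J ε t) 0 := by
    refine Eventually.of_forall fun ε => ?_
    have e1 : ∫ t in a..b, J 0 t = b - a := by
      have : ∀ t, J 0 t = 1 := fun t => by
        simp only [J, zero_smul, add_zero]
        rw [← M.nrm_sq, h.nrm_deriv]; norm_num
      simp [this]
    have hcu : ContDiff ℝ 1 fun t => z t + ε • φ t := hz.add (hφ.const_smul ε)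
    have e2 := M.energy_ge hcu hab.le (by
      simp only [ha, hb, smul_zero, add_zero]
      rw [hI a ⟨le_rfl, hab.le⟩ b ⟨hab.le, le_rfl⟩, abs_sub_comm, abs_of_pos (by linarith)])
    have e3 : ∀ t, deriv (fun t => z t + ε • φ t) t = deriv z t + ε • deriv φ t := fun t =>
      ((h.hasDerivAt t).add
        (((hφ.differentiable one_ne_zero).differentiableAt.hasDerivAt).const_smul
        ε)).deriv
    simp only [e3] at e2
    change (∫ t in a..b, J 0 t) ≤ ∫ t in a..b, J ε t
    rw [e1]; exact e2
  have := hmin.hasDerivAt_eq_zero hder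
  simpa [J'] using this

lemma dx_smul (M : TorusMetric) (x v e : ℝ × ℝ) (a : ℝ) : M.dx x v (a • e) = a * M.dx x v e := by
  simp only [dx, map_smul, smul_eq_mul]; ring

/-- The Euler-Lagrange equation. -/
lemma LocIso.euler_lagrange {M : TorusMetric} {z : ℝ → ℝ × ℝ} (h : M.LocIso z) (e : ℝ × ℝ) (t : ℝ) :
    HasDerivAt (fun t => 2 * M.g (z t) (deriv z t) e) (M.dx (z t) (deriv z t) e) t := by
  obtain ⟨a, b, h1, h2, -, h4⟩ := h.exists_small t
  have hz := h.contDiff_one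
  have cz := hz.continuous
  have cz' := hz.continuous_deriv le_rfl
  refine hasDerivAt_of_duBoisReymond (P := fun t => 2 * M.g (z t) (deriv z t) e)
    (Q := fun t => M.dx (z t) (deriv z t) e) ((M.continuous_g cz cz' continuous_const).const_mul 2)
    (M.continuous_dx cz cz' continuous_const) (h1.trans h2) ?_ t ⟨h1, h2⟩
  intro η hη ha hb
  have := euler_lagrange_weak h (h1.trans h2) h4 (φ := fun t => η t • e) (hη.smul contDiff_const)
    (by simp [ha]) (by simp [hb])
  rw [← this]
  congr 1; ext t
  have hd : deriv (fun t => η t • e) t = deriv η t • e :=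
    (((hη.differentiable one_ne_zero).differentiableAt.hasDerivAt).smul_const e).deriv
  rw [hd, M.dx_smul, M.smul_right]; ring

end EulerLagrange

end TorusMetric

namespace TorusMetric

section Hamilton

/-- The discriminant of the first fundamental form. -/
def disc (M : TorusMetric) (x : ℝ × ℝ) : ℝ := M.cE x * M.cG x - M.cF x ^ 2

lemma cE_pos (M : TorusMetric) (x : ℝ × ℝ) : 0 < M.cE x := M.posdef x _ (by simp)

lemma disc_pos (M : TorusMetric) (x : ℝ × ℝ) : 0 < M.disc x := by
  have h := M.posdef x (-M.cF x, M.cE x) (by simp [(M.cE_pos x).ne'])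
  rw [M.g_eq] at h
  have : 0 < M.cE x * M.disc x := by unfold disc; nlinarith
  exact pos_of_mul_pos_right this (M.cE_pos x).le

/-- The inverse of the Legendre transform `v ↦ 2 g x v`. -/
def vel (M : TorusMetric) (y : (ℝ × ℝ) × (ℝ × ℝ)) : ℝ × ℝ :=
  ((M.cG y.1 * y.2.1 - M.cF y.1 * y.2.2) / (2 * M.disc y.1),
    (M.cE y.1 * y.2.2 - M.cF y.1 * y.2.1) / (2 * M.disc y.1))

/-- The Legendre transform. -/
def mom (M : TorusMetric) (x v : ℝ × ℝ) : ℝ × ℝ := (2 * M.g x v (1, 0), 2 * M.g x v (0, 1))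

lemma vel_mom (M : TorusMetric) (x v : ℝ × ℝ) : M.vel (x, M.mom x v) = v := by
  have h := (M.disc_pos x).ne'
  ext
  · simp only [vel, mom, M.g_eq]
    rw [div_eq_iff (by positivity)]
    simp only [disc]; ring
  · simp only [vel, mom, M.g_eq]
    rw [div_eq_iff (by positivity)]
    simp only [disc]; ring

/-- The Hamiltonian vector field of the geodesic flow. -/
def field (M : TorusMetric) (y : (ℝ × ℝ) × (ℝ × ℝ)) : (ℝ × ℝ) × (ℝ × ℝ) :=
  (M.vel y, (M.dx y.1 (M.vel y) (1, 0), M.dx y.1 (M.vel y) (0, 1)))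

lemma contDiff_field (M : TorusMetric) : ContDiff ℝ (⊤ : ℕ∞) M.field := by
  have hE : ContDiff ℝ (⊤ : ℕ∞) fun y : (ℝ × ℝ) × (ℝ × ℝ) => M.cE y.1 :=
    M.contDiff_cE.comp contDiff_fst
  have hF : ContDiff ℝ (⊤ : ℕ∞) fun y : (ℝ × ℝ) × (ℝ × ℝ) => M.cF y.1 :=
    M.contDiff_cF.comp contDiff_fst
  have hG : ContDiff ℝ (⊤ : ℕ∞) fun y : (ℝ × ℝ) × (ℝ × ℝ) => M.cG y.1 :=
    M.contDiff_cG.comp contDiff_fst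
  have hd : ∀ y : (ℝ × ℝ) × (ℝ × ℝ), 2 * M.disc y.1 ≠ 0 := fun y => by
    have := M.disc_pos y.1; positivity
  have hD : ContDiff ℝ (⊤ : ℕ∞) fun y : (ℝ × ℝ) × (ℝ × ℝ) => 2 * M.disc y.1 := by
    unfold disc; fun_prop
  have hv : ContDiff ℝ (⊤ : ℕ∞) M.vel := by
    unfold vel
    refine ContDiff.prodMk (ContDiff.div ?_ hD hd) (ContDiff.div ?_ hD hd) <;> fun_prop
  have key : ∀ (f : ℝ × ℝ → ℝ), ContDiff ℝ (⊤ : ℕ∞) f → ∀ e : ℝ × ℝ,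
      ContDiff ℝ (⊤ : ℕ∞) fun y : (ℝ × ℝ) × (ℝ × ℝ) => fderiv ℝ f y.1 e := fun f hf e =>
    ((hf.fderiv_right (m := (⊤ : ℕ∞)) (by simp)).comp contDiff_fst).clm_apply contDiff_const
  have hdx : ∀ e : ℝ × ℝ, ContDiff ℝ (⊤ : ℕ∞) fun y : (ℝ × ℝ) × (ℝ × ℝ) =>
      M.dx y.1 (M.vel y) e := fun e => by
    have h1 := key _ M.contDiff_cE e
    have h2 := key _ M.contDiff_cF e
    have h3 := key _ M.contDiff_cG e
    unfold dx
    fun_prop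
  exact hv.prodMk ((hdx _).prodMk (hdx _))

lemma LocIso.hasDerivAt_phase {M : TorusMetric} {z : ℝ → ℝ × ℝ} (h : M.LocIso z) (t : ℝ) :
    HasDerivAt (fun t => (z t, M.mom (z t) (deriv z t)))
      (M.field (z t, M.mom (z t) (deriv z t))) t := by
  unfold field
  simp only [M.vel_mom]
  exact (h.hasDerivAt t).prodMk ((h.euler_lagrange (1, 0) t).prodMk (h.euler_lagrange (0, 1) t))

end Hamilton

end TorusMetric

lemma contDiff_of_hasDerivAt_comp {E : Type*} [NormedAddCommGroup E] [NormedSpace ℝ E] {f : E → E}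
    (hf : ContDiff ℝ (⊤ : ℕ∞) f) {y : ℝ → E} (hy : ∀ t, HasDerivAt y (f (y t)) t) :
    ContDiff ℝ (⊤ : ℕ∞) y := by
  have hd : deriv y = f ∘ y := funext fun t => (hy t).deriv
  rw [contDiff_infty]
  intro n
  induction n with
  | zero =>
    exact contDiff_zero.2 (continuous_iff_continuousAt.2 fun t => (hy t).continuousAt)
  | succ n ih =>
    push_cast
    rw [contDiff_succ_iff_deriv]
    refine ⟨fun t => (hy t).differentiableAt, fun h => absurd h (by simp), ?_⟩
    rw [hd]
    exact (hf.of_le (by exact_mod_cast le_top)).comp ih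

lemma eq_of_hasDerivAt_comp {E : Type*} [NormedAddCommGroup E] [NormedSpace ℝ E] {f : E → E}
    (hf : ContDiff ℝ (⊤ : ℕ∞) f) {y z : ℝ → E} (hy : ∀ t, HasDerivAt y (f (y t)) t)
    (hz : ∀ t, HasDerivAt z (f (z t)) t) {t₀ : ℝ} (h : y t₀ = z t₀) : y = z := by
  have cy : Continuous y := continuous_iff_continuousAt.2 fun t => (hy t).continuousAt
  have cz : Continuous z := continuous_iff_continuousAt.2 fun t => (hz t).continuousAt
  have hcl : IsClosed {t | y t = z t} := isClosed_eq cy cz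
  have hop : IsOpen {t | y t = z t} := by
    rw [isOpen_iff_mem_nhds]
    intro t ht
    obtain ⟨K, s, hs, hL⟩ := (hf.contDiffAt (x := y t)).of_le (m := 1)
      (by exact_mod_cast le_top) |>.exists_lipschitzOnWith
    refine ODE_solution_unique_of_eventually (v := fun _ => f) (s := fun _ => s)
      (Eventually.of_forall fun _ => hL) ?_ ?_ ht
    · filter_upwards [cy.continuousAt hs] with u hu using ⟨hy u, hu⟩
    · have hs' : s ∈ 𝓝 (z t) := by rwa [← (show y t = z t from ht)]
      filter_upwards [cz.continuousAt hs'] with u hu using ⟨hz u, hu⟩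
  have := IsClopen.eq_univ ⟨hcl, hop⟩ ⟨t₀, h⟩
  ext1 t
  exact (this ▸ mem_univ t : t ∈ {t | y t = z t})

namespace TorusMetric

section Geodesics

lemma LocIso.contDiff {M : TorusMetric} {z : ℝ → ℝ × ℝ} (h : M.LocIso z) :
    ContDiff ℝ (⊤ : ℕ∞) z :=
  (contDiff_of_hasDerivAt_comp M.contDiff_field h.hasDerivAt_phase).fst

lemma LocIso.eq_of_deriv_eq {M : TorusMetric} {y z : ℝ → ℝ × ℝ} (hy : M.LocIso y)
    (hz : M.LocIso z) {t : ℝ} (h0 : y t = z t) (h1 : deriv y t = deriv z t) : y = z := by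
  have := eq_of_hasDerivAt_comp M.contDiff_field hy.hasDerivAt_phase hz.hasDerivAt_phase
    (t₀ := t) (by rw [h0, h1])
  ext1 s
  exact congrArg Prod.fst (congrFun this s)

lemma length_of_nrm_eq_one {M : TorusMetric} {z : ℝ → ℝ × ℝ}
    (h : ∀ t, M.nrm (z t) (deriv z t) = 1) (a b : ℝ) : M.length z a b = b - a := by
  have : ∀ t, √(M.g (z t) (deriv z t) (deriv z t)) = 1 := h
  simp [length, this]

lemma IsGeodesic.nrm_deriv {M : TorusMetric} {z : ℝ → ℝ × ℝ} (h : M.IsGeodesic z) (t : ℝ) :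
    M.nrm (z t) (deriv z t) = 1 := by
  rw [nrm, h.2.1, Real.sqrt_one]

lemma isoOn_of_le {M : TorusMetric} {z : ℝ → ℝ × ℝ} {a b : ℝ}
    (h : ∀ s ∈ Icc a b, ∀ t ∈ Icc a b, s ≤ t → M.dist (z s) (z t) = t - s) : M.IsoOn z a b := by
  intro s hs t ht
  rcases le_total s t with hst | hst
  · rw [h s hs t ht hst, abs_sub_comm, abs_of_nonneg (by linarith)]
  · rw [M.dist_comm, h t ht s hs hst, abs_of_nonneg (by linarith)]

lemma IsGeodesic.locIso {M : TorusMetric} {z : ℝ → ℝ × ℝ} (h : M.IsGeodesic z) : M.LocIso z := by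
  intro t
  obtain ⟨ε, hε, hd⟩ := h.2.2 t
  refine ⟨ε, hε, isoOn_of_le fun s hs u hu hsu => ?_⟩
  rw [hd s u hs.1 hsu hu.2, length_of_nrm_eq_one h.nrm_deriv]

lemma LocIso.isGeodesic {M : TorusMetric} {z : ℝ → ℝ × ℝ} (h : M.LocIso z) : M.IsGeodesic z := by
  refine ⟨h.contDiff, fun t => ?_, fun t => ?_⟩
  · rw [← M.nrm_sq, h.nrm_deriv]; norm_num
  · obtain ⟨ε, hε, hi⟩ := h t
    refine ⟨ε, hε, fun s u h1 h2 h3 => ?_⟩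
    rw [hi s ⟨h1, h2.trans h3⟩ u ⟨h1.trans h2, h3⟩, length_of_nrm_eq_one h.nrm_deriv,
      abs_sub_comm, abs_of_nonneg (by linarith)]

lemma LocIso.neg {M : TorusMetric} {z : ℝ → ℝ × ℝ} (h : M.LocIso z) :
    M.LocIso fun t => z (-t) := by
  intro t
  obtain ⟨ε, hε, hi⟩ := h (-t)
  refine ⟨ε, hε, fun s hs u hu => ?_⟩
  rw [hi (-s) ⟨by linarith [hs.2], by linarith [hs.1]⟩ (-u)
    ⟨by linarith [hu.2], by linarith [hu.1]⟩,
    abs_sub_comm]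
  congr 1; ring

lemma LocIso.comp_add {M : TorusMetric} {z : ℝ → ℝ × ℝ} (h : M.LocIso z) (a : ℝ) :
    M.LocIso fun t => z (t + a) := by
  intro t
  obtain ⟨ε, hε, hi⟩ := h (t + a)
  refine ⟨ε, hε, fun s hs u hu => ?_⟩
  rw [hi (s + a) ⟨by linarith [hs.1], by linarith [hs.2]⟩ (u + a)
    ⟨by linarith [hu.1], by linarith [hu.2]⟩]
  congr 1; ring

/-- `z` is a globally isometric line. -/
def IsLine (M : TorusMetric) (z : ℝ → ℝ × ℝ) : Prop := ∀ s t, M.dist (z s) (z t) = |s - t|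

lemma IsLine.isoOn {M : TorusMetric} {z : ℝ → ℝ × ℝ} (h : M.IsLine z) (a b : ℝ) : M.IsoOn z a b :=
  fun s _ t _ => h s t

lemma IsLine.locIso {M : TorusMetric} {z : ℝ → ℝ × ℝ} (h : M.IsLine z) : M.LocIso z :=
  fun _ => ⟨1, one_pos, h.isoOn _ _⟩

lemma IsLine.add_lat {M : TorusMetric} {z : ℝ → ℝ × ℝ} (h : M.IsLine z) (k : ℤ × ℤ) :
    M.IsLine fun t => z t + lat k := fun s t => by
  rw [M.dist_add_lat, h]

lemma IsGeodesic.isLine {M : TorusMetric} {z : ℝ → ℝ × ℝ} (h : M.IsGeodesic z)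
    (hm : IsMinimal M z) : M.IsLine z := fun s t => by
  refine isoOn_of_le (a := min s t) (b := max s t) (fun u _ v _ huv => ?_) s
    ⟨min_le_left _ _, le_max_left _ _⟩ t ⟨min_le_right _ _, le_max_right _ _⟩
  rw [hm u v huv, length_of_nrm_eq_one h.nrm_deriv]

end Geodesics

end TorusMetric

section Polar

/-- The inner product with `w`. -/
def xi (w x : ℝ × ℝ) : ℝ := w.1 * x.1 + w.2 * x.2

/-- The determinant with `w`. -/
abbrev zt (w x : ℝ × ℝ) : ℝ := crossDet w x

lemma zt_add (w x y : ℝ × ℝ) : zt w (x + y) = zt w x + zt w y := by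
  simp [crossDet]; ring
lemma zt_sub (w x y : ℝ × ℝ) : zt w (x - y) = zt w x - zt w y := by
  simp [crossDet]; ring
lemma zt_neg (w x : ℝ × ℝ) : zt w (-x) = -zt w x := by
  simp [crossDet]; ring
lemma zt_smul (w x : ℝ × ℝ) (a : ℝ) : zt w (a • x) = a * zt w x := by
  simp [crossDet]; ring
lemma zt_self (w : ℝ × ℝ) : zt w w = 0 := by
  simp [crossDet]; ring
lemma xi_add (w x y : ℝ × ℝ) : xi w (x + y) = xi w x + xi w y := by
  simp [xi]; ring
lemma xi_sub (w x y : ℝ × ℝ) : xi w (x - y) = xi w x - xi w y := by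
  simp [xi]; ring
lemma xi_smul (w x : ℝ × ℝ) (a : ℝ) : xi w (a • x) = a * xi w x := by
  simp [xi]; ring
lemma continuous_zt (w : ℝ × ℝ) : Continuous (zt w) := by unfold zt crossDet; fun_prop
lemma continuous_xi (w : ℝ × ℝ) : Continuous (xi w) := by unfold xi; fun_prop

lemma xi_self_pos {w : ℝ × ℝ} (hw : w ≠ 0) : 0 < xi w w := by
  have : w.1 ≠ 0 ∨ w.2 ≠ 0 := by
    by_contra! h; exact hw (Prod.ext h.1 h.2)
  unfold xi
  rcases this with h | h
  · nlinarith [mul_self_pos.2 h, mul_self_nonneg w.2]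
  · nlinarith [mul_self_pos.2 h, mul_self_nonneg w.1]

lemma xi_mul_xi_add (w x y : ℝ × ℝ) :
    xi w x * xi w y + zt w x * zt w y = xi w w * (x.1 * y.1 + x.2 * y.2) := by
  simp [xi, crossDet]; ring

lemma eq_zero_of_xi_zt {w x : ℝ × ℝ} (hw : w ≠ 0) (h1 : xi w x = 0) (h2 : zt w x = 0) : x = 0 := by
  have h := xi_mul_xi_add w x x
  rw [h1, h2] at h
  have h3 : x.1 * x.1 + x.2 * x.2 = 0 := by
    have := xi_self_pos hw
    rcases mul_eq_zero.1 (show xi w w * (x.1 * x.1 + x.2 * x.2) = 0 by linarith) with h | h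
    · linarith
    · exact h
  have h4 : x.1 = 0 := mul_self_eq_zero.1 (by nlinarith [mul_self_nonneg x.1, mul_self_nonneg x.2])
  have h5 : x.2 = 0 := mul_self_eq_zero.1 (by nlinarith [mul_self_nonneg x.1, mul_self_nonneg x.2])
  exact Prod.ext h4 h5

/-- `θ` is a polar angle of `x` in the coordinates given by `w`. -/
def Polar (w x : ℝ × ℝ) (θ : ℝ) : Prop :=
  ∃ r > 0, xi w x = r * Real.cos θ ∧ zt w x = r * Real.sin θ

lemma exists_lift {X : Type*} [TopologicalSpace X] [LocallyPathConnectedSpace X]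
    [ContractibleSpace X] {w : ℝ × ℝ} (hw : w ≠ 0) {f : X → ℝ × ℝ} (hf : Continuous f)
    (h0 : ∀ x, f x ≠ 0) : ∃ θ : X → ℝ, Continuous θ ∧ ∀ x, Polar w (f x) (θ x) := by
  let g : X → ℂ := fun x => ⟨xi w (f x), zt w (f x)⟩
  have hg : Continuous g := by
    have : g = fun x => ((xi w (f x) : ℝ) : ℂ) + ((zt w (f x) : ℝ) : ℂ) * Complex.I := by
      ext x; simp [g, Complex.ext_iff]
    rw [this]
    have := (continuous_xi w).comp hf
    have := (continuous_zt w).comp hf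
    fun_prop
  have hg0 : (0 : ℂ) ∉ g '' univ := by
    rintro ⟨x, -, hx⟩
    exact h0 x (eq_zero_of_xi_zt hw (congrArg Complex.re hx) (congrArg Complex.im hx))
  have hU : IsSimplyConnected (univ : Set X) := by
    have := (Homeomorph.Set.univ X).contractibleSpace
    exact (inferInstance : SimplyConnectedSpace (univ : Set X))
  obtain ⟨L, hL, hE⟩ := Complex.exists_continuousOn_eqOn_exp_comp
    (U := (univ : Set X)) hU isOpen_univ hg.continuousOn hg0
  refine ⟨fun x => (L x).im, Complex.continuous_im.comp (continuousOn_univ.1 hL), fun x =>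
    ⟨Real.exp (L x).re, Real.exp_pos _, ?_, ?_⟩⟩
  · have := congrArg Complex.re (hE (mem_univ x))
    simp only [Function.comp, Complex.exp_re] at this
    exact this.symm
  · have := congrArg Complex.im (hE (mem_univ x))
    simp only [Function.comp, Complex.exp_im] at this
    exact this.symm

lemma Polar.zt_pos {w x : ℝ × ℝ} {θ : ℝ} (h : Polar w x θ) : 0 < zt w x ↔ 0 < Real.sin θ := by
  obtain ⟨r, hr, -, h⟩ := h
  rw [h, mul_pos_iff_of_pos_left hr]
lemma Polar.zt_neg {w x : ℝ × ℝ} {θ : ℝ} (h : Polar w x θ) : zt w x < 0 ↔ Real.sin θ < 0 := by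
  obtain ⟨r, hr, -, h⟩ := h
  rw [h]
  exact ⟨fun h => by by_contra! h'; nlinarith [mul_nonneg hr.le h'], mul_neg_of_pos_of_neg hr⟩
lemma Polar.xi_pos {w x : ℝ × ℝ} {θ : ℝ} (h : Polar w x θ) : 0 < xi w x ↔ 0 < Real.cos θ := by
  obtain ⟨r, hr, h, -⟩ := h
  rw [h, mul_pos_iff_of_pos_left hr]
lemma Polar.xi_neg {w x : ℝ × ℝ} {θ : ℝ} (h : Polar w x θ) : xi w x < 0 ↔ Real.cos θ < 0 := by
  obtain ⟨r, hr, h, -⟩ := h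
  rw [h]
  exact ⟨fun h => by by_contra! h'; nlinarith [mul_nonneg hr.le h'], mul_neg_of_pos_of_neg hr⟩

lemma Polar.add_int {w x : ℝ × ℝ} {θ : ℝ} (h : Polar w x θ) (k : ℤ) :
    Polar w x (θ + 2 * Real.pi * k) := by
  obtain ⟨r, hr, h1, h2⟩ := h
  refine ⟨r, hr, ?_, ?_⟩
  · rw [h1, mul_comm (2 * Real.pi), Real.cos_add_int_mul_two_pi]
  · rw [h2, mul_comm (2 * Real.pi), Real.sin_add_int_mul_two_pi]

lemma Polar.cos_sub_pos {w x y : ℝ × ℝ} (hw : w ≠ 0) {θ φ : ℝ} (h : Polar w x θ)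
    (h' : Polar w y φ) (hxy : 0 < x.1 * y.1 + x.2 * y.2) : 0 < Real.cos (θ - φ) := by
  obtain ⟨r, hr, h1, h2⟩ := h
  obtain ⟨r', hr', h1', h2'⟩ := h'
  have := xi_mul_xi_add w x y
  have h3 : 0 < xi w w * (x.1 * y.1 + x.2 * y.2) := mul_pos (xi_self_pos hw) hxy
  rw [← this, h1, h2, h1', h2'] at h3
  have h4 : 0 < r * r' * Real.cos (θ - φ) := by rw [Real.cos_sub]; nlinarith
  exact pos_of_mul_pos_right h4 (by positivity)

lemma dot_pos_of_norm_lt {x y : ℝ × ℝ} (h : 2 * ‖x - y‖ < ‖x‖) : 0 < x.1 * y.1 + x.2 * y.2 := by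
  have h1 := abs_fst_le (x - y)
  have h2 := abs_snd_le (x - y)
  have h3 : ‖x‖ = max |x.1| |x.2| := rfl
  simp only [Prod.fst_sub, Prod.snd_sub] at h1 h2
  set e := ‖x - y‖
  have he : 0 ≤ e := norm_nonneg _
  have a1 : x.1 * y.1 ≥ x.1 ^ 2 - |x.1| * e := by
    have : x.1 * (x.1 - y.1) ≤ |x.1| * e := (le_abs_self _).trans (by rw [abs_mul]; gcongr)
    nlinarith
  have a2 : x.2 * y.2 ≥ x.2 ^ 2 - |x.2| * e := by
    have : x.2 * (x.2 - y.2) ≤ |x.2| * e := (le_abs_self _).trans (by rw [abs_mul]; gcongr)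
    nlinarith
  rw [← sq_abs] at a1 a2
  rw [h3] at h
  rcases max_cases |x.1| |x.2| with ⟨hm, hl⟩ | ⟨hm, hl⟩
  · rw [hm] at h; nlinarith [abs_nonneg x.1, abs_nonneg x.2]
  · rw [hm] at h; nlinarith [abs_nonneg x.1, abs_nonneg x.2]

lemma abs_lt_pi_div_two_of_cos_pos {x : ℝ} (hx : |x| ≤ Real.pi) (h : 0 < Real.cos x) :
    |x| < Real.pi / 2 := by
  by_contra! h'
  rw [← Real.cos_abs] at h
  linarith [Real.cos_nonpos_of_pi_div_two_le_of_le h' (by linarith [Real.pi_pos])]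

/-- On a preconnected set where `cos (θ - a) > 0`, the function `θ` stays in one branch. -/
lemma exists_branch {X : Type*} [TopologicalSpace X] {S : Set X} (hS : IsPreconnected S)
    {θ : X → ℝ} (hθ : ContinuousOn θ S) (a : ℝ) (h : ∀ t ∈ S, 0 < Real.cos (θ t - a)) :
    ∃ k : ℤ, ∀ t ∈ S, |θ t - a - 2 * Real.pi * k| < Real.pi / 2 := by
  rcases S.eq_empty_or_nonempty with rfl | ⟨t₀, ht₀⟩
  · simp
  have hpi := Real.pi_pos
  refine ⟨round ((θ t₀ - a) / (2 * Real.pi)), ?_⟩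
  set k := round ((θ t₀ - a) / (2 * Real.pi)) with hk
  have hcos : ∀ t ∈ S, 0 < Real.cos (θ t - a - 2 * Real.pi * k) := fun t ht => by
    rw [mul_comm, Real.cos_sub_int_mul_two_pi]; exact h t ht
  have h0 : |θ t₀ - a - 2 * Real.pi * k| < Real.pi / 2 := by
    refine abs_lt_pi_div_two_of_cos_pos ?_ (hcos t₀ ht₀)
    have := abs_sub_round ((θ t₀ - a) / (2 * Real.pi))
    rw [← hk] at this
    have e : θ t₀ - a - 2 * Real.pi * k = (2 * Real.pi) * ((θ t₀ - a) / (2 * Real.pi) - k) := by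
      field_simp
    rw [e, abs_mul, abs_of_pos (by positivity : 0 < 2 * Real.pi)]
    nlinarith
  intro t ht
  by_contra! hc
  obtain ⟨t', ht', he⟩ : ∃ t' ∈ S, |θ t' - a - 2 * Real.pi * k| = Real.pi / 2 :=
    hS.intermediate_value ht₀ ht
      (f := fun t => |θ t - a - 2 * Real.pi * k|) (by fun_prop) ⟨h0.le, hc⟩
  have := hcos t' ht'
  rw [← Real.cos_abs, he, Real.cos_pi_div_two] at this
  exact lt_irrefl _ this

lemma Polar.exists_int {w x : ℝ × ℝ} {θ φ : ℝ} (h : Polar w x θ) (h' : Polar w x φ) :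
    ∃ k : ℤ, θ = φ + 2 * Real.pi * k := by
  obtain ⟨r, hr, h1, h2⟩ := h
  obtain ⟨r', hr', h1', h2'⟩ := h'
  have e1 : r = r' := by
    have a : xi w x ^ 2 + zt w x ^ 2 = r ^ 2 := by
      rw [h1, h2]; nlinarith [Real.sin_sq_add_cos_sq θ]
    have b : xi w x ^ 2 + zt w x ^ 2 = r' ^ 2 := by
      rw [h1', h2']; nlinarith [Real.sin_sq_add_cos_sq φ]
    exact (pow_left_inj₀ hr.le hr'.le two_ne_zero).1 (a.symm.trans b)
  subst e1
  have c1 : Real.cos θ = Real.cos φ := mul_left_cancel₀ hr.ne' (h1.symm.trans h1')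
  have c2 : Real.sin θ = Real.sin φ := mul_left_cancel₀ hr.ne' (h2.symm.trans h2')
  have c3 : Real.cos (θ - φ) = 1 := by
    rw [Real.cos_sub, c1, c2]; nlinarith [Real.sin_sq_add_cos_sq φ]
  obtain ⟨k, hk⟩ := (Real.cos_eq_one_iff _).1 c3
  exact ⟨k, by linarith⟩

lemma int_eq_of_lt {k j : ℤ} (h1 : 2 * Real.pi * k < 2 * Real.pi * j + 2 * Real.pi)
    (h2 : 2 * Real.pi * j < 2 * Real.pi * k + 2 * Real.pi) : k = j := by
  have hpi := Real.pi_pos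
  have a : (k : ℝ) < j + 1 := by
    by_contra! h; nlinarith
  have b : (j : ℝ) < k + 1 := by
    by_contra! h; nlinarith
  have a' : k < j + 1 := by exact_mod_cast a
  have b' : j < k + 1 := by exact_mod_cast b
  omega

end Polar

lemma continuous_of_Icc {X : Type*} [TopologicalSpace X] {g : ℝ → X} {a b : ℝ} (hab : a ≤ b)
    (hg : ContinuousOn g (Icc a b)) :
    ∃ f : ℝ → X, Continuous f ∧ (∀ t ∈ Icc a b, f t = g t) ∧
      ∀ t, ∃ s ∈ Icc a b, f t = g s :=
  ⟨fun t => g (projIcc a b hab t),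
    (hg.comp_continuous (continuous_subtype_val.comp continuous_projIcc)
      fun t => (projIcc a b hab t).2),
    fun t ht => by simp only [projIcc_of_mem hab ht], fun t => ⟨_, (projIcc a b hab t).2, rfl⟩⟩

namespace TorusMetric

/-- `α` is an isometric line on which `lat k` acts as the translation by `ℓ > 0`. -/
structure PerLine (M : TorusMetric) (k : ℤ × ℤ) (ℓ : ℝ) (α : ℝ → ℝ × ℝ) : Prop where
  pos : 0 < ℓ
  line : M.IsLine α
  per : ∀ u, α (u + ℓ) = α u + lat k

section Lip

/-- `γ` is `1`-Lipschitz on `[a, b]`. -/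
def LipOn (M : TorusMetric) (γ : ℝ → ℝ × ℝ) (a b : ℝ) : Prop :=
  ∀ s ∈ Icc a b, ∀ t ∈ Icc a b, M.dist (γ s) (γ t) ≤ |s - t|

lemma norm_sub_le_of_dist {M : TorusMetric} {x y : ℝ × ℝ} {r : ℝ} (h : M.dist x y ≤ r) :
    ‖x - y‖ ≤ r / M.lo := by
  rw [le_div_iff₀ M.lo_pos, mul_comm]
  exact (M.lo_le_dist x y).trans h

lemma LipOn.continuousOn {M : TorusMetric} {γ : ℝ → ℝ × ℝ} {a b : ℝ} (h : M.LipOn γ a b) :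
    ContinuousOn γ (Icc a b) := by
  have : LipschitzOnWith (Real.toNNReal M.lo⁻¹) γ (Icc a b) := by
    refine LipschitzOnWith.of_dist_le_mul fun s hs t ht => ?_
    rw [dist_eq_norm, Real.dist_eq, Real.coe_toNNReal _ (inv_nonneg.2 M.lo_pos.le), mul_comm,
      ← div_eq_mul_inv]
    exact norm_sub_le_of_dist (h s hs t ht)
  exact this.continuousOn

lemma IsoOn.lipOn {M : TorusMetric} {γ : ℝ → ℝ × ℝ} {a b : ℝ} (h : M.IsoOn γ a b) :
    M.LipOn γ a b := fun s hs t ht => (h s hs t ht).le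

lemma LipOn.mono {M : TorusMetric} {z : ℝ → ℝ × ℝ} {a b a' b' : ℝ} (h : M.LipOn z a b)
    (ha : a ≤ a') (hb : b' ≤ b) : M.LipOn z a' b' := fun s hs t ht =>
  h s (Icc_subset_Icc ha hb hs) t (Icc_subset_Icc ha hb ht)

lemma lipOn_of_le {M : TorusMetric} {z : ℝ → ℝ × ℝ} {a b : ℝ}
    (h : ∀ s ∈ Icc a b, ∀ t ∈ Icc a b, s ≤ t → M.dist (z s) (z t) ≤ t - s) : M.LipOn z a b := by
  intro s hs t ht
  rcases le_total s t with hst | hst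
  · rw [abs_sub_comm, abs_of_nonneg (by linarith)]; exact h s hs t ht hst
  · rw [M.dist_comm, abs_of_nonneg (by linarith)]; exact h t ht s hs hst

lemma LipOn.le {M : TorusMetric} {z : ℝ → ℝ × ℝ} {a b s t : ℝ} (h : M.LipOn z a b)
    (hs : a ≤ s) (hst : s ≤ t) (ht : t ≤ b) : M.dist (z s) (z t) ≤ t - s := by
  have := h s ⟨hs, hst.trans ht⟩ t ⟨hs.trans hst, ht⟩
  rwa [abs_sub_comm, abs_of_nonneg (by linarith)] at this

lemma LipOn.congr {M : TorusMetric} {z y : ℝ → ℝ × ℝ} {a b : ℝ} (h : M.LipOn z a b)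
    (he : ∀ t ∈ Icc a b, y t = z t) : M.LipOn y a b := fun s hs t ht => by
  rw [he s hs, he t ht]; exact h s hs t ht

lemma LipOn.glue {M : TorusMetric} {z : ℝ → ℝ × ℝ} {a b c : ℝ}
    (h1 : M.LipOn z a b) (h2 : M.LipOn z b c) : M.LipOn z a c := by
  refine lipOn_of_le fun s hs t ht hst => ?_
  rcases le_total t b with htb | htb
  · exact h1.le hs.1 hst htb
  rcases le_total s b with hsb | hsb
  · have e1 := h1.le hs.1 hsb le_rfl
    have e2 := h2.le le_rfl htb ht.2
    linarith [M.dist_triangle (z s) (z b) (z t)]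
  · exact h2.le hsb hst ht.2

lemma LipOn.comp_add {M : TorusMetric} {z : ℝ → ℝ × ℝ} {a b : ℝ} (h : M.LipOn z a b) (s : ℝ) :
    M.LipOn (fun t => z (t + s)) (a - s) (b - s) := fun u hu v hv => by
  have := h (u + s) ⟨by linarith [hu.1], by linarith [hu.2]⟩ (v + s)
    ⟨by linarith [hv.1], by linarith [hv.2]⟩
  rwa [show u + s - (v + s) = u - v by ring] at this

/-- Concatenation of two curves at the parameter `c`. -/
def _root_.join (y z : ℝ → ℝ × ℝ) (c : ℝ) : ℝ → ℝ × ℝ := fun t => if t ≤ c then y t else z t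

lemma _root_.join_left {y z : ℝ → ℝ × ℝ} {c t : ℝ} (h : t ≤ c) : join y z c t = y t := if_pos h

lemma _root_.join_right {y z : ℝ → ℝ × ℝ} {c t : ℝ} (hc : y c = z c) (h : c ≤ t) :
    join y z c t = z t := by
  rcases h.eq_or_lt with rfl | h
  · rw [join_left le_rfl, hc]
  · exact if_neg (not_le.2 h)

lemma LipOn.join {M : TorusMetric} {y z : ℝ → ℝ × ℝ} {a b c : ℝ}
    (h1 : M.LipOn y a c) (h2 : M.LipOn z c b) (hc : y c = z c) : M.LipOn (join y z c) a b :=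
  (h1.congr fun _ ht => join_left ht.2).glue (h2.congr fun _ ht => join_right hc ht.1)

lemma LipOn.isoOn {M : TorusMetric} {z : ℝ → ℝ × ℝ} {a b : ℝ} (h : M.LipOn z a b)
    (hd : b - a ≤ M.dist (z a) (z b)) : M.IsoOn z a b := by
  refine isoOn_of_le fun s hs t ht hst => le_antisymm (h.le hs.1 hst ht.2) ?_
  have e1 := h.le le_rfl hs.1 hs.2
  have e2 := h.le ht.1 ht.2 le_rfl
  linarith [M.dist_triangle (z a) (z s) (z b), M.dist_triangle (z s) (z t) (z b)]

end Lip

section Sides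

variable {M : TorusMetric} {k : ℤ × ℤ} {ℓ : ℝ} {α : ℝ → ℝ × ℝ}

lemma IsLine.lipOn (h : M.IsLine α) (a b : ℝ) : M.LipOn α a b := (h.isoOn a b).lipOn

lemma IsLine.continuous (h : M.IsLine α) : Continuous α := by
  rw [continuous_iff_continuousAt]
  intro t
  exact (h.lipOn (t - 1) (t + 1)).continuousOn.continuousAt
    (Icc_mem_nhds (by linarith) (by linarith))

lemma IsLine.isClosed_range (h : M.IsLine α) : IsClosed (range α) := by
  have h1 : AntilipschitzWith (Real.toNNReal M.hi) α := by
    refine AntilipschitzWith.of_le_mul_dist fun s t => ?_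
    rw [Real.dist_eq, dist_eq_norm, Real.coe_toNNReal _ M.hi_pos.le, ← h s t]
    exact M.dist_le_hi _ _
  have h2 : LipschitzWith (Real.toNNReal M.lo⁻¹) α := by
    refine LipschitzWith.of_dist_le_mul fun s t => ?_
    rw [dist_eq_norm, Real.dist_eq, Real.coe_toNNReal _ (inv_nonneg.2 M.lo_pos.le), mul_comm,
      ← div_eq_mul_inv]
    exact norm_sub_le_of_dist (h s t).le
  exact h1.isClosed_range h2.uniformContinuous

lemma PerLine.add_lat (h : M.PerLine k ℓ α) (j : ℤ × ℤ) :
    M.PerLine k ℓ fun u => α u + lat j :=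
  ⟨h.pos, h.line.add_lat j, fun u => by rw [h.per]; abel⟩

lemma PerLine.lat_ne_zero (h : M.PerLine k ℓ α) : lat k ≠ 0 := by
  intro h0
  have h1 := h.line (0 + ℓ) 0
  rw [h.per, h0, add_zero, M.dist_self, zero_add, sub_zero, abs_of_pos h.pos] at h1
  exact h.pos.ne h1

lemma _root_.exists_bound_of_periodic {f : ℝ → ℝ} {ℓ : ℝ} (hl : 0 < ℓ) (hf : Continuous f)
    (hp : ∀ u, f (u + ℓ) = f u) : ∃ C > 0, ∀ u, |f u| ≤ C := by
  obtain ⟨C, hC⟩ := isCompact_Icc.exists_bound_of_continuousOn (hf.continuousOn (s := Icc 0 ℓ))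
  refine ⟨max C 1, lt_max_of_lt_right one_pos, fun u => ?_⟩
  obtain ⟨v, hv, he⟩ := Function.Periodic.exists_mem_Ico₀ hp hl u
  rw [he]
  exact (hC v (Ico_subset_Icc_self hv)).trans (le_max_left _ _)

lemma PerLine.exists_bound (h : M.PerLine k ℓ α) :
    ∃ C > 0, (∀ u, |zt (lat k) (α u)| ≤ C) ∧
      ∀ u, |xi (lat k) (α u) - xi (lat k) (lat k) / ℓ * u| ≤ C := by
  have hc := h.line.continuous
  obtain ⟨C₁, h1, b1⟩ := exists_bound_of_periodic h.pos
    ((continuous_zt (lat k)).comp hc) fun u => by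
      simp only [Function.comp, h.per, zt_add, zt_self, add_zero]
  obtain ⟨C₂, h2, b2⟩ := exists_bound_of_periodic h.pos
    (f := fun u => xi (lat k) (α u) - xi (lat k) (lat k) / ℓ * u)
    (((continuous_xi (lat k)).comp hc).sub (by fun_prop)) fun u => by
      have := h.pos.ne'
      simp only [h.per, xi_add]; field_simp; ring
  exact ⟨max C₁ C₂, lt_max_of_lt_left h1, fun u => (b1 u).trans (le_max_left _ _),
    fun u => (b2 u).trans (le_max_right _ _)⟩

/-- A path from far below to far above a periodic line meets the line. -/
lemma PerLine.crossing (h : M.PerLine k ℓ α) {C : ℝ} (hC : ∀ u, |zt (lat k) (α u)| ≤ C)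
    {g : ℝ → ℝ × ℝ} {a b : ℝ} (hab : a ≤ b) (hg : ContinuousOn g (Icc a b))
    (ha : zt (lat k) (g a) < -C) (hb : C < zt (lat k) (g b)) :
    ∃ t ∈ Icc a b, g t ∈ range α := by
  by_contra! hno
  have hw := h.lat_ne_zero
  obtain ⟨f, hf, hfg, hfs⟩ := continuous_of_Icc hab hg
  obtain ⟨B, hB⟩ := isCompact_Icc.exists_bound_of_continuousOn
    (((continuous_xi (lat k)).comp hf).continuousOn (s := Icc a b))
  obtain ⟨C', -, -, hx⟩ := h.exists_bound
  set κ := xi (lat k) (lat k) / ℓ with hκ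
  have hκ0 : 0 < κ := div_pos (xi_self_pos hw) h.pos
  obtain ⟨T, hT0, hT⟩ : ∃ T > 0, B + C' < κ * T := by
    refine ⟨(|B + C'| + 1) / κ, by positivity, ?_⟩
    rw [mul_div_cancel₀ _ hκ0.ne']
    linarith [le_abs_self (B + C')]
  obtain ⟨θ, hθ, hP⟩ := exists_lift hw (X := ℝ × ℝ) (f := fun p => α p.1 - f p.2)
    ((h.line.continuous.comp continuous_fst).sub (hf.comp continuous_snd)) fun p h0 => by
      obtain ⟨s, hs, he⟩ := hfs p.2
      exact hno s hs (he ▸ ⟨p.1, sub_eq_zero.1 h0⟩)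
  have ha' : a ∈ Icc a b := ⟨le_rfl, hab⟩
  have hb' : b ∈ Icc a b := ⟨hab, le_rfl⟩
  obtain ⟨k0, h0⟩ := exists_branch (S := univ) isPreconnected_univ (θ := fun t => θ (t, a))
    (by fun_prop) (Real.pi / 2) (fun t _ => by
      rw [Real.cos_sub_pi_div_two, ← (hP (t, a)).zt_pos, zt_sub, hfg a ha']
      linarith [(abs_le.1 (hC t)).1])
  obtain ⟨k1, h1⟩ := exists_branch (S := univ) isPreconnected_univ (θ := fun t => θ (t, b))
    (by fun_prop) (-(Real.pi / 2)) (fun t _ => by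
      rw [sub_neg_eq_add, Real.cos_add_pi_div_two, Left.neg_pos_iff, ← (hP (t, b)).zt_neg, zt_sub,
        hfg b hb']
      linarith [(abs_le.1 (hC t)).2])
  obtain ⟨k2, h2⟩ := exists_branch (S := Icc a b) isPreconnected_Icc (θ := fun s => θ (T, s))
    (by fun_prop) 0 (fun s hs => by
      rw [sub_zero, ← (hP (T, s)).xi_pos, xi_sub]
      have := (abs_le.1 (hx T)).1
      have := (abs_le.1 (hB s hs)).2
      simp only [Function.comp] at this ⊢
      linarith)
  obtain ⟨k3, h3⟩ := exists_branch (S := Icc a b) isPreconnected_Icc (θ := fun s => θ (-T, s))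
    (by fun_prop) Real.pi (fun s hs => by
      rw [Real.cos_sub_pi, Left.neg_pos_iff, ← (hP (-T, s)).xi_neg, xi_sub]
      have := (abs_le.1 (hx (-T))).2
      have := (abs_le.1 (hB s hs)).1
      simp only [Function.comp] at this ⊢
      linarith)
  have a1 := abs_lt.1 (h0 T trivial)
  have a2 := abs_lt.1 (h0 (-T) trivial)
  have a3 := abs_lt.1 (h1 T trivial)
  have a4 := abs_lt.1 (h1 (-T) trivial)
  have a5 := abs_lt.1 (h2 a ha')
  have a6 := abs_lt.1 (h2 b hb')
  have a7 := abs_lt.1 (h3 a ha')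
  have a8 := abs_lt.1 (h3 b hb')
  have hpi := Real.pi_pos
  have e1 : k0 = k2 := int_eq_of_lt (by linarith) (by linarith)
  have e2 : k0 = k3 := int_eq_of_lt (by linarith) (by linarith)
  have e3 : k1 = k2 := int_eq_of_lt (by linarith) (by linarith)
  subst e1 e2 e3
  linarith

/-- The points that can be joined to the far upper half plane off the set `A`. -/
def _root_.above (w : ℝ × ℝ) (C : ℝ) (A : Set (ℝ × ℝ)) : Set (ℝ × ℝ) :=
  {x | ∃ y, C < zt w y ∧ JoinedIn Aᶜ x y}

lemma _root_.above_subset {w : ℝ × ℝ} {C : ℝ} {A : Set (ℝ × ℝ)} : above w C A ⊆ Aᶜ :=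
  fun _ ⟨_, _, h⟩ => h.source_mem

lemma _root_.mem_above_of_joinedIn {w : ℝ × ℝ} {C : ℝ} {A : Set (ℝ × ℝ)} {x y : ℝ × ℝ}
    (h : JoinedIn Aᶜ x y) (hy : y ∈ above w C A) : x ∈ above w C A := by
  obtain ⟨z, hz, hj⟩ := hy
  exact ⟨z, hz, h.trans hj⟩

lemma _root_.isOpen_above {w : ℝ × ℝ} {C : ℝ} {A : Set (ℝ × ℝ)} (hA : IsClosed A) :
    IsOpen (above w C A) := by
  have : above w C A = ⋃ y ∈ {y | C < zt w y}, pathComponentIn Aᶜ y := by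
    ext x
    simp only [above, mem_ofPred_eq, mem_iUnion, exists_prop, pathComponentIn]
    exact exists_congr fun y => and_congr_right fun _ => ⟨JoinedIn.symm, JoinedIn.symm⟩
  rw [this]
  exact isOpen_biUnion fun y _ => hA.isOpen_compl.pathComponentIn y

lemma _root_.isClosed_union_above {w : ℝ × ℝ} {C : ℝ} {A : Set (ℝ × ℝ)} (hA : IsClosed A) :
    IsClosed (A ∪ above w C A) := by
  rw [← isOpen_compl_iff, isOpen_iff_mem_nhds]
  intro x hx
  simp only [mem_compl_iff, mem_union, not_or] at hx
  refine mem_of_superset ((hA.isOpen_compl.pathComponentIn x).mem_nhds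
    (mem_pathComponentIn_self hx.1)) fun y hy => ?_
  rintro (h | h)
  · exact (JoinedIn.target_mem hy) h
  · exact hx.2 (mem_above_of_joinedIn hy h)

lemma _root_.joinedIn_of_continuousOn {X : Type*} [TopologicalSpace X] {A : Set X} {g : ℝ → X}
    {a b : ℝ} (hg : ContinuousOn g (Icc a b)) (hA : ∀ t ∈ Icc a b, g t ∈ A) {s t : ℝ}
    (hs : s ∈ Icc a b) (ht : t ∈ Icc a b) : JoinedIn A (g s) (g t) := by
  have h1 : IsPathConnected (Icc a b) := (convex_Icc a b).isPathConnected ⟨s, hs⟩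
  exact ((h1.image' hg).joinedIn _ (mem_image_of_mem _ hs) _ (mem_image_of_mem _ ht)).mono
    (image_subset_iff.2 hA)

lemma _root_.exists_hit_of_above {w : ℝ × ℝ} {C : ℝ} {A : Set (ℝ × ℝ)} {g : ℝ → ℝ × ℝ}
    {a b : ℝ} (hg : ContinuousOn g (Icc a b)) {s t : ℝ} (hs : s ∈ Icc a b) (ht : t ∈ Icc a b)
    (h1 : g s ∈ above w C A) (h2 : g t ∉ above w C A) : ∃ t ∈ Icc a b, g t ∈ A := by
  by_contra! h
  exact h2 (mem_above_of_joinedIn (joinedIn_of_continuousOn hg h ht hs) h1)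

lemma _root_.mem_above {k : ℤ × ℤ} {α : ℝ → ℝ × ℝ} {C : ℝ}
    (hC : ∀ u, |zt (lat k) (α u)| ≤ C) {x : ℝ × ℝ} (hx : C < zt (lat k) x) :
    x ∈ above (lat k) C (range α) := by
  refine ⟨x, hx, JoinedIn.refl ?_⟩
  rintro ⟨u, rfl⟩
  linarith [le_abs_self (zt (lat k) (α u)), hC u]

lemma PerLine.notMem_above (h : M.PerLine k ℓ α) {C : ℝ} (hC : ∀ u, |zt (lat k) (α u)| ≤ C)
    {x : ℝ × ℝ} (hx : zt (lat k) x < -C) : x ∉ above (lat k) C (range α) := by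
  rintro ⟨y, hy, hj⟩
  obtain ⟨p, hp⟩ := hj
  obtain ⟨t, -, ht⟩ := h.crossing hC (g := p.extend) zero_le_one p.continuous_extend.continuousOn
    (by simpa using hx) (by simpa using hy)
  have : p.extend t ∈ range p := by
    rw [← p.extend_range]; exact mem_range_self t
  obtain ⟨s, hs⟩ := this
  exact hp s (hs ▸ ht)

/-- Replacing the part of an isometric segment between its first and last hit of `α`. -/
lemma IsLine.exists_replace (h : M.IsLine α) {H : Set (ℝ × ℝ)} (hA : range α ⊆ H)
    (hcr : ∀ (g : ℝ → ℝ × ℝ) (a b s t : ℝ), ContinuousOn g (Icc a b) → s ∈ Icc a b → t ∈ Icc a b →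
      g s ∈ H → g t ∉ H → ∃ t ∈ Icc a b, g t ∈ range α)
    {γ : ℝ → ℝ × ℝ} {D : ℝ} (hD : 0 ≤ D) (hγ : M.IsoOn γ 0 D) (h0 : γ 0 ∈ H) (h1 : γ D ∈ H) :
    ∃ γ' : ℝ → ℝ × ℝ, M.IsoOn γ' 0 D ∧ γ' 0 = γ 0 ∧ γ' D = γ D ∧
      ∀ t ∈ Icc 0 D, γ' t ∈ H ∧ (γ' t = γ t ∨ γ' t ∈ range α) := by
  by_cases hall : ∀ t ∈ Icc 0 D, γ t ∈ H
  · exact ⟨γ, hγ, rfl, rfl, fun t ht => ⟨hall t ht, Or.inl rfl⟩⟩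
  push Not at hall
  obtain ⟨t₀, ht₀, hn⟩ := hall
  have hc := hγ.lipOn.continuousOn
  let K := Icc 0 D ∩ γ ⁻¹' range α
  have hK : IsCompact K :=
    isCompact_Icc.of_isClosed_subset (hc.preimage_isClosed_of_isClosed isClosed_Icc
      h.isClosed_range) inter_subset_left
  have hKn : K.Nonempty := by
    obtain ⟨t, ht, htA⟩ := hcr γ 0 D 0 t₀ hc ⟨le_rfl, hD⟩ ht₀ h0 hn
    exact ⟨t, ht, htA⟩
  obtain ⟨t₁, ⟨ht₁, u₁, hu₁⟩, hmin⟩ := hK.exists_isLeast hKn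
  obtain ⟨t₂, ⟨ht₂, u₂, hu₂⟩, hmax⟩ := hK.exists_isGreatest hKn
  have h12 : t₁ ≤ t₂ := hmin ⟨ht₂, u₂, hu₂⟩
  have hdu : |u₁ - u₂| = t₂ - t₁ := by
    rw [← h u₁ u₂, hu₁, hu₂, hγ t₁ ht₁ t₂ ht₂, abs_sub_comm, abs_of_nonneg (by linarith)]
  obtain ⟨σ, hσ, hσu⟩ : ∃ σ : ℝ, |σ| = 1 ∧ u₂ = u₁ + σ * (t₂ - t₁) := by
    rcases le_total u₁ u₂ with h' | h'
    · refine ⟨1, by simp, ?_⟩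
      rw [abs_of_nonpos (by linarith)] at hdu; linarith
    · refine ⟨-1, by simp, ?_⟩
      rw [abs_of_nonneg (by linarith)] at hdu; linarith
  let β : ℝ → ℝ × ℝ := fun t => α (u₁ + σ * (t - t₁))
  have hβ1 : γ t₁ = β t₁ := by simp [β, hu₁]
  have hβ2 : β t₂ = γ t₂ := by rw [← hu₂, hσu]
  have hβL : M.LipOn β t₁ t₂ := fun s _ t _ => by
    simp only [β]
    rw [h, show u₁ + σ * (s - t₁) - (u₁ + σ * (t - t₁)) = σ * (s - t) by ring, abs_mul, hσ, one_mul]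
  have hβA : ∀ t, β t ∈ range α := fun t => mem_range_self _
  have hj1 : join γ β t₁ t₂ = γ t₂ := by rw [join_right hβ1 h12, hβ2]
  have hv : ∀ t ∈ Icc 0 D, (join (join γ β t₁) γ t₂ t = γ t ∧ ∃ a b, t ∈ Icc a b ∧ 0 ≤ a ∧ b ≤ D ∧
      (∃ e ∈ Icc a b, γ e ∈ H) ∧ ∀ s ∈ Icc a b, γ s ∈ range α → s = t) ∨
      join (join γ β t₁) γ t₂ t ∈ range α := by
    intro t ht
    rcases le_total t t₁ with ha | ha
    · left
      rw [join_left (ha.trans h12), join_left ha]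
      refine ⟨rfl, 0, t, ⟨ht.1, le_rfl⟩, le_rfl, ht.2, ⟨0, ⟨le_rfl, ht.1⟩, h0⟩, fun s hs hsA => ?_⟩
      exact le_antisymm hs.2 (ha.trans (hmin ⟨⟨hs.1, hs.2.trans ht.2⟩, hsA⟩))
    rcases le_total t t₂ with hb | hb
    · right
      rw [join_left hb, join_right hβ1 ha]
      exact hβA t
    · left
      rw [join_right hj1 hb]
      refine ⟨rfl, t, D, ⟨le_rfl, ht.2⟩, ht.1, le_rfl, ⟨D, ⟨ht.2, le_rfl⟩, h1⟩, fun s hs hsA => ?_⟩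
      exact le_antisymm ((hmax ⟨⟨ht.1.trans hs.1, hs.2⟩, hsA⟩).trans hb) hs.1
  have e0 : join (join γ β t₁) γ t₂ 0 = γ 0 := by
    rw [join_left ht₂.1, join_left ht₁.1]
  have e1 : join (join γ β t₁) γ t₂ D = γ D := join_right hj1 ht₂.2
  refine ⟨join (join γ β t₁) γ t₂, LipOn.isoOn (((hγ.lipOn.mono le_rfl ht₁.2).join hβL hβ1).join
    (hγ.lipOn.mono ht₂.1 le_rfl) hj1) ?_, e0, e1, fun t ht => ?_⟩
  · rw [e0, e1, hγ 0 ⟨le_rfl, hD⟩ D ⟨hD, le_rfl⟩, abs_sub_comm]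
    exact le_abs_self _
  · rcases hv t ht with ⟨he, a, b, htab, ha, hb, ⟨e, hem, heH⟩, hs⟩ | h'
    · refine ⟨?_, Or.inl he⟩
      rw [he]
      by_contra hn'
      obtain ⟨s, hsm, hsA⟩ := hcr γ a b e t (hc.mono (Icc_subset_Icc ha hb)) hem htab heH hn'
      rw [hs s hsm hsA] at hsA
      exact hn' (hA hsA)
    · exact ⟨hA h', Or.inr h'⟩

end Sides

end TorusMetric

/-- The closed strip between `A` and its translate `A + s`. -/
def strip (w : ℝ × ℝ) (C : ℝ) (A : Set (ℝ × ℝ)) (s : ℝ × ℝ) : Set (ℝ × ℝ) :=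
  (A ∪ above w C A) ∩ {x | x - s ∉ above w C A}

lemma isClosed_strip {w s : ℝ × ℝ} {C : ℝ} {A : Set (ℝ × ℝ)} (hA : IsClosed A) :
    IsClosed (strip w C A s) :=
  (isClosed_union_above hA).inter
    ((isOpen_above hA).isClosed_compl.preimage (continuous_id.sub continuous_const))

namespace TorusMetric

variable {M : TorusMetric} {k : ℤ × ℤ} {ℓ C : ℝ} {α : ℝ → ℝ × ℝ}

lemma PerLine.add_lat_mem_above (h : M.PerLine k ℓ α) {x : ℝ × ℝ}
    (hx : x ∈ above (lat k) C (range α)) : x + lat k ∈ above (lat k) C (range α) := by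
  obtain ⟨y, hy, p, hp⟩ := hx
  refine ⟨y + lat k, by rwa [zt_add, zt_self, add_zero], ?_⟩
  refine ⟨p.map (continuous_id.add continuous_const : Continuous fun z => z + lat k), ?_⟩
  rintro t ⟨u, hu⟩
  refine hp t ⟨u - ℓ, ?_⟩
  have := h.per (u - ℓ)
  rw [sub_add_cancel] at this
  simpa [this] using hu

lemma PerLine.sub_lat_mem_above (h : M.PerLine k ℓ α) {x : ℝ × ℝ}
    (hx : x ∈ above (lat k) C (range α)) : x - lat k ∈ above (lat k) C (range α) := by
  obtain ⟨y, hy, p, hp⟩ := hx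
  refine ⟨y - lat k, by rwa [zt_sub, zt_self, sub_zero], ?_⟩
  refine ⟨p.map (continuous_id.sub continuous_const : Continuous fun z => z - lat k), ?_⟩
  rintro t ⟨u, hu⟩
  refine hp t ⟨u + ℓ, ?_⟩
  rw [h.per, hu]
  simp

lemma PerLine.add_zsmul_mem_strip (h : M.PerLine k ℓ α) {x s : ℝ × ℝ}
    (hx : x ∈ strip (lat k) C (range α) s) (j : ℤ) :
    x + (j : ℝ) • lat k ∈ strip (lat k) C (range α) s := by
  have hp : ∀ x ∈ strip (lat k) C (range α) s, x + lat k ∈ strip (lat k) C (range α) s := by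
    rintro x ⟨h1 | h1, h2⟩
    · obtain ⟨u, rfl⟩ := h1
      refine ⟨Or.inl ⟨u + ℓ, h.per u⟩, fun h3 => h2 ?_⟩
      have := h.sub_lat_mem_above h3
      rwa [show α u + lat k - s - lat k = α u - s by abel] at this
    · refine ⟨Or.inr (h.add_lat_mem_above h1), fun h3 => h2 ?_⟩
      have := h.sub_lat_mem_above h3
      rwa [show x + lat k - s - lat k = x - s by abel] at this
  have hm : ∀ x ∈ strip (lat k) C (range α) s, x - lat k ∈ strip (lat k) C (range α) s := by
    rintro x ⟨h1 | h1, h2⟩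
    · obtain ⟨u, rfl⟩ := h1
      refine ⟨Or.inl ⟨u - ℓ, ?_⟩, fun h3 => h2 ?_⟩
      · have := h.per (u - ℓ)
        rw [sub_add_cancel] at this
        rw [this, add_sub_cancel_right]
      have := h.add_lat_mem_above h3
      rwa [show α u - lat k - s + lat k = α u - s by abel] at this
    · refine ⟨Or.inr (h.sub_lat_mem_above h1), fun h3 => h2 ?_⟩
      have := h.add_lat_mem_above h3
      rwa [show x - lat k - s + lat k = x - s by abel] at this
  induction j using Int.induction_on with
  | zero => simpa using hx
  | succ i ih =>
    have := hp _ ih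
    push_cast at this ⊢
    rwa [add_smul, one_smul, ← add_assoc]
  | pred i ih =>
    have := hm _ ih
    push_cast at this ⊢
    rwa [sub_smul, one_smul, ← add_sub_assoc]

lemma PerLine.neg_le_zt_of_mem_strip (h : M.PerLine k ℓ α) (hC : ∀ u, |zt (lat k) (α u)| ≤ C)
    {x s : ℝ × ℝ} (hx : x ∈ strip (lat k) C (range α) s) : -C ≤ zt (lat k) x := by
  rcases hx.1 with ⟨u, rfl⟩ | h1
  · exact (abs_le.1 (hC u)).1
  · by_contra! h2
    exact h.notMem_above hC h2 h1

lemma zt_le_of_mem_strip (hC : ∀ u, |zt (lat k) (α u)| ≤ C)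
    {x s : ℝ × ℝ} (hx : x ∈ strip (lat k) C (range α) s) :
    zt (lat k) x ≤ C + zt (lat k) s := by
  by_contra! h2
  exact hx.2 (mem_above hC (by rw [zt_sub]; linarith))

lemma PerLine.mem_strip (h : M.PerLine k ℓ α) (hC : ∀ u, |zt (lat k) (α u)| ≤ C)
    {s : ℝ × ℝ} (hs : 2 * C < zt (lat k) s) (u : ℝ) :
    α u ∈ strip (lat k) C (range α) s :=
  ⟨Or.inl ⟨u, rfl⟩, h.notMem_above hC (by rw [zt_sub]; linarith [(abs_le.1 (hC u)).2])⟩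

lemma add_mem_strip (hC : ∀ u, |zt (lat k) (α u)| ≤ C)
    {s : ℝ × ℝ} (hs : 2 * C < zt (lat k) s) (u : ℝ) :
    α u + s ∈ strip (lat k) C (range α) s := by
  refine ⟨Or.inr (mem_above hC (by rw [zt_add]; linarith [(abs_le.1 (hC u)).1])), ?_⟩
  simp only [mem_ofPred_eq, add_sub_cancel_right]
  exact fun h2 => above_subset h2 ⟨u, rfl⟩

lemma PerLine.exists_segment_strip (h : M.PerLine k ℓ α) (hC : ∀ u, |zt (lat k) (α u)| ≤ C)
    {s : ℤ × ℤ} (hs : 2 * C < zt (lat k) (lat s)) {x y : ℝ × ℝ}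
    (hx : x ∈ strip (lat k) C (range α) (lat s)) (hy : y ∈ strip (lat k) C (range α) (lat s)) :
    ∃ γ : ℝ → ℝ × ℝ, M.IsoOn γ 0 (M.dist x y) ∧ γ 0 = x ∧ γ (M.dist x y) = y ∧
      ∀ t ∈ Icc 0 (M.dist x y), γ t ∈ strip (lat k) C (range α) (lat s) := by
  have hD := M.dist_nonneg x y
  obtain ⟨γ₀, h0, h1, h2⟩ := M.exists_segment x y
  obtain ⟨γ₁, i1, i0, iD, hi⟩ := h.line.exists_replace (H := range α ∪ above (lat k) C (range α))
    subset_union_left (by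
      intro g a b s t hg hs ht h3 h4
      simp only [mem_union, not_or] at h4
      rcases h3 with h3 | h3
      · exact ⟨s, hs, h3⟩
      · exact exists_hit_of_above hg hs ht h3 h4.2) hD h2 (by rw [h0]; exact hx.1)
        (by rw [h1]; exact hy.1)
  obtain ⟨γ₂, j1, j0, jD, hj⟩ := (h.line.add_lat s).exists_replace
    (H := {x | x - lat s ∉ above (lat k) C (range α)})
    (by
      rintro _ ⟨u, rfl⟩
      exact (add_mem_strip hC hs u).2) (by
      intro g a b u t hg hu ht h3 h4
      simp only [mem_ofPred_eq, not_not] at h3 h4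
      obtain ⟨v, hv, u', hu'⟩ := exists_hit_of_above (g := fun t => g t - lat s)
        (hg.sub continuousOn_const) ht hu h4 h3
      exact ⟨v, hv, u', by simp [hu']⟩) hD i1 (by rw [i0, h0]; exact hx.2)
        (by rw [iD, h1]; exact hy.2)
  refine ⟨γ₂, j1, j0.trans (i0.trans h0), jD.trans (iD.trans h1), fun t ht => ⟨?_, (hj t ht).1⟩⟩
  rcases (hj t ht).2 with h3 | ⟨u, hu⟩
  · rw [h3]; exact (hi t ht).1
  · rw [← hu]; exact (add_mem_strip hC hs u).1

lemma exists_hit_of_strip {s : ℝ × ℝ} {g : ℝ → ℝ × ℝ} {a b : ℝ} (hab : a ≤ b)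
    (hg : ContinuousOn g (Icc a b)) (h1 : g a ∈ strip (lat k) C (range α) s)
    (h2 : g b - s ∈ strip (lat k) C (range α) s) : ∃ t ∈ Icc a b, ∃ u, g t = α u + s := by
  rcases h2.1 with ⟨u, hu⟩ | h3
  · exact ⟨b, right_mem_Icc.2 hab, u, by rw [hu]; abel⟩
  · obtain ⟨t, ht, u, hu⟩ := exists_hit_of_above (g := fun t => g t - s)
      (hg.sub continuousOn_const) (right_mem_Icc.2 hab) (left_mem_Icc.2 hab) h3 h1.2
    exact ⟨t, ht, u, by rw [hu]; abel⟩

end TorusMetric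

lemma Ultrafilter.exists_tendsto_of_bounded {ι E : Type*} [NormedAddCommGroup E] [ProperSpace E]
    (g : Ultrafilter ι) {u : ι → E} {C : ℝ} (h : ∀ᶠ n in g, ‖u n‖ ≤ C) :
    ∃ x, Tendsto u g (𝓝 x) := by
  obtain ⟨x, -, hx⟩ := (isCompact_closedBall (0 : E) C).ultrafilter_le_nhds
    (g.map u) (by
      rw [le_principal_iff, Ultrafilter.coe_map, Filter.mem_map]
      filter_upwards [h] with n hn
      simpa using hn)
  exact ⟨x, hx⟩

namespace TorusMetric

variable {M : TorusMetric}

section Calibrated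

/-- `γ` is a curve of unit speed along which the function `f` grows at unit rate. -/
def Calib (M : TorusMetric) (f : ℝ × ℝ → ℝ) (γ : ℝ → ℝ × ℝ) : Prop :=
  (∀ s t, M.dist (γ s) (γ t) ≤ |s - t|) ∧ ∀ s, f (γ s) = f (γ 0) + s

variable {f : ℝ × ℝ → ℝ}

lemma Calib.isLine {γ : ℝ → ℝ × ℝ} (h : M.Calib f γ) (hf : ∀ x y, f y - f x ≤ M.dist x y) :
    M.IsLine γ := by
  refine fun s t => le_antisymm (h.1 s t) (abs_le'.2 ⟨?_, ?_⟩)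
  · have := hf (γ t) (γ s)
    rw [h.2 s, h.2 t, M.dist_comm] at this
    linarith
  · have := hf (γ s) (γ t)
    rw [h.2 s, h.2 t] at this
    linarith

lemma Calib.comp_add {γ : ℝ → ℝ × ℝ} (h : M.Calib f γ) (a : ℝ) :
    M.Calib f fun t => γ (t + a) := by
  refine ⟨fun s t => (h.1 _ _).trans (by rw [add_sub_add_right_eq_sub]), fun s => ?_⟩
  rw [h.2 (s + a), h.2 (0 + a)]
  ring

lemma Calib.deriv_eq {γ η : ℝ → ℝ × ℝ} (h : M.Calib f γ) (h' : M.Calib f η)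
    (hf : ∀ x y, f y - f x ≤ M.dist x y) (h0 : γ 0 = η 0) : deriv γ 0 = deriv η 0 := by
  have hj : M.IsoOn (join γ η 0) (-1 / 2) (1 / 2) := by
    refine LipOn.isoOn (LipOn.join (fun s _ t _ => h.1 s t) (fun s _ t _ => h'.1 s t) h0) ?_
    rw [join_left (by norm_num), join_right h0 (by norm_num)]
    have := hf (γ (-1 / 2)) (η (1 / 2))
    rw [h.2, h'.2, h0] at this
    linarith
  have hd := (hj.exists_deriv (t := 0) (by norm_num) (by norm_num)).1
  have e1 : deriv (join γ η 0) 0 = deriv γ 0 := by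
    have h1 := (h.isLine hf).locIso.hasDerivAt 0
    refine (uniqueDiffWithinAt_Iic (0 : ℝ)).eq_deriv _ hd.hasDerivWithinAt
      (h1.hasDerivWithinAt.congr (fun t ht => join_left ht) (join_left le_rfl))
  have e2 : deriv (join γ η 0) 0 = deriv η 0 := by
    have h1 := (h'.isLine hf).locIso.hasDerivAt 0
    refine (uniqueDiffWithinAt_Ici (0 : ℝ)).eq_deriv _ hd.hasDerivWithinAt
      (h1.hasDerivWithinAt.congr (fun t ht => join_right h0 ht) (join_right h0 le_rfl))
  rw [← e1, e2]

lemma IsLine.norm_sub_le {γ : ℝ → ℝ × ℝ} (h : M.IsLine γ) (s t : ℝ) :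
    ‖γ s - γ t‖ ≤ |s - t| / M.lo := norm_sub_le_of_dist (h s t).le

lemma continuous_of_calib (hf : ∀ x y, f y - f x ≤ M.dist x y) : Continuous f := by
  have : LipschitzWith (Real.toNNReal M.hi) f := by
    refine LipschitzWith.of_dist_le_mul fun x y => ?_
    rw [Real.dist_eq, dist_eq_norm, Real.coe_toNNReal _ M.hi_pos.le]
    refine (abs_le'.2 ⟨?_, ?_⟩ : |f x - f y| ≤ M.dist x y).trans (M.dist_le_hi _ _)
    · rw [M.dist_comm]; exact hf y x
    · linarith [hf x y]
  exact this.continuous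

/-- Limits of calibrated curves are calibrated, and their velocities converge. -/
lemma exists_calib_limit {ι : Type*} (g : Ultrafilter ι) {γ : ι → ℝ → ℝ × ℝ} {x : ℝ × ℝ}
    (hf : ∀ x y, f y - f x ≤ M.dist x y) (hγ : ∀ᶠ i in g, M.Calib f (γ i))
    (hx : Tendsto (fun i => γ i 0) g (𝓝 x)) :
    ∃ γ', M.Calib f γ' ∧ γ' 0 = x ∧ Tendsto (fun i => deriv (γ i) 0) g (𝓝 (deriv γ' 0)) := by
  have hb : ∀ᶠ i in g, ‖γ i 0‖ ≤ ‖x‖ + 1 := by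
    filter_upwards [hx.norm.eventually (gt_mem_nhds (lt_add_one ‖x‖))] with i hi using hi.le
  have hlim : ∀ t, ∃ y, Tendsto (fun i => γ i t) g (𝓝 y) := fun t => by
    refine g.exists_tendsto_of_bounded (C := ‖x‖ + 1 + |t| / M.lo) ?_
    filter_upwards [hγ, hb] with i hi hb
    have h1 := (hi.isLine hf).norm_sub_le t 0
    rw [sub_zero] at h1
    calc _ = ‖γ i 0 + (γ i t - γ i 0)‖ := by congr 1; abel
      _ ≤ _ := norm_add_le _ _
      _ ≤ _ := add_le_add hb h1
  choose γ' hγ' using hlim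
  have h0 : γ' 0 = x := tendsto_nhds_unique (hγ' 0) hx
  have hcal : M.Calib f γ' := by
    refine ⟨fun s t => le_of_tendsto (M.tendsto_dist (hγ' s) (hγ' t)) ?_, fun s => ?_⟩
    · filter_upwards [hγ] with i hi using hi.1 s t
    · have hc := continuous_of_calib hf
      have h1 := (hc.tendsto _).comp (hγ' s)
      have h2 := ((hc.tendsto _).comp (hγ' 0)).add_const s
      refine tendsto_nhds_unique h1 (h2.congr' ?_)
      filter_upwards [hγ] with i hi using (hi.2 s).symm
  refine ⟨γ', hcal, h0, ?_⟩
  obtain ⟨Y, hY⟩ : ∃ Y, Tendsto (fun i => deriv (γ i) 0) g (𝓝 Y) := by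
    refine g.exists_tendsto_of_bounded (C := 1 / M.lo) ?_
    filter_upwards [hγ] with i hi
    rw [le_div_iff₀ M.lo_pos, mul_comm, ← (hi.isLine hf).locIso.nrm_deriv 0]
    exact M.lo_le _ _
  have hest : ∀ η, M.Calib f η → ∀ s ∈ Icc (-1 / 2 : ℝ) (1 / 2),
      ‖η s - η 0 - s • deriv η 0‖ ≤ 8 * M.ac * (|s| * √|s|) := fun η hη s hs => by
    have := (((hη.isLine hf).isoOn (-1 / 2) (1 / 2)).exists_deriv (t := 0) (by norm_num)
      (by norm_num)).2.2 s hs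
    simpa using this
  have hest' : ∀ s ∈ Icc (-1 / 2 : ℝ) (1 / 2),
      ‖γ' s - γ' 0 - s • Y‖ ≤ 8 * M.ac * (|s| * √|s|) := fun s hs => by
    refine le_of_tendsto (((hγ' s).sub (hγ' 0)).sub (hY.const_smul s)).norm ?_
    filter_upwards [hγ] with i hi using hest _ hi s hs
  have hd : HasDerivAt γ' Y 0 := by
    rw [hasDerivAt_iff_isLittleO]
    refine (Asymptotics.IsBigO.trans_isLittleO (g := fun s : ℝ => |s| * √|s|)
      (Asymptotics.IsBigO.of_bound (8 * M.ac) ?_) ?_)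
    · filter_upwards [Icc_mem_nhds (show (-1 / 2 : ℝ) < 0 by norm_num)
        (show (0 : ℝ) < 1 / 2 by norm_num)] with s hs
      simpa [abs_of_nonneg (Real.sqrt_nonneg |s|)] using hest' s hs
    · have h1 : Tendsto (fun s : ℝ => √|s|) (𝓝 0) (𝓝 0) := by
        have : Continuous fun s : ℝ => √|s| := by fun_prop
        simpa using this.tendsto 0
      have h2 : (fun s : ℝ => |s|) =O[𝓝 0] fun s : ℝ => s - 0 :=
        Asymptotics.IsBigO.of_bound 1 (by simp)
      simpa using h2.mul_isLittleO ((Asymptotics.isLittleO_one_iff ℝ).2 h1)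
  rwa [hd.deriv]

lemma exists_continuousOn_dir {S : Set (ℝ × ℝ)} (hf : ∀ x y, f y - f x ≤ M.dist x y)
    (hS : ∀ x ∈ S, ∃ γ, M.Calib f γ ∧ γ 0 = x) :
    ∃ X : ℝ × ℝ → ℝ × ℝ, ContinuousOn X S ∧
      ∀ γ, M.Calib f γ → γ 0 ∈ S → deriv γ 0 = X (γ 0) := by
  choose! L hL hL0 using hS
  have hX : ∀ γ, M.Calib f γ → γ 0 ∈ S → deriv γ 0 = deriv (L (γ 0)) 0 := fun γ hγ h0 =>
    hγ.deriv_eq (hL _ h0) hf (hL0 _ h0).symm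
  refine ⟨fun x => deriv (L x) 0, fun x hx => ?_, hX⟩
  rw [ContinuousWithinAt, tendsto_iff_ultrafilter]
  intro g hg
  have hgS : ∀ᶠ y in g, y ∈ S := hg self_mem_nhdsWithin
  have hgx : Tendsto (fun y => y) (g : Filter (ℝ × ℝ)) (𝓝 x) := hg.trans nhdsWithin_le_nhds
  obtain ⟨γ, h1, h2, h3⟩ := exists_calib_limit g (γ := L) (x := x) hf
    (hgS.mono hL) (hgx.congr' (hgS.mono fun y hy => (hL0 y hy).symm))
  rwa [hX γ h1 (by rwa [h2]), h2] at h3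

end Calibrated

section Busemann

variable {α β : ℝ → ℝ × ℝ}

/-- The Busemann function of the backward ray of `α`. -/
def bu (M : TorusMetric) (α : ℝ → ℝ × ℝ) (x : ℝ × ℝ) : ℝ :=
  ⨅ n : ℕ, (M.dist (α (-n)) x - n)

lemma bu_bdd (h : M.IsLine α) (x : ℝ × ℝ) :
    BddBelow (range fun n : ℕ => M.dist (α (-n)) x - n) := by
  refine ⟨-M.dist x (α 0), ?_⟩
  rintro _ ⟨n, rfl⟩
  have := M.dist_triangle (α (-n)) x (α 0)
  have h1 := h (-n) 0
  rw [sub_zero, abs_neg, Nat.abs_cast] at h1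
  linarith

lemma bu_antitone (h : M.IsLine α) (x : ℝ × ℝ) : Antitone fun n : ℕ => M.dist (α (-n)) x - n := by
  intro m n hmn
  have h0 : (m : ℝ) ≤ n := by exact_mod_cast hmn
  have := M.dist_triangle (α (-n)) (α (-m)) x
  have h1 := h (-n) (-m)
  rw [abs_sub_comm, abs_of_nonneg (by linarith)] at h1
  simp only
  linarith

lemma bu_tendsto (h : M.IsLine α) (x : ℝ × ℝ) :
    Tendsto (fun n : ℕ => M.dist (α (-n)) x - n) atTop (𝓝 (M.bu α x)) :=
  tendsto_atTop_ciInf (bu_antitone h x) (bu_bdd h x)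

lemma bu_le (h : M.IsLine α) (u : ℝ) (x : ℝ × ℝ) : M.bu α x ≤ u + M.dist (α u) x := by
  obtain ⟨n, hn⟩ := exists_nat_ge |u|
  refine (ciInf_le (bu_bdd h x) n).trans ?_
  have := M.dist_triangle (α (-n)) (α u) x
  have h1 := h (-n) u
  rw [abs_sub_comm, abs_of_nonneg (by linarith [neg_abs_le u])] at h1
  linarith

lemma bu_sub_le (h : M.IsLine α) (x y : ℝ × ℝ) : M.bu α y - M.bu α x ≤ M.dist x y := by
  rw [sub_le_iff_le_add']
  refine le_of_tendsto_of_tendsto' (bu_tendsto h y) ((bu_tendsto h x).add_const (M.dist x y))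
    fun n => ?_
  linarith [M.dist_triangle (α (-n)) x y]

lemma PerLine.bu_add {k : ℤ × ℤ} {ℓ : ℝ} (h : M.PerLine k ℓ α) (x : ℝ × ℝ) :
    M.bu α (x + lat k) = M.bu α x + ℓ := by
  have hper : ∀ u, α (u - ℓ) + lat k = α u := fun u => by rw [← h.per, sub_add_cancel]
  apply le_antisymm
  · refine ge_of_tendsto' ((bu_tendsto h.line x).add_const ℓ) fun n => ?_
    refine (bu_le h.line (-n + ℓ) _).trans (le_of_eq ?_)
    rw [h.per, M.dist_add_lat]
    ring
  · rw [← le_sub_iff_add_le]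
    refine ge_of_tendsto' ((bu_tendsto h.line (x + lat k)).sub_const ℓ) fun n => ?_
    refine (bu_le h.line (-n - ℓ) _).trans (le_of_eq ?_)
    rw [← M.dist_add_lat k (α _) x, hper]
    ring

/-- A line with the same period as `α` is calibrated by the Busemann function of `α`. -/
lemma PerLine.calib {k : ℤ × ℤ} {ℓ : ℝ} (h : M.PerLine k ℓ α) (hβ : M.PerLine k ℓ β) :
    M.Calib (M.bu α) β := by
  refine ⟨fun s t => (hβ.line s t).le, ?_⟩
  have hanti : Antitone fun u => M.bu α (β u) - u := fun u v huv => by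
    have h1 := bu_sub_le h.line (β u) (β v)
    rw [hβ.line, abs_sub_comm, abs_of_nonneg (by linarith)] at h1
    simp only
    linarith
  have hper : Function.Periodic (fun u => M.bu α (β u) - u) ℓ := fun u => by
    simp only [hβ.per, h.bu_add]
    ring
  have key : ∀ u v, M.bu α (β u) - u ≤ M.bu α (β v) - v := fun u v => by
    obtain ⟨n, hn⟩ := exists_nat_ge ((v - u) / ℓ)
    have h1 : v ≤ u + n * ℓ := by
      rw [div_le_iff₀ h.pos] at hn
      linarith
    have h2 := hanti h1
    have h3 := hper.nat_mul n u
    simp only at h2 h3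
    linarith
  intro s
  linarith [key s 0, key 0 s]

/-- The Busemann function of the forward ray of `β`. -/
def au (M : TorusMetric) (β : ℝ → ℝ × ℝ) (x : ℝ × ℝ) : ℝ := M.bu (fun t => β (-t)) x

lemma IsLine.neg (h : M.IsLine β) : M.IsLine fun t => β (-t) := fun s t => by
  rw [h, ← abs_neg]; congr 1; ring

lemma au_tendsto (h : M.IsLine β) (x : ℝ × ℝ) :
    Tendsto (fun n : ℕ => M.dist x (β n) - n) atTop (𝓝 (M.au β x)) := by
  refine (bu_tendsto h.neg x).congr fun n => ?_
  rw [neg_neg, M.dist_comm]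

lemma au_le (h : M.IsLine β) (u : ℝ) (x : ℝ × ℝ) : M.au β x ≤ M.dist x (β u) - u := by
  refine (bu_le h.neg (-u) x).trans (le_of_eq ?_)
  rw [neg_neg, M.dist_comm]
  ring

/-- The asymptotic minimal cost of a connection from `α` to `β`. -/
def mm (M : TorusMetric) (α β : ℝ → ℝ × ℝ) : ℝ := ⨅ n : ℕ, (M.dist (α (-n)) (β n) - 2 * n)

section Cost

lemma exists_lt_mm {δ : ℝ} (hδ : 0 < δ) : ∃ n : ℕ, M.dist (α (-n)) (β n) - 2 * n < M.mm α β + δ :=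
  exists_lt_of_ciInf_lt (lt_add_of_pos_right _ hδ)

lemma mm_bdd (hα : M.IsLine α) {K : ℝ} (hK : ∀ u, M.dist (α u) (β u) ≤ K) :
    BddBelow (range fun n : ℕ => M.dist (α (-n)) (β n) - 2 * n) := by
  refine ⟨-K, ?_⟩
  rintro _ ⟨n, rfl⟩
  have := M.dist_triangle (α (-n)) (β n) (α n)
  have h0 := hK n
  rw [M.dist_comm] at h0
  have h1 := hα (-n) n
  rw [abs_sub_comm, abs_of_nonneg (by linarith [Nat.cast_nonneg (α := ℝ) n])] at h1
  linarith

lemma mm_le_dist (hα : M.IsLine α) (hβ : M.IsLine β) {K : ℝ}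
    (hK : ∀ u, M.dist (α u) (β u) ≤ K) (u v : ℝ) : M.mm α β ≤ M.dist (α u) (β v) - (v - u) := by
  obtain ⟨n, hn⟩ := exists_nat_ge (max |u| |v|)
  refine (ciInf_le (mm_bdd hα hK) n).trans ?_
  have h1 := M.dist_triangle (α (-n)) (α u) (β n)
  have h2 := M.dist_triangle (α u) (β v) (β n)
  have h3 := hα (-n) u
  have h4 := hβ v n
  have h5 := neg_abs_le u
  have h6 := le_abs_self v
  have h7 := (le_max_left |u| |v|).trans hn
  have h8 := (le_max_right |u| |v|).trans hn
  rw [abs_sub_comm, abs_of_nonneg (by linarith)] at h3 h4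
  linarith

/-- Through a point at which the minimal cost is attained there passes a calibrated line. -/
lemma exists_leaf (hα : M.IsLine α) (hβ : M.IsLine β) {K : ℝ}
    (hK : ∀ u, M.dist (α u) (β u) ≤ K) {x : ℝ × ℝ} (hx : M.bu α x + M.au β x ≤ M.mm α β) :
    ∃ γ, M.Calib (M.bu α) γ ∧ γ 0 = x := by
  have hseg : ∀ n : ℕ, ∃ γ : ℝ → ℝ × ℝ, M.LipOn γ (-M.dist (α (-n)) x) (M.dist x (β n)) ∧
      γ 0 = x ∧ γ (-M.dist (α (-n)) x) = α (-n) ∧ γ (M.dist x (β n)) = β n := fun n => by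
    obtain ⟨y, y0, y1, hy⟩ := M.exists_segment (α (-n)) x
    obtain ⟨z, z0, z1, hz⟩ := M.exists_segment x (β n)
    have hA := M.dist_nonneg (α (-n)) x
    have hB := M.dist_nonneg x (β n)
    have hy' : M.LipOn (fun t => y (t + M.dist (α (-n)) x)) (-M.dist (α (-n)) x) 0 := by
      have := (IsoOn.lipOn hy).comp_add (M.dist (α (-n)) x)
      simpa using this
    have hc : (fun t => y (t + M.dist (α (-n)) x)) 0 = z 0 := by simp [y1, z0]
    refine ⟨join (fun t => y (t + M.dist (α (-n)) x)) z 0, hy'.join (IsoOn.lipOn hz) hc, ?_, ?_, ?_⟩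
    · rw [join_right hc le_rfl, z0]
    · rw [join_left (by linarith)]; simp [y0]
    · rw [join_right hc hB, z1]
  choose γ hL h0 hA hB using hseg
  have tA := tendsto_atTop_mono' atTop (f₂ := fun n : ℕ => M.dist (α (-n)) x)
    (f₁ := fun n : ℕ => M.bu α x + n)
    (Eventually.of_forall fun n => by
      have := ciInf_le (bu_bdd hα x) n
      simp only at this ⊢
      unfold bu
      linarith)
    (tendsto_atTop_add_const_left _ _ tendsto_natCast_atTop_atTop)
  have tB := tendsto_atTop_mono' atTop (f₂ := fun n : ℕ => M.dist x (β n))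
    (f₁ := fun n : ℕ => M.au β x + n)
    (Eventually.of_forall fun n => by
      have := au_le hβ n x
      simp only at this ⊢
      linarith)
    (tendsto_atTop_add_const_left _ _ tendsto_natCast_atTop_atTop)
  have hin : ∀ t, ∀ᶠ n : ℕ in ulf, t ∈ Icc (-M.dist (α (-n)) x) (M.dist x (β n)) := fun t => by
    filter_upwards [ulf_le_atTop (tA.eventually_ge_atTop (-t)),
      ulf_le_atTop (tB.eventually_ge_atTop t)] with n h1 h2
    exact ⟨by linarith, h2⟩
  have hlim : ∀ t, ∃ y, Tendsto (fun n => γ n t) ulf (𝓝 y) := fun t => by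
    refine exists_ulim (C := ‖x‖ + |t| / M.lo) ?_
    filter_upwards [hin t, hin 0] with n h1 h2
    have h3 := norm_sub_le_of_dist (hL n t h1 0 h2)
    rw [sub_zero, h0] at h3
    calc _ = ‖x + (γ n t - x)‖ := by congr 1; abel
      _ ≤ _ := norm_add_le _ _
      _ ≤ _ := add_le_add le_rfl h3
  choose γ' hγ' using hlim
  have h0' : γ' 0 = x := tendsto_nhds_unique (hγ' 0) (by simp only [h0]; exact tendsto_const_nhds)
  have hlip : ∀ s t, M.dist (γ' s) (γ' t) ≤ |s - t| := fun s t => by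
    refine le_of_tendsto (M.tendsto_dist (hγ' s) (hγ' t)) ?_
    filter_upwards [hin s, hin t] with n h1 h2 using hL n s h1 t h2
  have hbu : ∀ t, Tendsto (fun n : ℕ => M.dist (α (-n)) (γ n t) - n) ulf (𝓝 (M.bu α (γ' t))) := by
    intro t
    have h1 := (bu_tendsto hα (γ' t)).mono_left ulf_le_atTop
    have h2 : Tendsto (fun n => M.dist (γ n t) (γ' t)) ulf (𝓝 0) := by
      have := M.tendsto_dist (hγ' t) (tendsto_const_nhds (x := γ' t))
      rwa [M.dist_self] at this
    refine tendsto_of_tendsto_of_tendsto_of_le_of_le (by simpa using h1.sub h2)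
      (by simpa using h1.add h2) (fun n => ?_) fun n => ?_
    · simp only
      linarith [M.dist_triangle (α (-n)) (γ n t) (γ' t)]
    · have := M.dist_triangle (α (-n)) (γ' t) (γ n t)
      rw [M.dist_comm (γ' t)] at this
      simp only
      linarith
  refine ⟨γ', ⟨hlip, fun t => ?_⟩, h0'⟩
  rw [h0']
  apply le_antisymm
  · rcases le_total 0 t with ht | ht
    · have h1 := bu_sub_le hα x (γ' t)
      have h2 := hlip 0 t
      rw [h0', zero_sub, abs_neg, abs_of_nonneg ht] at h2
      linarith
    · refine le_of_tendsto_of_tendsto (hbu t)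
        (((bu_tendsto hα x).mono_left ulf_le_atTop).add_const t) ?_
      filter_upwards [hin t] with n hn
      have h1 := (hL n).le le_rfl hn.1 hn.2
      rw [hA] at h1
      linarith
  · rcases le_total 0 t with ht | ht
    · have key : M.mm α β + t ≤ M.bu α (γ' t) + M.au β x := by
        refine ge_of_tendsto ((hbu t).add ((au_tendsto hβ x).mono_left ulf_le_atTop)) ?_
        filter_upwards [hin t] with n hn
        have h1 := (hL n).le hn.1 hn.2 le_rfl
        rw [hB] at h1
        have h2 := mm_le_dist hα hβ hK (-n) n
        linarith [M.dist_triangle (α (-n)) (γ n t) (β n)]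
      linarith
    · have h1 := bu_sub_le hα (γ' t) x
      have h2 := hlip t 0
      rw [h0', sub_zero, abs_of_nonpos ht] at h2
      linarith

end Cost

end Busemann

end TorusMetric

/-- The rotation by a right angle. -/
def rot (v : ℝ × ℝ) : ℝ × ℝ := (-v.2, v.1)

lemma zt_rot (v w : ℝ × ℝ) : zt w (rot v) = xi w v := by simp [crossDet, xi, rot]

lemma norm_rot (v : ℝ × ℝ) : ‖rot v‖ = ‖v‖ := by simp [rot, Prod.norm_def, max_comm]

lemma norm_sq_le_xi (v : ℝ × ℝ) : ‖v‖ ^ 2 ≤ xi v v := by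
  have h : ‖v‖ = |v.1| ∨ ‖v‖ = |v.2| := by
    rw [Prod.norm_def, Real.norm_eq_abs, Real.norm_eq_abs]
    exact max_choice _ _
  unfold xi
  rcases h with h | h <;> rw [h, sq_abs] <;> nlinarith [sq_nonneg v.1, sq_nonneg v.2]

lemma abs_zt_le (v x : ℝ × ℝ) : |zt v x| ≤ 2 * ‖v‖ * ‖x‖ := by
  have h1 : |v.1 * x.2| ≤ ‖v‖ * ‖x‖ := by
    rw [abs_mul]
    exact mul_le_mul (abs_fst_le v) (abs_snd_le x) (abs_nonneg _) (norm_nonneg _)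
  have h2 : |v.2 * x.1| ≤ ‖v‖ * ‖x‖ := by
    rw [abs_mul]
    exact mul_le_mul (abs_snd_le v) (abs_fst_le x) (abs_nonneg _) (norm_nonneg _)
  have := abs_sub (v.1 * x.2) (v.2 * x.1)
  simp only [crossDet]
  linarith

lemma HasDerivAt.exists_near {c : ℝ → ℝ × ℝ} {c' : ℝ × ℝ} {t κ : ℝ} (h : HasDerivAt c c' t)
    (hκ : 0 < κ) : ∃ s₁ > 0, ∀ s, |s| < s₁ → ‖c (t + s) - c t - s • c'‖ ≤ κ * |s| := by
  have h1 := (hasDerivAt_iff_isLittleO_nhds_zero.1 h).def hκ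
  obtain ⟨s₁, hs, h2⟩ := Metric.eventually_nhds_iff.1 h1
  exact ⟨s₁, hs, fun s hs => by simpa using h2 (y := s) (by simpa using hs)⟩

namespace TorusMetric

variable {M : TorusMetric} {k : ℤ × ℤ} {ℓ C : ℝ} {α : ℝ → ℝ × ℝ}

lemma LocIso.norm_deriv_le {z : ℝ → ℝ × ℝ} (h : M.LocIso z) (t : ℝ) : ‖deriv z t‖ ≤ 1 / M.lo := by
  rw [le_div_iff₀ M.lo_pos, mul_comm, ← h.nrm_deriv t]
  exact M.lo_le _ _

lemma LocIso.le_norm_deriv {z : ℝ → ℝ × ℝ} (h : M.LocIso z) (t : ℝ) : 1 / M.hi ≤ ‖deriv z t‖ := by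
  rw [div_le_iff₀ M.hi_pos, mul_comm, ← h.nrm_deriv t]
  exact M.le_hi _ _

/-- Points close to a line, in directions uniformly transversal to it, do not lie on the line. -/
lemma IsLine.exists_cone (h : M.IsLine α) {η : ℝ} (hη : 0 < η) :
    ∃ r > 0, ∀ u x, x ≠ 0 → ‖x‖ < r → η * ‖x‖ ≤ |zt (deriv α u) x| → α u + x ∉ range α := by
  set B := 16 * M.ac * (1 / M.lo) * M.hi + 1 with hB
  have hac := M.ac_nonneg
  have hlo := M.lo_pos
  have hhi := M.hi_pos
  have hBpos : 0 < B := by positivity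
  set ρ := min (1 / 4) ((η / B) ^ 2) with hρ
  have hρpos : 0 < ρ := by positivity
  refine ⟨ρ / M.hi, by positivity, ?_⟩
  rintro u x hx hxr hηx ⟨v, hv⟩
  have hxpos : 0 < ‖x‖ := norm_pos_iff.2 hx
  have huv : |v - u| ≤ M.hi * ‖x‖ := by
    rw [← h v u, hv]
    refine (M.dist_le_hi _ _).trans (le_of_eq ?_)
    rw [add_sub_cancel_left]
  have hlt : |v - u| < ρ := by
    rw [lt_div_iff₀ hhi] at hxr
    linarith
  have h4 : |v - u| < 1 / 4 := hlt.trans_le (min_le_left _ _)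
  rw [abs_lt] at h4
  have hest := ((h.isoOn (u - 1 / 2) (u + 1 / 2)).exists_deriv (t := u) (by linarith)
    ⟨by linarith, by linarith⟩).2.2 v ⟨by linarith, by linarith⟩
  rw [hv, add_sub_cancel_left] at hest
  have hz : zt (deriv α u) x = zt (deriv α u) (x - (v - u) • deriv α u) := by
    rw [zt_sub, zt_smul, zt_self, mul_zero, sub_zero]
  have hsq : √|v - u| < η / B := by
    rw [Real.sqrt_lt' (by positivity)]
    exact hlt.trans_le (min_le_right _ _)
  have h5 : |zt (deriv α u) x| ≤ 2 * (1 / M.lo) * (8 * M.ac * (M.hi * ‖x‖ * √|v - u|)) := by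
    rw [hz]
    refine (abs_zt_le _ _).trans ?_
    refine mul_le_mul (by linarith [h.locIso.norm_deriv_le u]) (hest.trans ?_) (norm_nonneg _)
      (by positivity)
    gcongr
  have h6 : 2 * (1 / M.lo) * (8 * M.ac * (M.hi * ‖x‖ * √|v - u|)) ≤ B * ‖x‖ * √|v - u| := by
    have : 0 ≤ ‖x‖ * √|v - u| := by positivity
    rw [hB]
    linarith
  have h7 : B * ‖x‖ * √|v - u| < η * ‖x‖ := by
    calc B * ‖x‖ * √|v - u| < B * ‖x‖ * (η / B) := by gcongr
      _ = η * ‖x‖ := by field_simp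
  linarith

lemma joinedIn_cone {A : Set (ℝ × ℝ)} {p v : ℝ × ℝ} {ε η r : ℝ} (hη : 0 < η) (hε : |ε| = 1)
    (hr : ∀ x, x ≠ 0 → ‖x‖ < r → η * ‖x‖ ≤ |zt v x| → p + x ∉ A) {x y : ℝ × ℝ}
    (hx0 : x ≠ 0) (hxr : ‖x‖ < r) (hx : η * ‖x‖ ≤ ε * zt v x)
    (hy0 : y ≠ 0) (hyr : ‖y‖ < r) (hy : η * ‖y‖ ≤ ε * zt v y) :
    JoinedIn Aᶜ (p + x) (p + y) := by
  apply JoinedIn.of_segment_subset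
  rintro _ ⟨a, b, ha, hb, hab, rfl⟩
  rw [show a • (p + x) + b • (p + y) = p + (a • x + b • y) by
    rw [smul_add, smul_add, add_add_add_comm, ← add_smul, hab, one_smul]]
  have hn : ‖a • x + b • y‖ ≤ a * ‖x‖ + b * ‖y‖ := by
    refine (norm_add_le _ _).trans (le_of_eq ?_)
    rw [norm_smul, norm_smul, Real.norm_of_nonneg ha, Real.norm_of_nonneg hb]
  have hz : η * (a * ‖x‖ + b * ‖y‖) ≤ ε * zt v (a • x + b • y) := by
    rw [zt_add, zt_smul, zt_smul]
    nlinarith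
  have hpos : 0 < a * ‖x‖ + b * ‖y‖ := by
    have h1 := norm_pos_iff.2 hx0
    have h2 := norm_pos_iff.2 hy0
    rcases ha.eq_or_lt with rfl | ha
    · have : b = 1 := by linarith
      simpa [this] using hy0
    · have := mul_pos ha h1
      have := mul_nonneg hb h2.le
      linarith
  have hle : ε * zt v (a • x + b • y) ≤ |zt v (a • x + b • y)| := by
    refine (le_abs_self _).trans (le_of_eq ?_)
    rw [abs_mul, hε, one_mul]
  refine hr _ (fun h0 => ?_) (hn.trans_lt ?_) ?_
  · rw [h0] at hz
    simp [crossDet] at hz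
    nlinarith [mul_pos hη hpos]
  · rcases ha.eq_or_lt with rfl | ha
    · have : b = 1 := by linarith
      simpa [this] using hyr
    · nlinarith
  · exact (mul_le_mul_of_nonneg_left hn hη.le).trans (hz.trans hle)

lemma LocIso.rot_cone {z : ℝ → ℝ × ℝ} (h : M.LocIso z) (t : ℝ) {ε s r : ℝ} (hε : |ε| = 1)
    (hs : 0 < s) (hr : s / M.lo < r) : (ε * s) • rot (deriv z t) ≠ 0 ∧
      ‖(ε * s) • rot (deriv z t)‖ < r ∧ 1 / M.hi * ‖(ε * s) • rot (deriv z t)‖ ≤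
        ε * zt (deriv z t) ((ε * s) • rot (deriv z t)) := by
  have h1 := h.norm_deriv_le t
  have h2 := h.le_norm_deriv t
  have h3 : 0 < 1 / M.hi := one_div_pos.2 M.hi_pos
  have hnorm : ‖(ε * s) • rot (deriv z t)‖ = s * ‖deriv z t‖ := by
    rw [norm_smul, norm_rot, Real.norm_eq_abs, abs_mul, hε, one_mul, abs_of_pos hs]
  have hεε : ε * ε = 1 := by rw [← abs_mul_abs_self, hε, one_mul]
  refine ⟨?_, ?_, ?_⟩
  · rw [← norm_pos_iff, hnorm]
    exact mul_pos hs (h3.trans_le h2)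
  · rw [hnorm]
    refine lt_of_le_of_lt ?_ hr
    rw [div_eq_mul_one_div]
    gcongr
  · rw [hnorm, zt_smul, zt_rot, show ε * (ε * s * xi (deriv z t) (deriv z t)) =
      (ε * ε) * (s * xi (deriv z t) (deriv z t)) by ring, hεε, one_mul]
    calc 1 / M.hi * (s * ‖deriv z t‖) ≤ ‖deriv z t‖ * (s * ‖deriv z t‖) := by gcongr
      _ = s * ‖deriv z t‖ ^ 2 := by ring
      _ ≤ _ := by gcongr; exact norm_sq_le_xi _

/-- All points close to a line on one given side of it can be joined in the complement. -/
lemma IsLine.exists_sides (h : M.IsLine α) : ∃ s₀ > 0, ∀ ε, |ε| = 1 → ∀ η > 0, ∃ r > 0, ∀ u x,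
    x ≠ 0 → ‖x‖ < r → η * ‖x‖ ≤ ε * zt (deriv α u) x →
      JoinedIn (range α)ᶜ (α u + x) (α 0 + (ε * s₀) • rot (deriv α 0)) := by
  have hhi := M.hi_pos
  have hlo := M.lo_pos
  obtain ⟨r₀, hr₀, hc₀⟩ := h.exists_cone (η := 1 / M.hi) (by positivity)
  refine ⟨r₀ * M.lo / 2, by positivity, fun ε hε η hη => ?_⟩
  set s₀ := r₀ * M.lo / 2 with hs₀
  have hs₀pos : 0 < s₀ := by positivity
  have hs₀r : s₀ / M.lo < r₀ := by rw [div_lt_iff₀ hlo, hs₀]; linarith [mul_pos hr₀ hlo]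
  set η₁ := min η (1 / M.hi)
  have hη₁ : 0 < η₁ := by positivity
  obtain ⟨r₁, hr₁, hc₁⟩ := h.exists_cone hη₁
  refine ⟨r₁, hr₁, fun u x hx hxr hxη => ?_⟩
  set s := min s₀ (r₁ * M.lo / 2) with hs
  have hspos : 0 < s := by positivity
  have hsr₁ : s / M.lo < r₁ := by
    rw [div_lt_iff₀ hlo]
    linarith [min_le_right s₀ (r₁ * M.lo / 2), mul_pos hr₁ hlo]
  have hsr₀ : s / M.lo < r₀ := lt_of_le_of_lt (by gcongr; exact min_le_left _ _) hs₀r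
  have k1 := h.locIso.rot_cone u hε hspos hsr₁
  have k2 := h.locIso.rot_cone u hε hspos hsr₀
  have k3 := h.locIso.rot_cone u hε hs₀pos hs₀r
  have j1 := joinedIn_cone hη₁ hε (hc₁ u) hx hxr
    ((mul_le_mul_of_nonneg_right (min_le_left _ _) (norm_nonneg _)).trans hxη) k1.1 k1.2.1
    ((mul_le_mul_of_nonneg_right (min_le_right _ _) (norm_nonneg _)).trans k1.2.2)
  have j2 := joinedIn_cone (by positivity) hε (hc₀ u) k2.1 k2.2.1 k2.2.2 k3.1 k3.2.1 k3.2.2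
  have hcont : Continuous fun u => α u + (ε * s₀) • rot (deriv α u) := by
    have h1 := h.locIso.contDiff_one.continuous_deriv le_rfl
    have h2 := h.continuous
    unfold rot
    fun_prop
  have j3 := joinedIn_of_continuousOn (A := (range α)ᶜ)
    (hcont.continuousOn (s := Icc (min u 0) (max u 0)))
    (fun v _ => by
      have := h.locIso.rot_cone v hε hs₀pos hs₀r
      refine hc₀ v _ this.1 this.2.1 (this.2.2.trans ((le_abs_self _).trans (le_of_eq ?_)))
      rw [abs_mul, hε, one_mul]) (s := u) (t := 0) ⟨min_le_left _ _, le_max_left _ _⟩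
      ⟨min_le_right _ _, le_max_right _ _⟩
  exact (j1.trans j2).trans j3

lemma PerLine.exists_far (h : M.PerLine k ℓ α) (C : ℝ) {δ s₀ : ℝ} (hδ : |δ| = 1)
    (hs : ∀ ε, |ε| = 1 → ∀ η > 0, ∃ r > 0, ∀ u x,
    x ≠ 0 → ‖x‖ < r → η * ‖x‖ ≤ ε * zt (deriv α u) x →
      JoinedIn (range α)ᶜ (α u + x) (α 0 + (ε * s₀) • rot (deriv α 0))) :
    ∃ ε, |ε| = 1 ∧ ∃ x, C < δ * zt (lat k) x ∧
      JoinedIn (range α)ᶜ (α 0 + (ε * s₀) • rot (deriv α 0)) x := by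
  have hw := h.lat_ne_zero
  set f : ℝ → ℝ := fun u => δ * zt (lat k) (α u) with hf
  have hfc : Continuous f := continuous_const.mul ((continuous_zt _).comp h.line.continuous)
  have hper : Function.Periodic f ℓ := fun u => by
    simp only [hf, h.per, zt_add, zt_self, add_zero]
  obtain ⟨u, -, hu⟩ := isCompact_Icc.exists_isMaxOn (nonempty_Icc.2 h.pos.le) hfc.continuousOn
  have hmax : ∀ v, f v ≤ f u := fun v => by
    obtain ⟨y, hy, he⟩ := hper.exists_mem_Ico₀ h.pos v
    rw [he]
    exact hu (Ico_subset_Icc_self hy)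
  have hd := h.line.locIso.hasDerivAt u
  have hfd : HasDerivAt f (δ * zt (lat k) (deriv α u)) u := by
    have h1 := (hasFDerivAt_fst (𝕜 := ℝ) (p := α u)).comp_hasDerivAt u hd
    have h2 := (hasFDerivAt_snd (𝕜 := ℝ) (p := α u)).comp_hasDerivAt u hd
    exact ((h2.const_mul (lat k).1).sub (h1.const_mul (lat k).2)).const_mul δ
  have h0 : zt (lat k) (deriv α u) = 0 := by
    have hloc : IsLocalMax f u := Eventually.of_forall hmax
    have := hloc.hasDerivAt_eq_zero hfd
    rcases mul_eq_zero.1 this with h1 | h1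
    · rw [h1] at hδ; simp at hδ
    · exact h1
  have hxi : xi (lat k) (deriv α u) ≠ 0 := fun h1 => by
    have h2 := h.line.locIso.le_norm_deriv u
    rw [eq_zero_of_xi_zt hw h1 h0, norm_zero] at h2
    exact (one_div_pos.2 M.hi_pos).not_ge h2
  obtain ⟨ε, hε, hpos⟩ : ∃ ε : ℝ, |ε| = 1 ∧ 0 < δ * (ε * xi (lat k) (deriv α u)) := by
    have : δ * xi (lat k) (deriv α u) ≠ 0 := mul_ne_zero (fun h1 => by simp [h1] at hδ) hxi
    rcases lt_or_gt_of_ne this with h1 | h1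
    · exact ⟨-1, by simp, by linarith⟩
    · exact ⟨1, by simp, by linarith⟩
  obtain ⟨r, hr, hj⟩ := hs ε hε (1 / M.hi) (one_div_pos.2 M.hi_pos)
  set s := r * M.lo / 2 with hsdef
  have hspos : 0 < s := by have := M.lo_pos; positivity
  have hsr : s / M.lo < r := by
    rw [div_lt_iff₀ M.lo_pos]; linarith [mul_pos hr M.lo_pos]
  have k1 := h.line.locIso.rot_cone u hε hspos hsr
  have j1 := hj u _ k1.1 k1.2.1 k1.2.2
  set d := δ * (ε * xi (lat k) (deriv α u)) with hdd
  have hzt : ∀ a, δ * zt (lat k) (α u + (ε * a) • rot (deriv α u)) = f u + a * d := fun a => by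
    rw [zt_add, zt_smul, zt_rot]
    simp only [hf, hdd]
    ring
  obtain ⟨S, hS⟩ : ∃ S, s ≤ S ∧ C < f u + S * d := by
    refine ⟨max s ((C - f u) / d + 1), le_max_left _ _, ?_⟩
    have : (C - f u) / d + 1 ≤ max s ((C - f u) / d + 1) := le_max_right _ _
    have h2 : ((C - f u) / d + 1) * d ≤ max s ((C - f u) / d + 1) * d := by gcongr
    rw [add_mul, div_mul_cancel₀ _ hpos.ne'] at h2
    linarith
  refine ⟨ε, hε, α u + (ε * S) • rot (deriv α u), by rw [hzt]; exact hS.2, j1.symm.trans ?_⟩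
  refine joinedIn_of_continuousOn (g := fun a => α u + (ε * a) • rot (deriv α u))
    (a := s) (b := S) (by fun_prop) ?_ ⟨le_rfl, hS.1⟩ ⟨hS.1, le_rfl⟩
  rintro a ha ⟨v, hv⟩
  have h1 := hmax v
  have h2 : f v = f u + a * d := by rw [← hzt, ← hv]
  nlinarith [ha.1]

lemma PerLine.not_joinedIn (h : M.PerLine k ℓ α) {s₀ : ℝ}
    (hs : ∀ ε, |ε| = 1 → ∀ η > 0, ∃ r > 0, ∀ u x,
    x ≠ 0 → ‖x‖ < r → η * ‖x‖ ≤ ε * zt (deriv α u) x →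
      JoinedIn (range α)ᶜ (α u + x) (α 0 + (ε * s₀) • rot (deriv α 0))) :
    ¬ JoinedIn (range α)ᶜ (α 0 + (1 * s₀) • rot (deriv α 0))
      (α 0 + (-1 * s₀) • rot (deriv α 0)) := by
  intro hj
  obtain ⟨C, -, hC, -⟩ := h.exists_bound
  obtain ⟨ε, hε, x, hx, jx⟩ := h.exists_far C (δ := 1) (by simp) hs
  obtain ⟨ε', hε', y, hy, jy⟩ := h.exists_far C (δ := -1) (by simp) hs
  have hall : ∀ ε, |ε| = 1 → JoinedIn (range α)ᶜ (α 0 + (ε * s₀) • rot (deriv α 0))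
      (α 0 + (1 * s₀) • rot (deriv α 0)) := fun ε hε => by
    rcases (abs_eq zero_le_one).1 hε with rfl | rfl
    · exact JoinedIn.refl hj.source_mem
    · exact hj.symm
  have hxy : JoinedIn (range α)ᶜ y x :=
    (jy.symm.trans (hall ε' hε')).trans ((hall ε hε).symm.trans jx)
  exact h.notMem_above hC (by linarith) (mem_above_of_joinedIn hxy (mem_above hC (by linarith)))

/-- A curve cannot cross a periodic line twice in a row in the same direction. -/
lemma PerLine.false_of_crossings (h : M.PerLine k ℓ α) {c : ℝ → ℝ × ℝ}
    (hc : ∀ t, HasDerivAt c (deriv c t) t) {t₁ t₂ : ℝ} (ht : t₁ < t₂) (h1 : c t₁ ∈ range α)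
    (h2 : c t₂ ∈ range α)
    (hpos : ∀ t ∈ Icc t₁ t₂, ∀ u, c t = α u → 0 < zt (deriv α u) (deriv c t)) : False := by
  obtain ⟨s₀, -, hs⟩ := h.line.exists_sides
  have key : ∀ t ∈ Icc t₁ t₂, c t ∈ range α → ∀ ε : ℝ, |ε| = 1 → ∃ s₁ > 0, ∀ s ∈ Ioo 0 s₁,
      JoinedIn (range α)ᶜ (c (t + ε * s)) (α 0 + (ε * s₀) • rot (deriv α 0)) := by
    rintro t ht ⟨u, hu⟩ ε hε
    set v := deriv α u
    set d := zt v (deriv c t) with hd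
    have hdpos : 0 < d := hpos t ht u hu.symm
    have hn := norm_nonneg (deriv c t)
    have hnv := norm_nonneg v
    set η := d / (2 * (‖deriv c t‖ + 1)) with hη
    have hηpos : 0 < η := by positivity
    set κ := min 1 (d / (4 * (‖v‖ + 1))) with hκ
    have hκpos : 0 < κ := by positivity
    obtain ⟨r, hr, hj⟩ := hs ε hε η hηpos
    obtain ⟨s₁, hs₁, hnear⟩ := (hc t).exists_near hκpos
    refine ⟨min s₁ (r / (‖deriv c t‖ + 1)), by positivity, fun s hss => ?_⟩
    have hs1 : s < s₁ := hss.2.trans_le (min_le_left _ _)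
    have hs2 : s * (‖deriv c t‖ + 1) < r := by
      rw [← lt_div_iff₀ (by positivity)]; exact hss.2.trans_le (min_le_right _ _)
    have habs : |ε * s| = s := by rw [abs_mul, hε, one_mul, abs_of_pos hss.1]
    have hεε : ε * ε = 1 := by rw [← abs_mul_abs_self, hε, one_mul]
    have he := hnear (ε * s) (by rwa [habs])
    rw [habs] at he
    set x := c (t + ε * s) - c t with hx
    have hxn : ‖x‖ ≤ s * (‖deriv c t‖ + 1) := by
      calc ‖x‖ = ‖(x - (ε * s) • deriv c t) + (ε * s) • deriv c t‖ := by rw [sub_add_cancel]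
        _ ≤ κ * s + s * ‖deriv c t‖ := (norm_add_le _ _).trans (add_le_add he (le_of_eq (by
            rw [norm_smul, Real.norm_eq_abs, habs])))
        _ ≤ _ := by
          have : κ * s ≤ 1 * s := mul_le_mul_of_nonneg_right (min_le_left _ _) hss.1.le
          linarith
    have hzx : s * d / 2 ≤ ε * zt v x := by
      have e1 : ε * zt v x = s * d + ε * zt v (x - (ε * s) • deriv c t) := by
        rw [zt_sub v x, zt_smul, ← hd]
        linear_combination (s * d) * hεε
      have e2 : |ε * zt v (x - (ε * s) • deriv c t)| ≤ 2 * ‖v‖ * (κ * s) := by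
        rw [abs_mul, hε, one_mul]
        exact (abs_zt_le _ _).trans (by gcongr)
      have e3 : 2 * ‖v‖ * (κ * s) ≤ s * d / 2 := by
        have : κ * (4 * (‖v‖ + 1)) ≤ d := by
          rw [← le_div_iff₀ (by positivity)]; exact min_le_right _ _
        nlinarith [hss.1, mul_pos hκpos hss.1]
      have e4 := (abs_le.1 e2).1
      rw [e1]
      linarith
    have hsd : 0 < s * d := mul_pos hss.1 hdpos
    have hfin := hj u x (fun h0 => by
        rw [h0] at hzx; simp [crossDet] at hzx; linarith) (hxn.trans_lt hs2) (by
        calc η * ‖x‖ ≤ η * (s * (‖deriv c t‖ + 1)) := by gcongr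
          _ = s * d / 2 := by rw [hη]; field_simp
          _ ≤ _ := hzx)
    rwa [hu, hx, add_sub_cancel] at hfin
  obtain ⟨s₁, hs₁, k1⟩ := key t₁ ⟨le_rfl, ht.le⟩ h1 1 (by simp)
  have hs12 : s₁ ≤ t₂ - t₁ := by
    by_contra! hlt
    have := (k1 (t₂ - t₁) ⟨by linarith, hlt⟩).source_mem
    rw [one_mul, add_sub_cancel] at this
    exact this h2
  have ka := k1 (s₁ / 2) ⟨by linarith, by linarith⟩
  set a := t₁ + 1 * (s₁ / 2) with ha
  have hcc : Continuous c := continuous_iff_continuousAt.2 fun t => (hc t).continuousAt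
  obtain ⟨b, ⟨⟨hab, hbt⟩, hbA⟩, hb⟩ := (isCompact_Icc.inter_right
    (h.line.isClosed_range.preimage hcc)).exists_isLeast (s := Icc a t₂ ∩ c ⁻¹' range α)
    ⟨t₂, ⟨by linarith, le_rfl⟩, h2⟩
  obtain ⟨s₂, hs₂, k2⟩ := key b ⟨by linarith, hbt⟩ hbA (-1) (by simp)
  have hab' : a < b := lt_of_le_of_ne hab fun he => ka.source_mem (by rw [he]; exact hbA)
  set s := min (s₂ / 2) (b - a) with hsd
  have hs : 0 < s := lt_min (by linarith) (by linarith)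
  have kb := k2 s ⟨hs, (min_le_left _ _).trans_lt (by linarith)⟩
  have hsb : s ≤ b - a := min_le_right _ _
  have hmid : JoinedIn (range α)ᶜ (c a) (c (b + -1 * s)) := by
    refine joinedIn_of_continuousOn (A := (range α)ᶜ) (a := a) (b := b + -1 * s)
      hcc.continuousOn (fun t ht hA => ?_)
      ⟨le_rfl, by linarith⟩ ⟨by linarith, le_rfl⟩
    have := hb ⟨⟨ht.1, by linarith [ht.2]⟩, hA⟩
    linarith [ht.2]
  exact h.not_joinedIn ‹_› (ka.symm.trans (hmid.trans kb))

end TorusMetric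

lemma eq_or_neg_of_zt_eq_zero {v w : ℝ × ℝ} (hv : v ≠ 0) (h : zt v w = 0) :
    ∃ a : ℝ, w = a • v := by
  have hpos := xi_self_pos hv
  refine ⟨xi v w / xi v v, ?_⟩
  have h1 : xi v (w - (xi v w / xi v v) • v) = 0 := by
    rw [xi_sub, xi_smul, div_mul_cancel₀ _ hpos.ne', sub_self]
  have h2 : zt v (w - (xi v w / xi v v) • v) = 0 := by
    rw [zt_sub, zt_smul, zt_self, h, mul_zero, sub_zero]
  exact sub_eq_zero.1 (eq_zero_of_xi_zt hv h1 h2)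

namespace TorusMetric

variable {M : TorusMetric} {k : ℤ × ℤ} {ℓ C : ℝ} {α : ℝ → ℝ × ℝ}

lemma LocIso.deriv_eq_of_zt_eq_zero {y z : ℝ → ℝ × ℝ} (hy : M.LocIso y) (hz : M.LocIso z)
    {s t : ℝ} (h0 : y s = z t) (h : zt (deriv y s) (deriv z t) = 0) :
    deriv z t = deriv y s ∨ deriv z t = -deriv y s := by
  have hn : deriv y s ≠ 0 := fun h0 => by
    have := hy.le_norm_deriv s
    rw [h0, norm_zero] at this
    exact (one_div_pos.2 M.hi_pos).not_ge this
  obtain ⟨a, ha⟩ := eq_or_neg_of_zt_eq_zero hn h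
  have h1 := hz.nrm_deriv t
  rw [ha, M.nrm_smul, ← h0, hy.nrm_deriv, mul_one] at h1
  rw [ha]
  rcases (abs_eq zero_le_one).1 h1 with rfl | rfl
  · left; simp
  · right; simp

/-- A calibrated line meets the lines which have the same period as the calibration only
tangentially. -/
lemma Calib.deriv_eq_of_mem {f : ℝ × ℝ → ℝ} {γ η c : ℝ → ℝ × ℝ} (hγ : M.Calib f γ)
    (hη : M.Calib f η) (hf : ∀ x y, f y - f x ≤ M.dist x y) (hc : M.LocIso c) {t : ℝ}
    (h0 : γ 0 = c t) (h1 : deriv γ 0 = deriv c t) {t' u : ℝ} (h2 : c t' = η u) :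
    deriv c t' = deriv η u := by
  have h3 : c = fun s => γ (s - t) := by
    refine hc.eq_of_deriv_eq (t := t) (by
      simpa [sub_eq_add_neg] using (hγ.isLine hf).locIso.comp_add (-t)) (by simp [h0]) ?_
    rw [deriv_comp_sub_const, sub_self, h1]
  have h4 : M.Calib f fun s => c (s + t') := by
    have := hγ.comp_add (t' - t)
    rw [h3]
    convert this using 3
    ring
  have h5 := h4.deriv_eq (hη.comp_add u) hf (by simp [h2])
  rwa [deriv_comp_add_const, deriv_comp_add_const, zero_add, zero_add] at h5

/-- Between two transversal intersections with a periodic minimal line, a geodesic passes through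
a point which is not on a minimal connection between two given translates of that line. -/
lemma PerLine.exists_gap (h : M.PerLine k ℓ α) {c : ℝ → ℝ × ℝ} (hc : M.LocIso c) {t₁ t₂ : ℝ}
    (ht : t₁ < t₂) {u₁ u₂ : ℝ} (h1 : c t₁ = α u₁) (h2 : c t₂ = α u₂)
    (htr : zt (deriv α u₁) (deriv c t₁) ≠ 0) (a b : ℤ × ℤ) :
    ∃ t ∈ Icc t₁ t₂, M.mm (fun u => α u + lat a) (fun u => α u + lat b) <
      M.bu (fun u => α u + lat a) (c t) + M.au (fun u => α u + lat b) (c t) := by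
  by_contra! hle
  have ha := h.add_lat a
  have hb := h.add_lat b
  set f := M.bu fun u => α u + lat a with hfdef
  have hf : ∀ x y, f y - f x ≤ M.dist x y := bu_sub_le ha.line
  have hαc : M.Calib f α := ha.calib h
  have hleaf : ∀ x ∈ c '' Icc t₁ t₂, ∃ γ, M.Calib f γ ∧ γ 0 = x := by
    rintro _ ⟨t, ht, rfl⟩
    refine exists_leaf ha.line hb.line (K := M.hi * ‖lat a - lat b‖) (fun u => ?_) (hle t ht)
    refine (M.dist_le_hi _ _).trans (le_of_eq ?_)
    congr 2
    abel
  obtain ⟨X, hX, hXd⟩ := exists_continuousOn_dir hf hleaf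
  have hhit : ∀ t ∈ Icc t₁ t₂, ∀ u, c t = α u → deriv α u = X (c t) := fun t ht u hu => by
    have := hXd _ (hαc.comp_add u) (by simpa [← hu] using mem_image_of_mem c ht)
    rw [deriv_comp_add_const, zero_add, ← hu] at this
    exact this
  set D : ℝ → ℝ := fun t => zt (X (c t)) (deriv c t) with hD
  have hcc : Continuous c := hc.contDiff_one.continuous
  have hDc : ContinuousOn D (Icc t₁ t₂) := by
    have e1 : ContinuousOn (fun t => X (c t)) (Icc t₁ t₂) :=
      hX.comp hcc.continuousOn (mapsTo_image _ _)
    have e2 := (hc.contDiff_one.continuous_deriv le_rfl).continuousOn (s := Icc t₁ t₂)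
    exact (e1.fst.mul e2.snd).sub (e1.snd.mul e2.fst)
  have hD0 : ∀ t ∈ Icc t₁ t₂, D t ≠ 0 := fun t ht h0 => by
    obtain ⟨γ, hγ, hγ0⟩ := hleaf _ (mem_image_of_mem c ht)
    have hXγ := hXd γ hγ (by rw [hγ0]; exact mem_image_of_mem c ht)
    rw [hγ0] at hXγ
    simp only [hD, ← hXγ] at h0
    rcases (hγ.isLine hf).locIso.deriv_eq_of_zt_eq_zero hc hγ0 h0 with h3 | h3
    · apply htr
      rw [hγ.deriv_eq_of_mem hαc hf hc hγ0 h3.symm h1, zt_self]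
    · apply htr
      have h4 := hγ.deriv_eq_of_mem hαc hf hc.neg (t := -t) (by simp [hγ0])
        (by rw [deriv_comp_neg, neg_neg, h3, neg_neg]) (t' := -t₁) (u := u₁) (by simp [h1])
      rw [deriv_comp_neg, neg_neg] at h4
      rw [← h4]
      simp [crossDet]; ring
  have hsign : (∀ t ∈ Icc t₁ t₂, 0 < D t) ∨ ∀ t ∈ Icc t₁ t₂, D t < 0 := by
    by_contra! hcon
    obtain ⟨⟨s, hs, hs'⟩, t, ht, ht'⟩ := hcon
    obtain ⟨r, hr, hr'⟩ := (isPreconnected_Icc.image D hDc).ordConnected.out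
      (mem_image_of_mem D hs) (mem_image_of_mem D ht) ⟨hs', ht'⟩
    exact hD0 r hr hr'
  rcases hsign with hs | hs
  · refine h.false_of_crossings hc.hasDerivAt ht ⟨u₁, h1.symm⟩ ⟨u₂, h2.symm⟩ fun t ht u hu => ?_
    rw [hhit t ht u hu]
    exact hs t ht
  · refine h.false_of_crossings hc.neg.hasDerivAt (neg_lt_neg ht) ⟨u₂, by simp [h2]⟩
      ⟨u₁, by simp [h1]⟩ fun t ht u hu => ?_
    have ht' : -t ∈ Icc t₁ t₂ := ⟨by linarith [ht.2], by linarith [ht.1]⟩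
    rw [hhit _ ht' u hu, deriv_comp_neg, zt_neg]
    exact neg_pos.2 (hs _ ht')

end TorusMetric

/-- Abstract properties of the relation expressing that there is a connection of cost `c` from the
parameter `u` to the parameter `u'`. -/
structure CostRel (Q : ℝ → ℝ → ℝ → Prop) (K m : ℝ) : Prop where
  mono : ∀ {u u' c v v'}, Q u u' c → v ≤ u → u' ≤ v' → Q v v' c
  left : ∀ {u u' c s}, Q u u' c → 0 ≤ s → Q (u + s) u' (c + 2 * s)
  right : ∀ {u u' c s}, Q u u' c → 0 ≤ s → Q u (u' - s) (c + 2 * s)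
  coer_left : ∀ {u u' c}, Q u u' c → 2 * u - K ≤ c
  coer_right : ∀ {u u' c}, Q u u' c → -2 * u' - K ≤ c
  lower : ∀ {u u' c}, Q u u' c → m ≤ c
  closed : ∀ {u u' c : ℕ → ℝ} {a a' b : ℝ}, (∀ i, Q (u i) (u' i) (c i)) → Tendsto u ulf (𝓝 a) →
    Tendsto u' ulf (𝓝 a') → Tendsto c ulf (𝓝 b) → Q a a' b
  nonempty : ∃ u u' c, Q u u' c

namespace CostRel

variable {Q : ℝ → ℝ → ℝ → Prop} {K m : ℝ}

lemma symm (h : CostRel Q K m) : CostRel (fun u u' c => Q (-u') (-u) c) K m where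
  mono hq h1 h2 := h.mono hq (neg_le_neg h2) (neg_le_neg h1)
  left {u u' c s} hq hs := by
    have := h.right hq hs
    rwa [show -u - s = -(u + s) by ring] at this
  right {u u' c s} hq hs := by
    have := h.left hq hs
    rwa [show -u' + s = -(u' - s) by ring] at this
  coer_left hq := by have := h.coer_right hq; linarith
  coer_right hq := by have := h.coer_left hq; linarith
  lower hq := h.lower hq
  closed hq h1 h2 h3 := h.closed hq h2.neg h1.neg h3
  nonempty := by
    obtain ⟨u, u', c, hq⟩ := h.nonempty
    exact ⟨-u', -u, c, by simpa using hq⟩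

/-- The infimum of the costs. -/
def _root_.cinf (Q : ℝ → ℝ → ℝ → Prop) : ℝ := sInf {c | ∃ u u', Q u u' c}

lemma cinf_le (h : CostRel Q K m) {u u' c : ℝ} (hq : Q u u' c) : cinf Q ≤ c :=
  csInf_le ⟨m, fun _ ⟨_, _, hq⟩ => h.lower hq⟩ ⟨u, u', hq⟩

lemma exists_lt (h : CostRel Q K m) {η : ℝ} (hη : 0 < η) : ∃ u u' c, Q u u' c ∧ c < cinf Q + η := by
  obtain ⟨u, u', c, hq⟩ := h.nonempty
  obtain ⟨c', ⟨v, v', hc'⟩, hlt⟩ := exists_lt_of_csInf_lt (s := {c | ∃ u u', Q u u' c})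
    ⟨c, u, u', hq⟩ (lt_add_of_pos_right _ hη)
  exact ⟨v, v', c', hc', hlt⟩

lemma exists_reset_left (h : CostRel Q K m) {η : ℝ} (hη : 0 < η) (B : ℝ) :
    ∃ R, ∀ u u' c, Q u u' c → c ≤ B → ∀ R' ≥ R, ∃ c' ≤ c + η, Q (-R') u' c' := by
  obtain ⟨u₀, u₀', c₀, h₀, hc₀⟩ := h.exists_lt hη
  set K₁ := (B + K) / 2 with hK₁
  set v : ℕ → ℝ := fun i => -K₁ + (i + 1) * (η / 4) with hv
  have hr : ∀ i, ∃ r, ∀ u c, Q u (v i) c → ∃ c' ≤ c + η / 2, Q r (v i) c' := fun i => by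
    by_cases hne : ∃ u c, Q u (v i) c
    · obtain ⟨u, c, hq⟩ := hne
      have hbdd : BddBelow {c | ∃ u, Q u (v i) c} := ⟨m, fun _ ⟨_, hq⟩ => h.lower hq⟩
      obtain ⟨c', ⟨r, hr⟩, hlt⟩ := exists_lt_of_csInf_lt (s := {c | ∃ u, Q u (v i) c})
        ⟨c, u, hq⟩ (lt_add_of_pos_right _ (half_pos hη))
      exact ⟨r, fun u c hq => ⟨c', by linarith [csInf_le hbdd ⟨u, hq⟩], hr⟩⟩
    · exact ⟨0, fun u c hq => absurd ⟨u, c, hq⟩ hne⟩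
  choose r hr using hr
  obtain ⟨N, hN⟩ := exists_nat_ge ((u₀' + K₁) / (η / 4))
  obtain ⟨R, hR⟩ := ((Finset.range (N + 1)).image fun i => -r i).exists_le
  refine ⟨max R (-u₀), fun u u' c hq hc R' hR' => ?_⟩
  have hR1 := (le_max_left _ _).trans hR'
  have hR2 := (le_max_right _ _).trans hR'
  rcases le_total u₀' u' with hu | hu
  · exact ⟨c₀, by linarith [h.cinf_le hq], h.mono h₀ (by linarith) hu⟩
  · have h1 : 0 ≤ u' + K₁ := by have := h.coer_right hq; rw [hK₁]; linarith
    have hη4 : 0 < η / 4 := by linarith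
    set i := ⌊(u' + K₁) / (η / 4)⌋₊ with hi
    have h2 : (i : ℝ) * (η / 4) ≤ u' + K₁ := by
      rw [← le_div_iff₀ hη4]; exact Nat.floor_le (by positivity)
    have h3 : u' + K₁ < (i + 1) * (η / 4) := by
      rw [← div_lt_iff₀ hη4]; exact Nat.lt_floor_add_one _
    have hiN : i ≤ N := by
      have : (i : ℝ) ≤ N := by
        refine (Nat.floor_le (by positivity)).trans (le_trans ?_ hN)
        gcongr
      exact_mod_cast this
    have hvi : u' ≤ v i := by simp only [hv]; linarith
    obtain ⟨c', hc', hq'⟩ := hr i u c (h.mono hq le_rfl hvi)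
    have hq'' := h.right (s := v i - u') hq' (by linarith)
    rw [sub_sub_cancel] at hq''
    refine ⟨c' + 2 * (v i - u'), ?_, h.mono hq'' ?_ le_rfl⟩
    · simp only [hv]; linarith
    · have := hR _ (Finset.mem_image_of_mem _ (Finset.mem_range.2 (Nat.lt_succ_of_le hiN)))
      linarith

lemma exists_reset_right (h : CostRel Q K m) {η : ℝ} (hη : 0 < η) (B : ℝ) :
    ∃ R, ∀ u u' c, Q u u' c → c ≤ B → ∀ R' ≥ R, ∃ c' ≤ c + η, Q u R' c' := by
  obtain ⟨R, hR⟩ := h.symm.exists_reset_left hη B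
  refine ⟨R, fun u u' c hq hc R' hR' => ?_⟩
  obtain ⟨c', h1, h2⟩ := hR (-u') (-u) c (by simpa using hq) hc R' hR'
  exact ⟨c', h1, by simpa using h2⟩

section Chain

variable {n : ℕ} [NeZero n]

/-- A periodic chain of connections with gaps `g`. -/
def Chain (Q : ℝ → ℝ → ℝ → Prop) (g x c : ZMod n → ℝ) : Prop :=
  ∀ k, Q (x k) (x (k + 1) + g k) (c k)

lemma exists_minimizer (h : CostRel Q K m) {g : ZMod n → ℝ} (hne : ∃ x c, Chain Q g x c) :
    ∃ x c, Chain Q g x c ∧ ∀ x' c', Chain Q g x' c' → ∑ k, c k ≤ ∑ k, c' k := by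
  set S : Set ℝ := {s | ∃ x c, Chain Q g x c ∧ s = ∑ k, c k} with hS
  have hbdd : BddBelow S := by
    refine ⟨∑ _k : ZMod n, m, ?_⟩
    rintro _ ⟨x, c, hc, rfl⟩
    exact Finset.sum_le_sum fun k _ => h.lower (hc k)
  have hSne : S.Nonempty := by
    obtain ⟨x, c, hc⟩ := hne
    exact ⟨_, x, c, hc, rfl⟩
  have hseq : ∀ i : ℕ, ∃ x c, Chain Q g x c ∧ ∑ k, c k < sInf S + 1 / ((i : ℝ) + 1) := fun i => by
    obtain ⟨_, ⟨x, c, hc, rfl⟩, hlt⟩ := exists_lt_of_csInf_lt hSne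
      (lt_add_of_pos_right (sInf S) (Nat.one_div_pos_of_nat (n := i)))
    exact ⟨x, c, hc, hlt⟩
  choose x c hc hlt using hseq
  have hle1 : ∀ i, ∑ k, c i k ≤ sInf S + 1 := fun i => by
    refine (hlt i).le.trans ?_
    have : 1 / ((i : ℝ) + 1) ≤ 1 := by
      rw [div_le_one (by positivity)]; linarith [Nat.cast_nonneg (α := ℝ) i]
    linarith
  set B := sInf S + 1 - ∑ _k : ZMod n, m + m with hB
  have hcB : ∀ i k, c i k ≤ B := fun i k => by
    have h1 : c i k - m ≤ ∑ j, (c i j - m) := Finset.single_le_sum (f := fun j => c i j - m)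
      (fun j _ => by linarith [h.lower (hc i j)]) (Finset.mem_univ k)
    rw [Finset.sum_sub_distrib] at h1
    linarith [hle1 i]
  have hlimc : ∀ k, ∃ y, Tendsto (fun i => c i k) ulf (𝓝 y) := fun k => by
    refine exists_ulim (C := max (-m) B) (Eventually.of_forall fun i => ?_)
    rw [Real.norm_eq_abs, abs_le']
    exact ⟨(hcB i k).trans (le_max_right _ _),
      (neg_le_neg (h.lower (hc i k))).trans (le_max_left _ _)⟩
  have hlimx : ∀ k, ∃ y, Tendsto (fun i => x i k) ulf (𝓝 y) := fun k => by
    refine exists_ulim (C := max ((B + K) / 2) ((B + K) / 2 + g (k - 1)))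
      (Eventually.of_forall fun i => ?_)
    have h1 := h.coer_left (hc i k)
    have h2 := h.coer_right (hc i (k - 1))
    rw [sub_add_cancel] at h2
    have h3 := hcB i k
    have h4 := hcB i (k - 1)
    rw [Real.norm_eq_abs, abs_le']
    exact ⟨le_max_of_le_left (by linarith), le_max_of_le_right (by linarith)⟩
  choose c₀ hc₀ using hlimc
  choose x₀ hx₀ using hlimx
  refine ⟨x₀, c₀, fun k => h.closed (fun i => hc i k) (hx₀ k) ((hx₀ (k + 1)).add_const _) (hc₀ k),
    fun x' c' hc' => ?_⟩
  have h1 : ∑ k, c₀ k ≤ sInf S := by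
    have t1 : Tendsto (fun i => ∑ k, c i k) ulf (𝓝 (∑ k, c₀ k)) :=
      tendsto_finsetSum _ fun k _ => hc₀ k
    have t2 : Tendsto (fun i : ℕ => sInf S + 1 / ((i : ℝ) + 1)) ulf (𝓝 (sInf S + 0)) :=
      (tendsto_one_div_add_atTop_nhds_zero_nat.const_add _).mono_left ulf_le_atTop
    rw [add_zero] at t2
    exact le_of_tendsto_of_tendsto' t1 t2 fun i => (hlt i).le
  exact h1.trans (csInf_le hbdd ⟨x', c', hc', rfl⟩)

/-- If the gaps are large, then there are periodic chains all of whose links are almost optimal,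
and which cannot be improved by moving a single junction. -/
lemma _root_.CostRel.exists_chain (h : CostRel Q K m) {η : ℝ} (hη : 0 < η) :
    ∃ W, ∀ (n : ℕ) [NeZero n] (_ : 2 ≤ n) (g : ZMod n → ℝ), (∀ k, W ≤ g k) →
      ∃ x c : ZMod n → ℝ, Chain Q g x c ∧ (∀ k, c k < cinf Q + 4 * η) ∧
        ∀ k v c₁ c₂, Q (x (k - 1)) (v + g (k - 1)) c₁ → Q v (x (k + 1) + g k) c₂ →
          c (k - 1) + c k ≤ c₁ + c₂ := by
  obtain ⟨u₀, u₀', c₀, h₀, hc₀⟩ := h.exists_lt hη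
  obtain ⟨R₁, hR₁⟩ := h.exists_reset_left hη (cinf Q + 5 * η)
  obtain ⟨R₂, hR₂⟩ := h.exists_reset_right hη (cinf Q + 5 * η)
  refine ⟨2 * max (max R₁ R₂) (max (-u₀) u₀'), fun n _ hn g hg => ?_⟩
  have hg1 : ∀ k, R₁ ≤ g k / 2 := fun k => by
    linarith [hg k, le_max_left R₁ R₂, le_max_left (max R₁ R₂) (max (-u₀) u₀')]
  have hg2 : ∀ k, R₂ ≤ g k / 2 := fun k => by
    linarith [hg k, le_max_right R₁ R₂, le_max_left (max R₁ R₂) (max (-u₀) u₀')]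
  have hg3 : ∀ k, -u₀ ≤ g k / 2 := fun k => by
    linarith [hg k, le_max_left (-u₀) u₀', le_max_right (max R₁ R₂) (max (-u₀) u₀')]
  have hg4 : ∀ k, u₀' ≤ g k / 2 := fun k => by
    linarith [hg k, le_max_right (-u₀) u₀', le_max_right (max R₁ R₂) (max (-u₀) u₀')]
  have hmid : ∀ k : ZMod n, Q (-(g (k - 1) / 2)) (-(g k / 2) + g k) c₀ := fun k =>
    h.mono h₀ (by linarith [hg3 (k - 1)]) (by linarith [hg4 k])
  obtain ⟨x, c, hc, hmin⟩ := h.exists_minimizer (g := g) ⟨fun k => -(g (k - 1) / 2), fun _ => c₀,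
    fun k => by
      show Q _ (-(g (k + 1 - 1) / 2) + g k) c₀
      rw [add_sub_cancel_right]
      exact hmid k⟩
  refine ⟨x, c, hc, ?_, fun k v c₁ c₂ h1 h2 => ?_⟩
  · by_contra! hbad
    obtain ⟨k₀, hk₀⟩ := hbad
    classical
    set bad : ZMod n → Prop := fun k => cinf Q + 4 * η ≤ c k with hbd
    set b : ZMod n → ℝ := fun k => if bad k then 1 else 0 with hb
    have hb0 : ∀ k, 0 ≤ b k := fun k => by simp only [hb]; split_ifs <;> norm_num
    set x' : ZMod n → ℝ := fun k => if bad (k - 1) ∨ bad k then -(g (k - 1) / 2) else x k with hx'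
    have hstep : ∀ k, ∃ c', Q (x' k) (x' (k + 1) + g k) c' ∧
        c' ≤ c k - 3 * η * b k + η * b (k - 1) + η * b (k + 1) := fun k => by
      have e1 := mul_nonneg hη.le (hb0 (k - 1))
      have e2 := mul_nonneg hη.le (hb0 (k + 1))
      by_cases hk : bad k
      · have hbk : b k = 1 := if_pos hk
        refine ⟨c₀, ?_, ?_⟩
        · have h1 : x' k = -(g (k - 1) / 2) := if_pos (Or.inr hk)
          have h2 : x' (k + 1) = -(g k / 2) := by
            simp only [hx', add_sub_cancel_right]
            exact if_pos (Or.inl hk)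
          rw [h1, h2]
          exact hmid k
        · rw [hbk]
          have : cinf Q + 4 * η ≤ c k := hk
          linarith
      · have hbk : b k = 0 := if_neg hk
        have hck : c k < cinf Q + 4 * η := not_le.1 hk
        obtain ⟨c1, hc1, hq1⟩ : ∃ c1 ≤ c k + η * b (k - 1), Q (x' k) (x (k + 1) + g k) c1 := by
          by_cases hk1 : bad (k - 1)
          · have : b (k - 1) = 1 := if_pos hk1
            have h1 : x' k = -(g (k - 1) / 2) := if_pos (Or.inl hk1)
            rw [this, h1, mul_one]
            exact hR₁ _ _ _ (hc k) (by linarith) _ (hg1 (k - 1))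
          · have h1 : x' k = x k := if_neg (by tauto)
            rw [h1]
            exact ⟨c k, by linarith, hc k⟩
        have hb1 : b (k - 1) ≤ 1 := by simp only [hb]; split_ifs <;> norm_num
        have hb1' : η * b (k - 1) ≤ η * 1 := mul_le_mul_of_nonneg_left hb1 hη.le
        obtain ⟨c2, hc2, hq2⟩ : ∃ c2 ≤ c1 + η * b (k + 1), Q (x' k) (x' (k + 1) + g k) c2 := by
          by_cases hk1 : bad (k + 1)
          · have : b (k + 1) = 1 := if_pos hk1
            have h1 : x' (k + 1) + g k = g k / 2 := by
              have : x' (k + 1) = -(g k / 2) := by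
                simp only [hx', add_sub_cancel_right]
                exact if_pos (Or.inr hk1)
              rw [this]; ring
            rw [this, h1, mul_one]
            exact hR₂ _ _ _ hq1 (by linarith) _ (hg2 k)
          · have h1 : x' (k + 1) = x (k + 1) := by
              simp only [hx', add_sub_cancel_right]
              exact if_neg (by tauto)
            rw [h1]
            exact ⟨c1, by linarith, hq1⟩
        exact ⟨c2, hq2, by rw [hbk]; linarith⟩
    choose c' hc' hle using hstep
    have h1 := hmin x' c' hc'
    have h2 : ∑ k, c' k ≤ ∑ k, (c k - 3 * η * b k + η * b (k - 1) + η * b (k + 1)) :=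
      Finset.sum_le_sum fun k _ => hle k
    rw [Finset.sum_add_distrib, Finset.sum_add_distrib, Finset.sum_sub_distrib,
      ← Finset.mul_sum, ← Finset.mul_sum, ← Finset.mul_sum] at h2
    have s1 : ∑ i, b (i - 1) = ∑ i, b i := (Equiv.subRight (1 : ZMod n)).sum_comp b
    have s2 : ∑ i, b (i + 1) = ∑ i, b i := Fintype.sum_equiv (Equiv.addRight 1) _ _ fun _ => rfl
    rw [s1, s2] at h2
    have h3 : 1 ≤ ∑ k, b k := by
      have : b k₀ = 1 := if_pos hk₀
      rw [← this]
      exact Finset.single_le_sum (fun k _ => hb0 k) (Finset.mem_univ k₀)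
    nlinarith
  · have : Fact (1 < n) := ⟨hn⟩
    have hne : k - 1 ≠ k := fun he => one_ne_zero (sub_eq_self.1 he)
    have hne' : k + 1 ≠ k := fun he => one_ne_zero (add_eq_left.1 he)
    set x' := Function.update x k v with hx'
    set c' := Function.update (Function.update c (k - 1) c₁) k c₂ with hc'
    have hch : Chain Q g x' c' := fun j => by
      by_cases hj : j = k
      · subst hj
        simpa [hx', hc', Function.update_of_ne hne'] using h2
      by_cases hj1 : j = k - 1
      · subst hj1
        have e1 : x' (k - 1) = x (k - 1) := Function.update_of_ne hne _ _
        have e2 : x' (k - 1 + 1) = v := by rw [sub_add_cancel]; exact Function.update_self _ _ _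
        have e3 : c' (k - 1) = c₁ := by
          simp only [hc']
          rw [Function.update_of_ne hne, Function.update_self]
        rw [e1, e2, e3]
        exact h1
      · have e1 : x' j = x j := Function.update_of_ne hj _ _
        have e2 : x' (j + 1) = x (j + 1) :=
          Function.update_of_ne (fun he => hj1 (eq_sub_of_add_eq he)) _ _
        have e3 : c' j = c j := by
          simp only [hc']
          rw [Function.update_of_ne hj, Function.update_of_ne hj1]
        rw [e1, e2, e3]
        exact hc j
    have h3 := hmin x' c' hch
    have h4 : ∑ j, (c' j - c j) = (c₁ - c (k - 1)) + (c₂ - c k) := by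
      rw [Fintype.sum_eq_add (k - 1) k hne]
      · simp only [hc']
        rw [Function.update_of_ne hne, Function.update_self, Function.update_self]
      · rintro j ⟨hj1, hj⟩
        simp only [hc']
        rw [Function.update_of_ne hj, Function.update_of_ne hj1, sub_self]
    rw [Finset.sum_sub_distrib] at h4
    linarith

end Chain

end CostRel

lemma Ioo_of_sin_neg {x : ℝ} (h : Real.sin x < 0) (h1 : -(3 * Real.pi / 2) < x)
    (h2 : x < Real.pi / 2) : x ∈ Ioo (-Real.pi) 0 := by
  have hpi := Real.pi_pos
  constructor
  · by_contra! h3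
    have := Real.sin_nonneg_of_nonneg_of_le_pi (x := x + 2 * Real.pi) (by linarith) (by linarith)
    rw [Real.sin_add_two_pi] at this
    linarith
  · by_contra! h3
    linarith [Real.sin_nonneg_of_nonneg_of_le_pi h3 (by linarith)]

lemma Ioo_of_sin_pos {x : ℝ} (j : ℤ) (h : 0 < Real.sin x)
    (h1 : 2 * Real.pi * j - Real.pi / 2 < x) (h2 : x < 2 * Real.pi * j + 3 * Real.pi / 2) :
    x ∈ Ioo (2 * Real.pi * j) (2 * Real.pi * j + Real.pi) := by
  have h3 : Real.sin (-(x - 2 * Real.pi * j)) < 0 := by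
    rw [Real.sin_neg, mul_comm, Real.sin_sub_int_mul_two_pi]; linarith
  have := Ioo_of_sin_neg h3 (by linarith) (by linarith)
  exact ⟨by linarith [this.2], by linarith [this.1]⟩

lemma Ioo_of_sin_neg_of_mem {S : Set ℝ} (hS : IsPreconnected S) {θ : ℝ → ℝ} (hθ : Continuous θ)
    (h : ∀ t ∈ S, Real.sin (θ t) < 0) {t₀ : ℝ} (ht₀ : t₀ ∈ S) (h₀ : θ t₀ ∈ Ioo (-Real.pi) 0)
    {t : ℝ} (ht : t ∈ S) : θ t ∈ Ioo (-Real.pi) 0 := by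
  have hpi := Real.pi_pos
  obtain ⟨i, hi⟩ := exists_branch hS hθ.continuousOn (-(Real.pi / 2)) fun t ht => by
    rw [sub_neg_eq_add, Real.cos_add_pi_div_two]; linarith [h t ht]
  have h1 := abs_lt.1 (hi t₀ ht₀)
  have hi0 : i = 0 := int_eq_of_lt (by push_cast; linarith [h₀.2]) (by push_cast; linarith [h₀.1])
  subst hi0
  have h2 := abs_lt.1 (hi t ht)
  push_cast at h2
  exact ⟨by linarith, by linarith⟩

lemma Ioo_of_sin_pos_of_mem {S : Set ℝ} (hS : IsPreconnected S) {θ : ℝ → ℝ} (hθ : Continuous θ)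
    {j : ℤ} (h : ∀ t ∈ S, 0 < Real.sin (θ t)) {t₀ : ℝ} (ht₀ : t₀ ∈ S)
    (h₀ : θ t₀ ∈ Ioo (2 * Real.pi * j) (2 * Real.pi * j + Real.pi))
    {t : ℝ} (ht : t ∈ S) : θ t ∈ Ioo (2 * Real.pi * j) (2 * Real.pi * j + Real.pi) := by
  have hs : ∀ x : ℝ, Real.sin (-(x - 2 * Real.pi * j)) = - Real.sin x := fun x => by
    rw [Real.sin_neg, mul_comm, Real.sin_sub_int_mul_two_pi]
  have := Ioo_of_sin_neg_of_mem hS (θ := fun t => -(θ t - 2 * Real.pi * j)) (by fun_prop)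
    (fun t ht => by rw [hs]; linarith [h t ht]) ht₀ ⟨by linarith [h₀.2], by linarith [h₀.1]⟩ ht
  exact ⟨by linarith [this.2], by linarith [this.1]⟩

/-- The curve `γ`, which comes from below and ends above `p` with respect to the direction `w`,
turns around `p` in the class `j`; the class `0` is to pass on the right of `p` and the class `-1`
is to pass on the left of `p`. -/
def Cls (w p : ℝ × ℝ) (γ : ℝ → ℝ × ℝ) (j : ℤ) : Prop :=
  ∃ θ : ℝ → ℝ, Continuous θ ∧ (∀ t, Polar w (γ t - p) (θ t)) ∧
    (∀ᶠ t in atBot, θ t ∈ Ioo (-Real.pi) 0) ∧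
    ∀ᶠ t in atTop, θ t ∈ Ioo (2 * Real.pi * j) (2 * Real.pi * j + Real.pi)

namespace Cls

variable {w p : ℝ × ℝ} {γ γ' : ℝ → ℝ × ℝ} {i j : ℤ}

lemma add_right (h : Cls w p γ j) (v : ℝ × ℝ) : Cls w (p + v) (fun t => γ t + v) j := by
  obtain ⟨θ, hθ, hp, h1, h2⟩ := h
  exact ⟨θ, hθ, fun t => by rw [add_sub_add_right_eq_sub]; exact hp t, h1, h2⟩

lemma transfer (hw : w ≠ 0) (h : Cls w p γ j) (hγ : Continuous γ') {a b s : ℝ} (hab : a ≤ b)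
    (hcl : ∀ t ∈ Icc a b, 2 * ‖γ (t - s) - γ' t‖ < ‖γ (t - s) - p‖)
    (h1 : ∀ t ≤ a, zt w (γ (t - s) - p) < 0) (h1' : ∀ t ≤ a, zt w (γ' t - p) < 0)
    (h2 : ∀ t, b ≤ t → 0 < zt w (γ (t - s) - p)) (h2' : ∀ t, b ≤ t → 0 < zt w (γ' t - p)) :
    Cls w p γ' j := by
  obtain ⟨θ, hθ, hp, hb, ht⟩ := h
  have hdot : ∀ t ∈ Icc a b, 0 < (γ' t - p).1 * (γ (t - s) - p).1 +
      (γ' t - p).2 * (γ (t - s) - p).2 := fun t ht => by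
    have := dot_pos_of_norm_lt (x := γ (t - s) - p) (y := γ' t - p)
      (by rw [sub_sub_sub_cancel_right]; exact hcl t ht)
    linarith
  have hne : ∀ t, γ' t - p ≠ 0 := fun t h0 => by
    rcases le_total t a with hta | hta
    · have := h1' t hta; rw [h0] at this; simp [crossDet] at this
    rcases le_total b t with htb | htb
    · have := h2' t htb; rw [h0] at this; simp [crossDet] at this
    have := hdot t ⟨hta, htb⟩
    rw [h0] at this; simp at this
  obtain ⟨φ, hφ, hφp⟩ := exists_lift hw (hγ.sub continuous_const) hne
  obtain ⟨i, hi⟩ := exists_branch (isPreconnected_Icc (a := a) (b := b))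
    (θ := fun t => φ t - θ (t - s)) (by fun_prop) 0 fun t ht => by
      rw [sub_zero]; exact (hφp t).cos_sub_pos hw (hp _) (hdot t ht)
  have hψp : ∀ t, Polar w (γ' t - p) (φ t - 2 * Real.pi * i) := fun t => by
    have := (hφp t).add_int (-i)
    push_cast at this
    rwa [mul_neg, ← sub_eq_add_neg] at this
  have hψ : Continuous fun t => φ t - 2 * Real.pi * i := by fun_prop
  have hθs : Continuous fun t => θ (t - s) := by fun_prop
  refine ⟨fun t => φ t - 2 * Real.pi * i, hψ, hψp, ?_, ?_⟩
  · obtain ⟨T, hT⟩ := (hb.and (eventually_le_atBot (a - s))).exists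
    have e1 : θ (a - s) ∈ Ioo (-Real.pi) 0 :=
      Ioo_of_sin_neg_of_mem (isPreconnected_Iic (a := a)) hθs
        (fun t ht => ((hp _).zt_neg).1 (h1 t ht)) (t₀ := T + s) (by simp; linarith [hT.2])
        (by simpa using hT.1) self_mem_Iic
    have e2 := abs_lt.1 (hi a (left_mem_Icc.2 hab))
    have e3 := Ioo_of_sin_neg (((hψp a).zt_neg).1 (h1' a le_rfl)) (by linarith [e1.1, e2.1])
      (by linarith [e1.2, e2.2])
    filter_upwards [eventually_le_atBot a] with t hta
    exact Ioo_of_sin_neg_of_mem (isPreconnected_Iic (a := a)) hψ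
      (fun t ht => ((hψp t).zt_neg).1 (h1' t ht)) self_mem_Iic e3 hta
  · obtain ⟨T, hT⟩ := (ht.and (eventually_ge_atTop (b - s))).exists
    have e1 : θ (b - s) ∈ Ioo (2 * Real.pi * j) (2 * Real.pi * j + Real.pi) :=
      Ioo_of_sin_pos_of_mem (isPreconnected_Ici (a := b)) hθs
        (fun t ht => ((hp _).zt_pos).1 (h2 t ht)) (t₀ := T + s) (by simp; linarith [hT.2])
        (by simpa using hT.1) self_mem_Ici
    have e2 := abs_lt.1 (hi b (right_mem_Icc.2 hab))
    have e3 := Ioo_of_sin_pos j (((hψp b).zt_pos).1 (h2' b le_rfl)) (by linarith [e1.1, e2.1])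
      (by linarith [e1.2, e2.2])
    filter_upwards [eventually_ge_atTop b] with t hta
    exact Ioo_of_sin_pos_of_mem (isPreconnected_Ici (a := b)) hψ
      (fun t ht => ((hψp t).zt_pos).1 (h2' t ht)) self_mem_Ici e3 hta

lemma unique (h : Cls w p γ i) (h' : Cls w p γ j) : i = j := by
  obtain ⟨θ, hθ, hp, hb, ht⟩ := h
  obtain ⟨θ', hθ', hp', hb', ht'⟩ := h'
  have hpi := Real.pi_pos
  obtain ⟨n, hn⟩ := exists_branch (isPreconnected_univ) (θ := fun t => θ t - θ' t) (by fun_prop) 0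
    fun t _ => by
      obtain ⟨l, hl⟩ := (hp t).exists_int (hp' t)
      rw [hl, sub_zero, add_sub_cancel_left, mul_comm, Real.cos_int_mul_two_pi]
      exact one_pos
  obtain ⟨T, h1, h2⟩ := (hb.and hb').exists
  obtain ⟨T', h3, h4⟩ := (ht.and ht').exists
  have e1 := abs_lt.1 (hn T (mem_univ _))
  have hn0 : n = 0 := int_eq_of_lt (by push_cast; linarith [h1.2, h2.1])
    (by push_cast; linarith [h1.1, h2.2])
  subst hn0
  have e2 := abs_lt.1 (hn T' (mem_univ _))
  push_cast at e2
  exact int_eq_of_lt (by linarith [h3.1, h4.2]) (by linarith [h3.2, h4.1])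

lemma exists_right (h : Cls w p γ 0) : ∃ t, zt w (γ t - p) = 0 ∧ 0 < xi w (γ t - p) := by
  obtain ⟨θ, hθ, hp, hb, ht⟩ := h
  obtain ⟨a, ha⟩ := hb.exists
  obtain ⟨b, hb⟩ := ht.exists
  obtain ⟨t, ht⟩ := mem_range_of_exists_le_of_exists_ge hθ ⟨a, ha.2.le⟩
    ⟨b, by have := hb.1; push_cast at this; linarith⟩
  obtain ⟨r, hr, h1, h2⟩ := hp t
  rw [ht, Real.cos_zero] at h1
  rw [ht, Real.sin_zero] at h2
  exact ⟨t, by linarith, by linarith⟩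

lemma exists_left (h : Cls w p γ (-1)) : ∃ t, zt w (γ t - p) = 0 ∧ xi w (γ t - p) < 0 := by
  obtain ⟨θ, hθ, hp, hb, ht⟩ := h
  obtain ⟨a, ha⟩ := hb.exists
  obtain ⟨b, hb⟩ := ht.exists
  obtain ⟨t, ht⟩ := mem_range_of_exists_le_of_exists_ge hθ (c := -Real.pi)
    ⟨b, by have := hb.2; push_cast at this; linarith⟩ ⟨a, ha.1.le⟩
  obtain ⟨r, hr, h1, h2⟩ := hp t
  rw [ht, Real.cos_neg, Real.cos_pi] at h1
  rw [ht, Real.sin_neg, Real.sin_pi] at h2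
  exact ⟨t, by linarith, by linarith⟩

lemma of_xi_pos (hw : w ≠ 0) (hγ : Continuous γ) (hx : ∀ t, 0 < xi w (γ t - p))
    (hb : ∀ᶠ t in atBot, zt w (γ t - p) < 0) (ht : ∀ᶠ t in atTop, 0 < zt w (γ t - p)) :
    Cls w p γ 0 := by
  have hpi := Real.pi_pos
  obtain ⟨φ, hφ, hφp⟩ := exists_lift hw (f := fun t => γ t - p) (by fun_prop) fun t h0 => by
    have := hx t; simp only [h0] at this; simp [xi] at this
  obtain ⟨i, hi⟩ := exists_branch isPreconnected_univ hφ.continuousOn 0 fun t _ => by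
    rw [sub_zero]; exact ((hφp t).xi_pos).1 (hx t)
  have hψp : ∀ t, Polar w (γ t - p) (φ t - 2 * Real.pi * i) := fun t => by
    have := (hφp t).add_int (-i)
    push_cast at this
    rwa [mul_neg, ← sub_eq_add_neg] at this
  refine ⟨fun t => φ t - 2 * Real.pi * i, by fun_prop, hψp, ?_, ?_⟩
  · filter_upwards [hb] with t h
    have := abs_lt.1 (hi t (mem_univ _))
    exact Ioo_of_sin_neg (((hψp t).zt_neg).1 h) (by linarith) (by linarith)
  · filter_upwards [ht] with t h
    have := abs_lt.1 (hi t (mem_univ _))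
    exact Ioo_of_sin_pos 0 (((hψp t).zt_pos).1 h) (by push_cast; linarith)
      (by push_cast; linarith)

lemma of_xi_neg (hw : w ≠ 0) (hγ : Continuous γ) (hx : ∀ t, xi w (γ t - p) < 0)
    (hb : ∀ᶠ t in atBot, zt w (γ t - p) < 0) (ht : ∀ᶠ t in atTop, 0 < zt w (γ t - p)) :
    Cls w p γ (-1) := by
  have hpi := Real.pi_pos
  obtain ⟨φ, hφ, hφp⟩ := exists_lift hw (f := fun t => γ t - p) (by fun_prop) fun t h0 => by
    have := hx t; simp only [h0] at this; simp [xi] at this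
  obtain ⟨i, hi⟩ := exists_branch isPreconnected_univ hφ.continuousOn (-Real.pi) fun t _ => by
    rw [sub_neg_eq_add, Real.cos_add_pi]; linarith [((hφp t).xi_neg).1 (hx t)]
  have hψp : ∀ t, Polar w (γ t - p) (φ t - 2 * Real.pi * i) := fun t => by
    have := (hφp t).add_int (-i)
    push_cast at this
    rwa [mul_neg, ← sub_eq_add_neg] at this
  refine ⟨fun t => φ t - 2 * Real.pi * i, by fun_prop, hψp, ?_, ?_⟩
  · filter_upwards [hb] with t h
    have := abs_lt.1 (hi t (mem_univ _))
    exact Ioo_of_sin_neg (((hψp t).zt_neg).1 h) (by linarith) (by linarith)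
  · filter_upwards [ht] with t h
    have := abs_lt.1 (hi t (mem_univ _))
    exact Ioo_of_sin_pos (-1) (((hψp t).zt_pos).1 h) (by push_cast; linarith)
      (by push_cast; linarith)

end Cls

namespace TorusMetric

variable {M : TorusMetric}

lemma PerLine.bu_add_zsmul {k : ℤ × ℤ} {ℓ : ℝ} {α : ℝ → ℝ × ℝ} (h : M.PerLine k ℓ α)
    (x : ℝ × ℝ) (j : ℤ) : M.bu α (x + (j : ℝ) • lat k) = M.bu α x + j * ℓ := by
  induction j using Int.induction_on with
  | zero => simp
  | succ n ih =>
    push_cast at ih ⊢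
    rw [add_smul, one_smul, ← add_assoc, h.bu_add, ih]; ring
  | pred n ih =>
    have := h.bu_add (x + ((-n - 1 : ℤ) : ℝ) • lat k)
    push_cast at ih this ⊢
    rw [show x + (-(n : ℝ) - 1) • lat k + lat k = x + (-(n : ℝ)) • lat k by
      rw [sub_smul, one_smul]; abel, ih] at this
    linarith

lemma _root_.lat_neg (k : ℤ × ℤ) : lat (-k) = -lat k := by
  simp [lat]

lemma PerLine.neg {k : ℤ × ℤ} {ℓ : ℝ} {α : ℝ → ℝ × ℝ} (h : M.PerLine k ℓ α) :
    M.PerLine (-k) ℓ fun t => α (-t) :=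
  ⟨h.pos, h.line.neg, fun u => by
    have := h.per (-(u + ℓ))
    rw [neg_add, neg_add_cancel_right] at this
    simp only [neg_add, lat_neg]
    rw [this, add_neg_cancel_right]⟩

lemma PerLine.au_add_zsmul {k : ℤ × ℤ} {ℓ : ℝ} {α : ℝ → ℝ × ℝ} (h : M.PerLine k ℓ α)
    (x : ℝ × ℝ) (j : ℤ) : M.au α (x + (j : ℝ) • lat k) = M.au α x - j * ℓ := by
  have := h.neg.bu_add_zsmul x (-j)
  rw [lat_neg] at this
  push_cast at this
  rw [smul_neg, neg_smul, neg_neg] at this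
  rw [au, au, this]; ring

lemma PerLine.add_zsmul {k : ℤ × ℤ} {ℓ : ℝ} {α : ℝ → ℝ × ℝ} (h : M.PerLine k ℓ α)
    (u : ℝ) (j : ℤ) : α (u + j * ℓ) = α u + (j : ℝ) • lat k := by
  induction j using Int.induction_on with
  | zero => simp
  | succ n ih =>
    push_cast at ih ⊢
    rw [add_smul, one_smul, ← add_assoc, ← ih, ← h.per]; congr 1; ring
  | pred n ih =>
    have := h.per (u + (-n - 1 : ℤ) * ℓ)
    push_cast at ih this ⊢
    rw [show u + (-(n : ℝ) - 1) * ℓ + ℓ = u + (-(n : ℝ)) * ℓ by ring, ih] at this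
    rw [sub_smul, one_smul, ← add_sub_assoc, this, add_sub_cancel_right]

lemma PerLine.exists_ray_bound {k : ℤ × ℤ} {ℓ : ℝ} {α : ℝ → ℝ × ℝ} (h : M.PerLine k ℓ α)
    (p : ℝ × ℝ) : ∃ K, ∀ a : ℝ, 0 ≤ a → ∀ u, -K ≤ u + M.dist (α u) (p + a • lat k) := by
  refine ⟨M.hi * (‖α 0 - p‖ + ‖lat k‖), fun a ha u => ?_⟩
  set j : ℤ := ⌊a⌋
  have hj : 0 ≤ j := Int.floor_nonneg.2 ha
  have hjr : (0 : ℝ) ≤ j := by exact_mod_cast hj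
  set y := p + Int.fract a • lat k
  have e1 : p + a • lat k = y + lat (j • k) := by
    have : lat (j • k) = (j : ℝ) • lat k := by simp [lat]
    rw [this, add_assoc, ← add_smul, add_comm (Int.fract a), Int.floor_add_fract]
  have e2 : α u = α (u - j * ℓ) + lat (j • k) := by
    have : lat (j • k) = (j : ℝ) • lat k := by simp [lat]
    rw [this, ← h.add_zsmul, sub_add_cancel]
  rw [e1, e2, M.dist_add_lat]
  have h1 := M.dist_triangle (α (u - j * ℓ)) y (α 0)
  rw [h.line, sub_zero, M.dist_comm y] at h1
  have h2 := M.dist_le_hi (α 0) y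
  have h3 : ‖α 0 - y‖ ≤ ‖α 0 - p‖ + ‖lat k‖ := by
    rw [← sub_sub]
    refine (norm_sub_le _ _).trans (add_le_add_right ?_ _)
    rw [norm_smul, Real.norm_of_nonneg (Int.fract_nonneg a)]
    exact mul_le_of_le_one_left (norm_nonneg _) (Int.fract_lt_one a).le
  have h4 := mul_le_mul_of_nonneg_left h3 M.hi_pos.le
  have h5 := neg_abs_le (u - j * ℓ)
  have h6 := mul_nonneg hjr h.pos.le
  linarith

/-- Global version of `LipOn`. -/
def Lip (M : TorusMetric) (γ : ℝ → ℝ × ℝ) : Prop := ∀ s t, M.dist (γ s) (γ t) ≤ |s - t|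

namespace Lip

variable {γ γ' : ℝ → ℝ × ℝ}

lemma of_lipOn (h : ∀ a b, M.LipOn γ a b) : M.Lip γ := fun s t =>
  h (min s t) (max s t) s ⟨min_le_left _ _, le_max_left _ _⟩ t ⟨min_le_right _ _, le_max_right _ _⟩

lemma lipOn (h : M.Lip γ) (a b : ℝ) : M.LipOn γ a b := fun s _ t _ => h s t

lemma join (h : M.Lip γ) (h' : M.Lip γ') {c : ℝ} (hc : γ c = γ' c) : M.Lip (join γ γ' c) :=
  of_lipOn fun a b => (h.lipOn a c).join (h'.lipOn c b) hc

lemma continuous (h : M.Lip γ) : Continuous γ := by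
  rw [continuous_iff_continuousAt]
  intro t
  exact (h.lipOn (t - 1) (t + 1)).continuousOn.continuousAt
    (Icc_mem_nhds (by linarith) (by linarith))

lemma comp {f : ℝ → ℝ} (h : M.Lip γ) (hf : ∀ s t, |f s - f t| ≤ |s - t|) :
    M.Lip fun t => γ (f t) := fun s t => (h _ _).trans (hf s t)

lemma comp_sub (h : M.Lip γ) (a : ℝ) : M.Lip fun t => γ (t - a) :=
  h.comp fun s t => by rw [sub_sub_sub_cancel_right]

lemma add_lat (h : M.Lip γ) (k : ℤ × ℤ) : M.Lip fun t => γ t + lat k := fun s t => by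
  rw [M.dist_add_lat]; exact h s t

end Lip

lemma IsLine.lip {α : ℝ → ℝ × ℝ} (h : M.IsLine α) : M.Lip α := fun s t => (h s t).le

/-- A strip between the minimal axes `α` and `α + lat s` of `lat k`, and a ball in this strip at
the points of which a connection from `α` to `α + lat s` is not optimal. -/
structure Conf (M : TorusMetric) where
  k : ℤ × ℤ
  s : ℤ × ℤ
  ℓ : ℝ
  C : ℝ
  r : ℝ
  δ : ℝ
  α : ℝ → ℝ × ℝ
  p : ℝ × ℝ
  per : M.PerLine k ℓ α
  bound : ∀ u, |zt (lat k) (α u)| ≤ C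
  gap : 2 * C < zt (lat k) (lat s)
  r_pos : 0 < r
  δ_pos : 0 < δ
  low : ∀ x, ‖x - p‖ < 2 * r → C < zt (lat k) x ∧ zt (lat k) x < zt (lat k) (lat s) - C
  cost : ∀ x, ‖x - p‖ < 2 * r →
    M.mm α (fun u => α u + lat s) + δ ≤ M.bu α x + M.au (fun u => α u + lat s) x

namespace Conf

variable (X : Conf M)

/-- The second axis. -/
def β (u : ℝ) : ℝ × ℝ := X.α u + lat X.s
/-- The strip between the axes. -/
def S : Set (ℝ × ℝ) := strip (lat X.k) X.C (range X.α) (lat X.s)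
/-- The translates of the centre of the ball. -/
def pt (j : ℤ) : ℝ × ℝ := X.p + (j : ℝ) • lat X.k

lemma perβ : M.PerLine X.k X.ℓ X.β := X.per.add_lat X.s

lemma w_ne : lat X.k ≠ 0 := X.per.lat_ne_zero

lemma dist_αβ (u : ℝ) : M.dist (X.α u) (X.β u) ≤ M.hi * ‖lat X.s‖ := by
  refine (M.dist_le_hi _ _).trans (le_of_eq ?_)
  rw [β, sub_add_cancel_left, norm_neg]

lemma α_mem (u : ℝ) : X.α u ∈ X.S := X.per.mem_strip X.bound X.gap u
lemma β_mem (u : ℝ) : X.β u ∈ X.S := add_mem_strip X.bound X.gap u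

lemma zt_pt (j : ℤ) : zt (lat X.k) (X.pt j) = zt (lat X.k) X.p := by
  rw [pt, zt_add, zt_smul, zt_self]; ring

lemma far {x : ℝ × ℝ} {j : ℤ} (hx : ‖x - X.pt j‖ < 2 * X.r) :
    X.C < zt (lat X.k) x ∧ zt (lat X.k) x < zt (lat X.k) (lat X.s) - X.C ∧
      M.mm X.α X.β + X.δ ≤ M.bu X.α x + M.au X.β x := by
  have e : x = (x - (j : ℝ) • lat X.k) + (j : ℝ) • lat X.k := by abel
  set y := x - (j : ℝ) • lat X.k with hy
  have h0 : ‖y - X.p‖ < 2 * X.r := by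
    rwa [hy, sub_sub, add_comm _ X.p]
  have h1 := X.low y h0
  have h2 := X.cost y h0
  have e1 : zt (lat X.k) x = zt (lat X.k) y := by
    rw [e, zt_add, zt_smul, zt_self]; ring
  rw [e1]
  refine ⟨h1.1, h1.2, ?_⟩
  rw [e, X.per.bu_add_zsmul, X.perβ.au_add_zsmul]
  have : M.mm X.α X.β + X.δ ≤ M.bu X.α y + M.au X.β y := h2
  linarith

lemma zt_p : X.C < zt (lat X.k) X.p ∧ zt (lat X.k) X.p < zt (lat X.k) (lat X.s) - X.C :=
  X.low X.p (by rw [sub_self, norm_zero]; linarith [X.r_pos])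

lemma far_α (u : ℝ) (j : ℤ) : 2 * X.r ≤ ‖X.α u - X.pt j‖ := by
  by_contra! h
  linarith [(X.far h).1, (abs_le.1 (X.bound u)).2]

lemma far_β (u : ℝ) (j : ℤ) : 2 * X.r ≤ ‖X.β u - X.pt j‖ := by
  by_contra! h
  have := (X.far h).2.1
  rw [β, zt_add] at this
  linarith [(abs_le.1 (X.bound u)).1]

lemma zt_α (u : ℝ) (j : ℤ) : zt (lat X.k) (X.α u - X.pt j) < 0 := by
  rw [zt_sub, zt_pt]; linarith [X.zt_p.1, (abs_le.1 (X.bound u)).2]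

lemma zt_β (u : ℝ) (j : ℤ) : 0 < zt (lat X.k) (X.β u - X.pt j) := by
  rw [zt_sub, zt_pt, β, zt_add]; linarith [X.zt_p.2, (abs_le.1 (X.bound u)).1]

/-- A path of length `L` in the strip from the point `u` on the first axis to the point `v` on the
second axis. -/
structure Conn (u v L : ℝ) (γ : ℝ → ℝ × ℝ) : Prop where
  nonneg : 0 ≤ L
  lip : M.Lip γ
  left : ∀ t ≤ 0, γ t = X.α u
  right : ∀ t, L ≤ t → γ t = X.β v
  mem : ∀ t, γ t ∈ X.S

/-- The curve `γ` avoids the `i`-th ball and turns around it in the class `j`. -/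
def Av (γ : ℝ → ℝ × ℝ) (i j : ℤ) : Prop :=
  Cls (lat X.k) (X.pt i) γ j ∧ ∀ t, X.r ≤ ‖γ t - X.pt i‖

/-- The paths from one axis to the other which pass between the two balls. -/
structure Seg (J : ℤ) (u v L : ℝ) (γ : ℝ → ℝ × ℝ) : Prop extends Conn X u v L γ where
  av₀ : X.Av γ 0 0
  av₁ : X.Av γ J (-1)

variable {X} {u v L : ℝ} {γ γ' : ℝ → ℝ × ℝ} {i j J : ℤ}

namespace Conn

lemma dist_add_le (h : X.Conn u v L γ) (t : ℝ) :
    M.dist (X.α u) (γ t) + M.dist (γ t) (X.β v) ≤ L := by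
  rcases le_total t 0 with ht | ht
  · have := h.lip 0 L
    rw [zero_sub, abs_neg, abs_of_nonneg h.nonneg, h.left 0 le_rfl, h.right L le_rfl] at this
    rwa [h.left t ht, M.dist_self, zero_add]
  rcases le_total L t with hL | hL
  · have := h.lip 0 L
    rw [zero_sub, abs_neg, abs_of_nonneg h.nonneg, h.left 0 le_rfl, h.right L le_rfl] at this
    rwa [h.right t hL, M.dist_self, add_zero]
  have h1 := h.lip 0 t
  have h2 := h.lip t L
  rw [zero_sub, abs_neg, abs_of_nonneg ht, h.left 0 le_rfl] at h1
  rw [abs_sub_comm, abs_of_nonneg (by linarith), h.right L le_rfl] at h2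
  linarith

lemma zt_left (h : X.Conn u v L γ) (i : ℤ) {t : ℝ} (ht : t ≤ 0) :
    zt (lat X.k) (γ t - X.pt i) < 0 := by rw [h.left t ht]; exact X.zt_α u i

lemma zt_right (h : X.Conn u v L γ) (i : ℤ) {t : ℝ} (ht : L ≤ t) :
    0 < zt (lat X.k) (γ t - X.pt i) := by rw [h.right t ht]; exact X.zt_β v i

/-- A path of small cost stays away from the balls. -/
lemma two_mul_le (h : X.Conn u v L γ) (hc : L - (v - u) < M.mm X.α X.β + X.δ) (i : ℤ) (t : ℝ) :
    2 * X.r ≤ ‖γ t - X.pt i‖ := by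
  by_contra! hx
  have h1 := (X.far hx).2.2
  have h2 := h.dist_add_le t
  linarith [bu_le X.per.line u (γ t), au_le X.perβ.line v (γ t)]

lemma mm_le (h : X.Conn u v L γ) : M.mm X.α X.β ≤ L - (v - u) := by
  have h1 := h.dist_add_le 0
  rw [h.left 0 le_rfl, M.dist_self, zero_add] at h1
  linarith [mm_le_dist X.per.line X.perβ.line X.dist_αβ u v]

/-- Prolongation at the beginning along the first axis. -/
lemma precomp (h : X.Conn u v L γ) {σ : ℝ → ℝ × ℝ} (hσ : M.Lip σ) {a u' : ℝ} (ha : 0 ≤ a)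
    (h0 : ∀ t ≤ 0, σ t = X.α u') (h1 : σ a = X.α u) (hr : ∀ t, σ t ∈ range X.α) :
    X.Conn u' v (L + a) (join σ (fun t => γ (t - a)) a) ∧ ∀ i j, X.Av γ i j →
      X.Av (join σ (fun t => γ (t - a)) a) i j := by
  have hm : σ a = γ (a - a) := by rw [sub_self, h.left 0 le_rfl, h1]
  have hR : ∀ t, a ≤ t → join σ (fun t => γ (t - a)) a t = γ (t - a) := fun t ht =>
    join_right (z := fun t => γ (t - a)) hm ht
  have hlip : M.Lip (join σ (fun t => γ (t - a)) a) := hσ.join (h.lip.comp_sub a) hm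
  refine ⟨⟨by linarith [h.nonneg], hlip, fun t ht => ?_, fun t ht => ?_, fun t => ?_⟩,
    fun i j hav => ⟨?_, fun t => ?_⟩⟩
  · rw [join_left (ht.trans ha), h0 t ht]
  · rw [hR t (by linarith [h.nonneg]), h.right _ (by linarith)]
  · rcases le_total t a with hta | hta
    · rw [join_left hta]
      obtain ⟨x, hx⟩ := hr t
      rw [← hx]; exact X.α_mem x
    · rw [hR t hta]; exact h.mem _
  · refine hav.1.transfer X.w_ne hlip.continuous (a := a) (b := L + a) (s := a)
      (by linarith [h.nonneg]) (fun t ht => ?_) (fun t ht => h.zt_left i (by linarith))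
      (fun t ht => ?_) (fun t ht => h.zt_right i (by linarith)) (fun t ht => ?_)
    · rw [hR t ht.1, sub_self, norm_zero, mul_zero]
      exact X.r_pos.trans_le (hav.2 _)
    · rw [join_left ht]
      obtain ⟨x, hx⟩ := hr t
      rw [← hx]; exact X.zt_α x i
    · rw [hR t (by linarith [h.nonneg])]
      exact h.zt_right i (by linarith)
  · rcases le_total t a with hta | hta
    · rw [join_left hta]
      obtain ⟨x, hx⟩ := hr t
      rw [← hx]; linarith [X.far_α x i, X.r_pos]
    · rw [hR t hta]; exact hav.2 _

/-- Prolongation at the end along the second axis. -/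
lemma postcomp (h : X.Conn u v L γ) {σ : ℝ → ℝ × ℝ} (hσ : M.Lip σ) {a v' : ℝ} (ha : 0 ≤ a)
    (h0 : ∀ t, L + a ≤ t → σ t = X.β v') (h1 : σ L = X.β v) (hr : ∀ t, σ t ∈ range X.β) :
    X.Conn u v' (L + a) (join γ σ L) ∧ ∀ i j, X.Av γ i j → X.Av (join γ σ L) i j := by
  have hm : γ L = σ L := by rw [h.right L le_rfl, h1]
  have hR : ∀ t, L ≤ t → join γ σ L t = σ t := fun t ht => join_right hm ht
  have hlip : M.Lip (join γ σ L) := h.lip.join hσ hm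
  refine ⟨⟨by linarith [h.nonneg], hlip, fun t ht => ?_, fun t ht => ?_, fun t => ?_⟩,
    fun i j hav => ⟨?_, fun t => ?_⟩⟩
  · rw [join_left (ht.trans h.nonneg), h.left t ht]
  · rw [hR t (by linarith [h.nonneg]), h0 _ (by linarith)]
  · rcases le_total t L with hta | hta
    · rw [join_left hta]; exact h.mem _
    · rw [hR t hta]
      obtain ⟨x, hx⟩ := hr t
      rw [← hx]; exact X.β_mem x
  · refine hav.1.transfer X.w_ne hlip.continuous (a := 0) (b := L) (s := 0)
      h.nonneg (fun t ht => ?_) (fun t ht => h.zt_left i (by linarith))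
      (fun t ht => ?_) (fun t ht => h.zt_right i (by linarith)) (fun t ht => ?_)
    · rw [join_left ht.2, sub_zero, sub_self, norm_zero, mul_zero]
      exact X.r_pos.trans_le (hav.2 _)
    · rw [join_left (ht.trans h.nonneg)]; exact h.zt_left i ht
    · rw [hR t ht]
      obtain ⟨x, hx⟩ := hr t
      rw [← hx]; exact X.zt_β x i
  · rcases le_total t L with hta | hta
    · rw [join_left hta]; exact hav.2 _
    · rw [hR t hta]
      obtain ⟨x, hx⟩ := hr t
      rw [← hx]; linarith [X.far_β x i, X.r_pos]

/-- A path which is close to a path avoiding the balls is in the same class. -/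
lemma cls_of_close (h : X.Conn u v L γ) {u' v' L' : ℝ} (h' : X.Conn u' v' L' γ')
    (hcl : ∀ t, 2 * ‖γ t - γ' t‖ < ‖γ t - X.pt i‖) (hc : Cls (lat X.k) (X.pt i) γ j) :
    Cls (lat X.k) (X.pt i) γ' j := by
  refine hc.transfer X.w_ne h'.lip.continuous (a := 0) (b := max L L') (s := 0)
    (le_max_of_le_left h.nonneg) (fun t _ => by rw [sub_zero]; exact hcl t)
    (fun t ht => h.zt_left i (by linarith)) (fun t ht => h'.zt_left i ht)
    (fun t ht => h.zt_right i (by linarith [le_max_left L L']))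
    (fun t ht => h'.zt_right i ((le_max_right _ _).trans ht))

lemma av_of_close (h : X.Conn u v L γ) {u' v' L' : ℝ} (h' : X.Conn u' v' L' γ')
    (hc : L - (v - u) < M.mm X.α X.β + X.δ)
    (hcl : ∀ t, ‖γ t - γ' t‖ < X.r) (hav : X.Av γ i j) : X.Av γ' i j := by
  refine ⟨h.cls_of_close h' (fun t => ?_) hav.1, fun t => ?_⟩
  · linarith [hcl t, h.two_mul_le hc i t]
  · have h1 := norm_sub_le_norm_sub_add_norm_sub (γ t) (γ' t) (X.pt i)
    linarith [hcl t, h.two_mul_le hc i t]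

end Conn

end Conf

end TorusMetric

lemma eq_smul_of_zt_eq_zero {w x : ℝ × ℝ} (hw : w ≠ 0) (h : zt w x = 0) :
    x = (xi w x / xi w w) • w := by
  rw [← sub_eq_zero]
  refine eq_zero_of_xi_zt hw ?_ ?_
  · rw [xi_sub, xi_smul, div_mul_cancel₀ _ (xi_self_pos hw).ne', sub_self]
  · rw [zt_sub, zt_smul, zt_self, h]; ring

namespace TorusMetric

variable {M : TorusMetric}

lemma Lip.norm_sub_le {γ : ℝ → ℝ × ℝ} (h : M.Lip γ) (s t : ℝ) : ‖γ s - γ t‖ ≤ |s - t| / M.lo :=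
  norm_sub_le_of_dist (h s t)

lemma Lip.eventually_forall_norm_sub_lt {γ : ℕ → ℝ → ℝ × ℝ} {γ' : ℝ → ℝ × ℝ}
    (h : ∀ n, M.Lip (γ n)) (h' : M.Lip γ') (hl : ∀ t, Tendsto (fun n => γ n t) ulf (𝓝 (γ' t)))
    {a b ε : ℝ} (hε : 0 < ε) : ∀ᶠ n in ulf, ∀ t ∈ Icc a b, ‖γ n t - γ' t‖ < ε := by
  have hlo := M.lo_pos
  refine isCompact_Icc.induction_on (p := fun S => ∀ᶠ n in ulf, ∀ t ∈ S, ‖γ n t - γ' t‖ < ε)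
    (by simp) (fun S T hST hT => hT.mono fun n hn t ht => hn t (hST ht))
    (fun S T hS hT => by
      filter_upwards [hS, hT] with n h1 h2 t ht
      exact ht.elim (h1 t) (h2 t)) fun x _ => ?_
  refine ⟨Metric.ball x (ε / 3 * M.lo), mem_nhdsWithin_of_mem_nhds
    (Metric.ball_mem_nhds _ (by positivity)), ?_⟩
  have h1 := Metric.tendsto_nhds.1 (hl x) (ε / 3) (by positivity)
  filter_upwards [h1] with n hn t ht
  rw [dist_eq_norm] at hn
  rw [Metric.mem_ball, Real.dist_eq] at ht
  have e1 : |t - x| / M.lo < ε / 3 := (div_lt_iff₀ hlo).2 ht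
  have e2 := (h n).norm_sub_le t x
  have e3 := h'.norm_sub_le x t
  rw [abs_sub_comm] at e3
  have e4 := norm_sub_le_norm_sub_add_norm_sub (γ n t) (γ n x) (γ' t)
  have e5 := norm_sub_le_norm_sub_add_norm_sub (γ n x) (γ' x) (γ' t)
  linarith

namespace Conf

variable {X : Conf M} {u v L : ℝ} {γ γ' : ℝ → ℝ × ℝ} {i j J : ℤ}

variable (X J) in
/-- There is a path of cost `c` from `u` to `v`. -/
def Q (u v c : ℝ) : Prop := ∃ L γ, X.Seg J u v L γ ∧ c = L - (v - u)

lemma Q.mono_left {u v c u' : ℝ} (h : X.Q J u v c) (hu : u' ≤ u) : X.Q J u' v c := by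
  obtain ⟨L, γ, hγ, rfl⟩ := h
  obtain ⟨h1, h2⟩ := hγ.toConn.precomp (σ := fun t => X.α (u' + max t 0)) (a := u - u') (u' := u')
    (X.per.line.lip.comp fun s t => by
      rw [add_sub_add_left_eq_sub]; exact abs_max_sub_max_le_abs s t 0) (by linarith)
    (fun t ht => by rw [max_eq_right ht, add_zero])
    (by rw [max_eq_left (by linarith)]; congr 1; ring) fun t => mem_range_self _
  exact ⟨_, _, ⟨h1, h2 _ _ hγ.av₀, h2 _ _ hγ.av₁⟩, by ring⟩

lemma Q.mono_right {u v c v' : ℝ} (h : X.Q J u v c) (hv : v ≤ v') : X.Q J u v' c := by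
  obtain ⟨L, γ, hγ, rfl⟩ := h
  obtain ⟨h1, h2⟩ := hγ.toConn.postcomp (σ := fun t => X.β (v + min (t - L) (v' - v)))
    (a := v' - v) (v' := v')
    (X.perβ.line.lip.comp fun s t => by
      rw [add_sub_add_left_eq_sub]
      refine (abs_min_sub_min_le_max _ _ _ _).trans ?_
      rw [sub_sub_sub_cancel_right, sub_self, abs_zero, max_eq_left (abs_nonneg _)])
    (by linarith)
    (fun t ht => by rw [min_eq_right (by linarith)]; congr 1; ring)
    (by simp only [sub_self]; rw [min_eq_left (by linarith)]; congr 1; ring)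
    fun t => mem_range_self _
  exact ⟨_, _, ⟨h1, h2 _ _ hγ.av₀, h2 _ _ hγ.av₁⟩, by ring⟩

lemma Q.add_left {u v c s : ℝ} (h : X.Q J u v c) (hs : 0 ≤ s) : X.Q J (u + s) v (c + 2 * s) := by
  obtain ⟨L, γ, hγ, rfl⟩ := h
  obtain ⟨h1, h2⟩ := hγ.toConn.precomp (σ := fun t => X.α (u + s - max t 0)) (a := s)
    (u' := u + s)
    (X.per.line.lip.comp fun s t => by
      rw [sub_sub_sub_cancel_left, abs_sub_comm]; exact abs_max_sub_max_le_abs s t 0) hs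
    (fun t ht => by rw [max_eq_right ht, sub_zero])
    (by rw [max_eq_left hs]; congr 1; ring) fun t => mem_range_self _
  exact ⟨_, _, ⟨h1, h2 _ _ hγ.av₀, h2 _ _ hγ.av₁⟩, by ring⟩

lemma Q.sub_right {u v c s : ℝ} (h : X.Q J u v c) (hs : 0 ≤ s) : X.Q J u (v - s) (c + 2 * s) := by
  obtain ⟨L, γ, hγ, rfl⟩ := h
  obtain ⟨h1, h2⟩ := hγ.toConn.postcomp (σ := fun t => X.β (v - min (t - L) s))
    (a := s) (v' := v - s)
    (X.perβ.line.lip.comp fun x y => by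
      rw [sub_sub_sub_cancel_left, abs_sub_comm]
      refine (abs_min_sub_min_le_max _ _ _ _).trans ?_
      rw [sub_sub_sub_cancel_right, sub_self, abs_zero, max_eq_left (abs_nonneg _)])
    hs
    (fun t ht => by rw [min_eq_right (by linarith)])
    (by simp only [sub_self]; rw [min_eq_left hs]; congr 1; ring)
    fun t => mem_range_self _
  exact ⟨_, _, ⟨h1, h2 _ _ hγ.av₀, h2 _ _ hγ.av₁⟩, by ring⟩

variable (X) in
lemma exists_coer_right : ∃ K, ∀ J u v c, X.Q J u v c → -2 * v - K ≤ c := by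
  obtain ⟨K₁, h1⟩ := X.per.exists_ray_bound X.p
  obtain ⟨K₂, h2⟩ := X.perβ.exists_ray_bound X.p
  refine ⟨K₁ + K₂, ?_⟩
  rintro J u v _ ⟨L, γ, hγ, rfl⟩
  obtain ⟨t, ht1, ht2⟩ := hγ.av₀.1.exists_right
  have h0 : X.pt 0 = X.p := by simp [pt]
  rw [h0] at ht1 ht2
  have e := eq_smul_of_zt_eq_zero X.w_ne ht1
  have ha := (div_pos ht2 (xi_self_pos X.w_ne)).le
  set a := xi (lat X.k) (γ t - X.p) / xi (lat X.k) (lat X.k)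
  have e' : γ t = X.p + a • lat X.k := by rw [← e]; abel
  have e1 := h1 a ha u
  have e2 := h2 a ha v
  rw [← e'] at e1 e2
  have e3 := hγ.toConn.dist_add_le t
  rw [M.dist_comm (γ t)] at e3
  linarith

variable (X J) in
lemma exists_coer_left : ∃ K, ∀ u v c, X.Q J u v c → 2 * u - K ≤ c := by
  obtain ⟨K₁, h1⟩ := X.per.neg.exists_ray_bound (X.pt J)
  obtain ⟨K₂, h2⟩ := X.perβ.neg.exists_ray_bound (X.pt J)
  refine ⟨K₁ + K₂, ?_⟩
  rintro u v _ ⟨L, γ, hγ, rfl⟩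
  obtain ⟨t, ht1, ht2⟩ := hγ.av₁.1.exists_left
  have e := eq_smul_of_zt_eq_zero X.w_ne ht1
  have ha := (div_neg_of_neg_of_pos ht2 (xi_self_pos X.w_ne)).le
  set a := xi (lat X.k) (γ t - X.pt J) / xi (lat X.k) (lat X.k)
  have e' : γ t = X.pt J + (-a) • lat (-X.k) := by
    rw [lat_neg, smul_neg, neg_smul, neg_neg, ← e]; abel
  have e1 := h1 (-a) (by linarith) (-u)
  have e2 := h2 (-a) (by linarith) (-v)
  rw [← e', neg_neg] at e1 e2
  have e3 := hγ.toConn.dist_add_le t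
  rw [M.dist_comm (γ t)] at e3
  linarith

lemma Q.closed {u v c : ℕ → ℝ} {a b d : ℝ} (h : ∀ n, X.Q J (u n) (v n) (c n))
    (hu : Tendsto u ulf (𝓝 a)) (hv : Tendsto v ulf (𝓝 b)) (hc : Tendsto c ulf (𝓝 d)) :
    X.Q J a b d := by
  choose L γ hγ hcL using h
  have hL : Tendsto L ulf (𝓝 (d + (b - a))) := by
    refine (hc.add (hv.sub hu)).congr fun n => ?_
    rw [hcL]; ring
  set L' := d + (b - a) with hL'
  have hL0 : 0 ≤ L' := ge_of_tendsto' hL fun n => (hγ n).nonneg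
  have hα : Tendsto (fun n => X.α (u n)) ulf (𝓝 (X.α a)) :=
    (X.per.line.continuous.tendsto a).comp hu
  have hβ : Tendsto (fun n => X.β (v n)) ulf (𝓝 (X.β b)) :=
    (X.perβ.line.continuous.tendsto b).comp hv
  have hlim : ∀ t, ∃ x, Tendsto (fun n => γ n t) ulf (𝓝 x) := fun t => by
    refine exists_ulim (C := ‖X.α a‖ + 1 + |t| / M.lo) ?_
    filter_upwards [hα.norm.eventually_le_const (lt_add_one _)] with n hn
    have h1 := (hγ n).lip.norm_sub_le t 0
    rw [(hγ n).left 0 le_rfl, sub_zero] at h1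
    have := norm_sub_norm_le (γ n t) (X.α (u n))
    linarith
  choose γ' hγ' using hlim
  have hlip : M.Lip γ' := fun s t =>
    le_of_tendsto' (M.tendsto_dist (hγ' s) (hγ' t)) fun n => (hγ n).lip s t
  have hright : ∀ t, L' < t → γ' t = X.β b := fun t ht => by
    refine tendsto_nhds_unique (hγ' t) (hβ.congr' ?_)
    filter_upwards [hL.eventually_le_const ht] with n hn
    rw [(hγ n).right t hn]
  have hconn : X.Conn a b L' γ' := by
    refine ⟨hL0, hlip, fun t ht => ?_, fun t ht => ?_, fun t => ?_⟩
    · exact tendsto_nhds_unique (hγ' t) (hα.congr fun n => ((hγ n).left t ht).symm)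
    · rcases ht.eq_or_lt with rfl | ht
      · refine M.eq_of_dist_le_zero (le_of_forall_pos_le_add fun ε hε => ?_)
        have h1 := hlip (d + (b - a)) (d + (b - a) + ε)
        rw [hright (d + (b - a) + ε) (lt_add_of_pos_right _ hε), sub_add_cancel_left, abs_neg,
          abs_of_pos hε] at h1
        rwa [zero_add]
      · exact hright t ht
    · exact (isClosed_strip X.per.line.isClosed_range).mem_of_tendsto (hγ' t)
        (Eventually.of_forall fun n => (hγ n).mem t)
  have hav : ∀ i j, (∀ n, X.Av (γ n) i j) → X.Av γ' i j := fun i j h => by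
    refine ⟨?_, fun t => ge_of_tendsto' ((hγ' t).sub_const _).norm fun n => (h n).2 t⟩
    have h1 := Lip.eventually_forall_norm_sub_lt (fun n => (hγ n).lip) hlip hγ' (a := 0)
      (b := L' + 1) (half_pos X.r_pos)
    obtain ⟨n, h1, h2⟩ := (h1.and (hL.eventually_le_const (lt_add_one _))).exists
    refine (hγ n).toConn.cls_of_close hconn (fun t => ?_) (h n).1
    have key : ‖γ n t - γ' t‖ < X.r / 2 := by
      rcases le_total t 0 with ht | ht
      · rw [(hγ n).left t ht, hconn.left t ht, ← (hγ n).left 0 le_rfl, ← hconn.left 0 le_rfl]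
        exact h1 0 ⟨le_rfl, by linarith⟩
      rcases le_total t (L' + 1) with ht' | ht'
      · exact h1 t ⟨ht, ht'⟩
      · rw [(hγ n).right t (h2.trans ht'), hconn.right t (by linarith), ← (hγ n).right _ h2,
          ← hconn.right (L' + 1) (by linarith)]
        exact h1 _ ⟨by linarith, le_rfl⟩
    linarith [(h n).2 t]
  exact ⟨L', γ', ⟨hconn, hav _ _ fun n => (hγ n).av₀, hav _ _ fun n => (hγ n).av₁⟩, by
    rw [hL']; ring⟩

variable (X) in
lemma pt_add (i m : ℤ) : X.pt (i + m) = X.pt i + (m : ℝ) • lat X.k := by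
  rw [pt, pt, Int.cast_add, add_smul, add_assoc]

lemma _root_.lat_zsmul (m : ℤ) (k : ℤ × ℤ) : lat (m • k) = (m : ℝ) • lat k := by simp [lat]

lemma Conn.translate (h : X.Conn u v L γ) (m : ℤ) :
    X.Conn (u + m * X.ℓ) (v + m * X.ℓ) L fun t => γ t + (m : ℝ) • lat X.k := by
  refine ⟨h.nonneg, ?_, fun t ht => ?_, fun t ht => ?_, fun t => ?_⟩
  · rw [← lat_zsmul]; exact h.lip.add_lat _
  · simp only [h.left t ht, X.per.add_zsmul]
  · simp only [h.right t ht, X.perβ.add_zsmul]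
  · exact X.per.add_zsmul_mem_strip (h.mem t) m

lemma Av.translate (h : X.Av γ i j) (m : ℤ) :
    X.Av (fun t => γ t + (m : ℝ) • lat X.k) (i + m) j := by
  refine ⟨?_, fun t => ?_⟩
  · rw [pt_add]; exact h.1.add_right _
  · rw [pt_add, add_sub_add_right_eq_sub]; exact h.2 t

variable (X) in
lemma exists_cost_lt : ∃ J u v c, X.Q J u v c ∧ c < M.mm X.α X.β + X.δ := by
  obtain ⟨n, hn⟩ := exists_lt_mm (M := M) (α := X.α) (β := X.β) X.δ_pos
  obtain ⟨σ, hσ, h0, h1, hS⟩ := X.per.exists_segment_strip X.bound X.gap (X.α_mem (-n)) (X.β_mem n)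
  have hL := M.dist_nonneg (X.α (-n)) (X.β n)
  set L := M.dist (X.α (-n)) (X.β n)
  have hmem : ∀ t, max 0 (min t L) ∈ Icc 0 L := fun t =>
    ⟨le_max_left _ _, max_le hL (min_le_right _ _)⟩
  have hconn : X.Conn (-n) n L fun t => σ (max 0 (min t L)) := by
    refine ⟨hL, fun s t => ?_, fun t ht => ?_, fun t ht => ?_, fun t => hS _ (hmem t)⟩
    · rw [hσ _ (hmem s) _ (hmem t)]
      refine (abs_max_sub_max_le_max _ _ _ _).trans ?_
      rw [sub_self, abs_zero, max_eq_right (abs_nonneg _)]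
      refine (abs_min_sub_min_le_max _ _ _ _).trans ?_
      rw [sub_self, abs_zero, max_eq_left (abs_nonneg _)]
    · rw [max_eq_left ((min_le_left _ _).trans ht), h0]
    · rw [min_eq_right ht, max_eq_right hL, h1]
  have hav := hconn.two_mul_le (by linarith)
  obtain ⟨B, hB⟩ := isCompact_Icc.exists_bound_of_continuousOn
    ((continuous_xi (lat X.k)).comp_continuousOn hσ.lipOn.continuousOn)
  have hB' : ∀ t, |xi (lat X.k) (σ (max 0 (min t L)))| ≤ B := fun t => hB _ (hmem t)
  have hw := xi_self_pos X.w_ne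
  obtain ⟨m, hm⟩ := exists_nat_gt ((B + |xi (lat X.k) X.p|) / xi (lat X.k) (lat X.k))
  rw [div_lt_iff₀ hw] at hm
  have a0 : X.Av (fun t => σ (max 0 (min t L))) (-m) 0 := by
    refine ⟨Cls.of_xi_pos X.w_ne hconn.lip.continuous (fun t => ?_) ?_ ?_, fun t => ?_⟩
    · rw [xi_sub, pt, xi_add, xi_smul]
      push_cast
      linarith [(abs_le.1 (hB' t)).1, le_abs_self (xi (lat X.k) X.p)]
    · filter_upwards [eventually_le_atBot 0] with t ht using hconn.zt_left _ ht
    · filter_upwards [eventually_ge_atTop L] with t ht using hconn.zt_right _ ht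
    · linarith [hav (-m) t, X.r_pos]
  have a1 : X.Av (fun t => σ (max 0 (min t L))) m (-1) := by
    refine ⟨Cls.of_xi_neg X.w_ne hconn.lip.continuous (fun t => ?_) ?_ ?_, fun t => ?_⟩
    · rw [xi_sub, pt, xi_add, xi_smul]
      push_cast
      linarith [(abs_le.1 (hB' t)).2, neg_abs_le (xi (lat X.k) X.p)]
    · filter_upwards [eventually_le_atBot 0] with t ht using hconn.zt_left _ ht
    · filter_upwards [eventually_ge_atTop L] with t ht using hconn.zt_right _ ht
    · linarith [hav m t, X.r_pos]
  have b0 := a0.translate m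
  rw [neg_add_cancel] at b0
  exact ⟨m + m, _, _, _, ⟨_, _, ⟨hconn.translate m, b0, a1.translate m⟩, rfl⟩, by linarith⟩

variable (X) in
lemma exists_costRel : ∃ J K, CostRel (X.Q J) K (M.mm X.α X.β) ∧
    cinf (X.Q J) < M.mm X.α X.β + X.δ := by
  obtain ⟨J, u, v, c, hq, hc⟩ := X.exists_cost_lt
  obtain ⟨K₁, h1⟩ := X.exists_coer_left J
  obtain ⟨K₂, h2⟩ := X.exists_coer_right
  have H : CostRel (X.Q J) (max K₁ K₂) (M.mm X.α X.β) :=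
    { mono := fun hq h h' => (hq.mono_left h).mono_right h'
      left := fun hq hs => hq.add_left hs
      right := fun hq hs => hq.sub_right hs
      coer_left := fun hq => by linarith [h1 _ _ _ hq, le_max_left K₁ K₂]
      coer_right := fun hq => by linarith [h2 _ _ _ _ hq, le_max_right K₁ K₂]
      lower := by
        rintro u v _ ⟨L, γ, hγ, rfl⟩
        exact hγ.toConn.mm_le
      closed := fun h h1 h2 h3 => Q.closed h h1 h2 h3
      nonempty := ⟨u, v, c, hq⟩ }
  exact ⟨J, _, H, (H.cinf_le hq).trans_lt hc⟩

end Conf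

end TorusMetric

namespace TorusMetric

variable {M : TorusMetric}

namespace Conf

variable {X : Conf M} {u v L D : ℝ} {γ γ' : ℝ → ℝ × ℝ} {i j J : ℤ} {x y z : ℝ × ℝ}

variable (X) in
/-- A path of length `L` in the strip from `x` to `y`. -/
structure Path (x y : ℝ × ℝ) (L : ℝ) (γ : ℝ → ℝ × ℝ) : Prop where
  nonneg : 0 ≤ L
  lip : M.Lip γ
  left : ∀ t ≤ 0, γ t = x
  right : ∀ t, L ≤ t → γ t = y
  mem : ∀ t, γ t ∈ X.S

namespace Path

lemma toConn (h : X.Path (X.α u) (X.β v) L γ) : X.Conn u v L γ :=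
  ⟨h.nonneg, h.lip, h.left, h.right, h.mem⟩

lemma join_eq (h : X.Path x y L γ) (h' : X.Path y z D γ') {t : ℝ} (ht : L ≤ t) :
    join γ (fun t => γ' (t - L)) L t = γ' (t - L) :=
  join_right (z := fun t => γ' (t - L)) (by rw [h.right L le_rfl, sub_self, h'.left 0 le_rfl]) ht

lemma trans (h : X.Path x y L γ) (h' : X.Path y z D γ') :
    X.Path x z (L + D) (join γ (fun t => γ' (t - L)) L) := by
  have hn := h'.nonneg
  refine ⟨add_nonneg h.nonneg h'.nonneg, h.lip.join (h'.lip.comp_sub L) ?_, fun t ht => ?_,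
    fun t ht => ?_, fun t => ?_⟩
  · rw [h.right L le_rfl, sub_self, h'.left 0 le_rfl]
  · rw [join_left (ht.trans h.nonneg), h.left t ht]
  · rw [h.join_eq h' (by linarith), h'.right _ (by linarith)]
  · rcases le_total t L with ht | ht
    · rw [join_left ht]; exact h.mem t
    · rw [h.join_eq h' ht]; exact h'.mem _

lemma norm_sub_left_le (h : X.Path x y L γ) (t : ℝ) : ‖γ t - x‖ ≤ L / M.lo := by
  have hlo := M.lo_pos
  have h0 := h.nonneg
  rcases le_total t 0 with ht | ht
  · rw [h.left t ht, sub_self, norm_zero]; positivity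
  rcases le_total t L with hL | hL
  · have := h.lip.norm_sub_le t 0
    rw [h.left 0 le_rfl, sub_zero, abs_of_nonneg ht] at this
    exact this.trans (by gcongr)
  · have := h.lip.norm_sub_le L 0
    rwa [h.left 0 le_rfl, sub_zero, abs_of_nonneg h0, h.right L le_rfl, ← h.right t hL] at this

lemma norm_sub_right_le (h : X.Path x y L γ) (t : ℝ) : ‖γ t - y‖ ≤ L / M.lo := by
  have hlo := M.lo_pos
  have h0 := h.nonneg
  rcases le_total t 0 with ht | ht
  · have := h.norm_sub_left_le L
    rwa [h.right L le_rfl, norm_sub_rev, ← h.left t ht] at this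
  rcases le_total t L with hL | hL
  · have := h.lip.norm_sub_le t L
    rw [h.right L le_rfl, abs_sub_comm, abs_of_nonneg (by linarith)] at this
    exact this.trans (by gcongr; linarith)
  · rw [h.right t hL, sub_self, norm_zero]; positivity

end Path

lemma exists_path (hx : x ∈ X.S) (hy : y ∈ X.S) : ∃ σ, X.Path x y (M.dist x y) σ := by
  obtain ⟨σ, hσ, h0, h1, hS⟩ := X.per.exists_segment_strip X.bound X.gap hx hy
  have hL := M.dist_nonneg x y
  set L := M.dist x y
  have hmem : ∀ t, max 0 (min t L) ∈ Icc 0 L := fun t =>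
    ⟨le_max_left _ _, max_le hL (min_le_right _ _)⟩
  refine ⟨fun t => σ (max 0 (min t L)), hL, fun s t => ?_, fun t ht => ?_, fun t ht => ?_,
    fun t => hS _ (hmem t)⟩
  · rw [hσ _ (hmem s) _ (hmem t)]
    refine (abs_max_sub_max_le_max _ _ _ _).trans ?_
    rw [sub_self, abs_zero, max_eq_right (abs_nonneg _)]
    refine (abs_min_sub_min_le_max _ _ _ _).trans ?_
    rw [sub_self, abs_zero, max_eq_left (abs_nonneg _)]
  · rw [max_eq_left ((min_le_left _ _).trans ht), h0]
  · rw [min_eq_right ht, max_eq_right hL, h1]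

lemma Conn.pathTo (h : X.Conn u v L γ) {t : ℝ} (ht : 0 ≤ t) :
    X.Path (X.α u) (γ t) t fun s => γ (min s t) :=
  ⟨ht, h.lip.comp fun a b => (abs_min_sub_min_le_max _ _ _ _).trans (by
      rw [sub_self, abs_zero, max_eq_left (abs_nonneg _)]),
    fun s hs => by rw [min_eq_left (hs.trans ht), h.left s hs],
    fun s hs => by rw [min_eq_right hs], fun s => h.mem _⟩

lemma Conn.pathFrom (h : X.Conn u v L γ) {t : ℝ} (ht : t ≤ L) :
    X.Path (γ t) (X.β v) (L - t) fun s => γ (max s 0 + t) :=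
  ⟨by linarith, h.lip.comp fun a b => by
      rw [add_sub_add_right_eq_sub]; exact abs_max_sub_max_le_abs a b 0,
    fun s hs => by rw [max_eq_right hs, zero_add],
    fun s hs => by rw [max_eq_left (by linarith), h.right _ (by linarith)], fun s => h.mem _⟩

lemma Seg.of_close (h : X.Seg J u v L γ) (hc : L - (v - u) < M.mm X.α X.β + X.δ) {u' v' L' : ℝ}
    (h' : X.Conn u' v' L' γ') (hcl : ∀ t, ‖γ t - γ' t‖ < X.r) : X.Seg J u' v' L' γ' :=
  ⟨h', h.toConn.av_of_close h' hc hcl h.av₀, h.toConn.av_of_close h' hc hcl h.av₁⟩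

/-- Replacement of a short piece of a path. -/
lemma Seg.cut (h : X.Seg J u v L γ) (hc : L - (v - u) < M.mm X.α X.β + X.δ) {a b : ℝ}
    (ha : 0 ≤ a) (hab : a ≤ b) (hb : b ≤ L) (hr : 2 * (b - a) < M.lo * X.r) :
    X.Q J u v (L - (v - u) - (b - a) + M.dist (γ a) (γ b)) := by
  have hlo := M.lo_pos
  obtain ⟨σ, hσ⟩ := exists_path (h.mem a) (h.mem b)
  have hD : M.dist (γ a) (γ b) ≤ b - a := by
    have := h.lip a b
    rwa [abs_sub_comm, abs_of_nonneg (by linarith)] at this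
  have hD0 := M.dist_nonneg (γ a) (γ b)
  set D := M.dist (γ a) (γ b)
  have p1 := h.toConn.pathTo ha
  have p2 := h.toConn.pathFrom hb
  have p12 := p1.trans hσ
  refine ⟨_, _, h.of_close hc (p12.trans p2).toConn fun t => ?_, by ring⟩
  have key : ∀ {x}, x ≤ 2 * (b - a) / M.lo → x < X.r := fun hx =>
    hx.trans_lt ((div_lt_iff₀ hlo).2 (by rwa [mul_comm X.r]))
  rcases le_total t (a + D) with ht | ht
  · rw [join_left ht]
    rcases le_total t a with hta | hta
    · rw [join_left hta, min_eq_left hta, sub_self, norm_zero]; exact X.r_pos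
    · rw [p1.join_eq hσ hta]
      refine key ?_
      have e1 := h.lip.norm_sub_le t a
      rw [abs_of_nonneg (by linarith)] at e1
      have e2 := hσ.norm_sub_left_le (t - a)
      rw [norm_sub_rev] at e2
      have e3 := norm_sub_le_norm_sub_add_norm_sub (γ t) (γ a) (σ (t - a))
      have e4 : (t - a) / M.lo ≤ (b - a) / M.lo := by gcongr; linarith
      have e5 : D / M.lo ≤ (b - a) / M.lo := by gcongr
      rw [mul_div_assoc]; linarith
  · rw [p12.join_eq p2 ht, max_eq_left (by linarith)]
    refine key ((h.lip.norm_sub_le _ _).trans ?_)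
    gcongr
    rw [abs_le]; constructor <;> linarith

/-- Replacement of the end of a path. -/
lemma Seg.cut_right (h : X.Seg J u v L γ) (hc : L - (v - u) < M.mm X.α X.β + X.δ) {a v' : ℝ}
    (ha : 0 ≤ a) (hb : a ≤ L) (hr : L - a + M.dist (γ a) (X.β v') < M.lo * X.r) :
    X.Q J u v' (a + M.dist (γ a) (X.β v') - (v' - u)) := by
  have hlo := M.lo_pos
  obtain ⟨σ, hσ⟩ := exists_path (h.mem a) (X.β_mem v')
  set D := M.dist (γ a) (X.β v')
  have p1 := h.toConn.pathTo ha
  have p2 := h.toConn.pathFrom hb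
  refine ⟨_, _, h.of_close hc (p1.trans hσ).toConn fun t => ?_, rfl⟩
  rcases le_total t a with hta | hta
  · rw [join_left hta, min_eq_left hta, sub_self, norm_zero]; exact X.r_pos
  · rw [p1.join_eq hσ hta]
    have e1 := p2.norm_sub_left_le (t - a)
    simp only [max_eq_left (sub_nonneg.2 hta), sub_add_cancel] at e1
    have e2 := hσ.norm_sub_left_le (t - a)
    rw [norm_sub_rev] at e2
    have e3 := norm_sub_le_norm_sub_add_norm_sub (γ t) (γ a) (σ (t - a))
    have e4 : (L - a) / M.lo + D / M.lo < X.r := by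
      rw [← add_div, div_lt_iff₀ hlo, mul_comm X.r]; exact hr
    linarith

/-- Replacement of the beginning of a path. -/
lemma Seg.cut_left (h : X.Seg J u v L γ) (hc : L - (v - u) < M.mm X.α X.β + X.δ) {b u' : ℝ}
    (hb0 : 0 ≤ b) (hb : b ≤ L) (hr : b + 2 * M.dist (X.α u') (γ b) < M.lo * X.r) :
    X.Q J u' v (L - b + M.dist (X.α u') (γ b) - (v - u')) := by
  have hlo := M.lo_pos
  obtain ⟨σ, hσ⟩ := exists_path (X.α_mem u') (h.mem b)
  have hD0 := M.dist_nonneg (X.α u') (γ b)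
  set D := M.dist (X.α u') (γ b)
  have p1 := h.toConn.pathTo hb0
  have p2 := h.toConn.pathFrom hb
  refine ⟨_, _, h.of_close hc (hσ.trans p2).toConn fun t => ?_, by ring⟩
  have key : ∀ {x}, x ≤ (b + 2 * D) / M.lo → x < X.r := fun hx =>
    hx.trans_lt ((div_lt_iff₀ hlo).2 (by rwa [mul_comm X.r]))
  rcases le_total t D with hta | hta
  · rw [join_left hta]
    refine key ?_
    have e2 := hσ.norm_sub_right_le t
    rw [norm_sub_rev] at e2
    have e3 := norm_sub_le_norm_sub_add_norm_sub (γ t) (γ b) (σ t)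
    have e1 : ‖γ t - γ b‖ ≤ (b + D) / M.lo := by
      rcases le_total t b with htb | htb
      · have := p1.norm_sub_right_le t
        simp only [min_eq_left htb] at this
        exact this.trans (by gcongr; linarith)
      · refine (h.lip.norm_sub_le t b).trans ?_
        gcongr
        rw [abs_of_nonneg (by linarith)]; linarith
    rw [show (b + 2 * D) / M.lo = (b + D) / M.lo + D / M.lo by ring]
    linarith
  · rw [hσ.join_eq p2 hta, max_eq_left (by linarith)]
    refine key ((h.lip.norm_sub_le _ _).trans ?_)
    gcongr
    rw [abs_le]; constructor <;> linarith

end Conf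

end TorusMetric

lemma exists_partial_sums (L : ℤ → ℝ) : ∃ T : ℤ → ℝ, T 0 = 0 ∧ ∀ k, T (k + 1) = T k + L k := by
  refine ⟨fun k => ∑ i ∈ Finset.Ico 0 k, L i - ∑ i ∈ Finset.Ico k 0, L i, by simp, fun k => ?_⟩
  dsimp only
  rcases le_or_gt 0 k with hk | hk
  · rw [← Finset.insert_Ico_right_eq_Ico_add_one hk, Finset.sum_insert (by simp)]
    simp [Finset.Ico_eq_empty_of_le hk,
      Finset.Ico_eq_empty_of_le (hk.trans (Int.le_add_one le_rfl))]
    ring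
  · rw [← Finset.insert_Ico_add_one_left_eq_Ico hk, Finset.sum_insert (by simp)]
    simp [Finset.Ico_eq_empty_of_le hk.le, Finset.Ico_eq_empty_of_le (show k + 1 ≤ 0 by lia)]

lemma exists_index {T : ℤ → ℝ} {a : ℝ} (ha : 0 < a) (hT : ∀ k, T k + a ≤ T (k + 1)) (t : ℝ) :
    ∃ k, T k ≤ t ∧ t < T (k + 1) := by
  have hup : ∀ n : ℕ, T 0 + n * a ≤ T n := fun n => by
    induction n with
    | zero => simp
    | succ n ih => have := hT n; push_cast; linarith
  have hdn : ∀ n : ℕ, T (-n) ≤ T 0 - n * a := fun n => by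
    induction n with
    | zero => simp
    | succ n ih =>
      have := hT (-(n + 1 : ℕ))
      rw [show -((n + 1 : ℕ) : ℤ) + 1 = -n by push_cast; ring] at this
      push_cast at this ⊢; linarith
  have hm : Monotone T := monotone_int_of_le_succ fun k => by linarith [hT k]
  obtain ⟨n₁, h1⟩ := exists_nat_gt ((t - T 0) / a)
  obtain ⟨n₂, h2⟩ := exists_nat_gt ((T 0 - t) / a)
  rw [div_lt_iff₀ ha] at h1 h2
  obtain ⟨k, hk, hmax⟩ := Int.exists_greatest_of_bdd (P := fun k => T k ≤ t)
    ⟨n₁, fun z hz => by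
      by_contra! h
      have := hm h.le
      linarith [hup n₁]⟩ ⟨-n₂, by linarith [hdn n₂]⟩
  refine ⟨k, hk, ?_⟩
  by_contra! h
  have := hmax _ h
  lia

namespace TorusMetric

variable {M : TorusMetric}

namespace Conf

variable {X : Conf M} {u v u' v' L L' : ℝ} {γ γ' : ℝ → ℝ × ℝ} {i j J : ℤ}

variable (X) in
lemma exists_length_pos : ∃ a > 0, ∀ u v L γ, X.Conn u v L γ → a ≤ L := by
  have hw : 0 < ‖lat X.k‖ := norm_pos_iff.2 X.w_ne
  have hlo := M.lo_pos
  refine ⟨M.lo * ((zt (lat X.k) (lat X.s) - 2 * X.C) / (2 * ‖lat X.k‖)),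
    mul_pos hlo (div_pos (by linarith [X.gap]) (by positivity)), fun u v L γ h => ?_⟩
  have h1 := h.dist_add_le 0
  rw [h.left 0 le_rfl, M.dist_self, zero_add] at h1
  have h2 := (M.lo_le_dist (X.α u) (X.β v)).trans h1
  refine le_trans ?_ h2
  gcongr
  rw [div_le_iff₀ (by positivity), norm_sub_rev]
  have h3 := (le_abs_self _).trans (abs_zt_le (lat X.k) (X.β v - X.α u))
  rw [zt_sub, β, zt_add] at h3
  have h4 := (abs_le.1 (X.bound u)).2
  have h5 := (abs_le.1 (X.bound v)).1
  rw [β]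
  linarith

/-- Consecutive paths of an optimal chain fit together to a curve which is locally minimizing. -/
lemma Seg.le_dist_of_junction (h : X.Seg J u v L γ) (h' : X.Seg J u' v' L' γ')
    (hc : L - (v - u) < M.mm X.α X.β + X.δ) (hc' : L' - (v' - u') < M.mm X.α X.β + X.δ) {Δ : ℤ}
    (hv : v = u' + Δ * X.ℓ)
    (hopt : ∀ y c₁ c₂, X.Q J u (y + Δ * X.ℓ) c₁ → X.Q J y v' c₂ →
      L - (v - u) + (L' - (v' - u')) ≤ c₁ + c₂) {a b : ℝ} (ha : 0 ≤ a) (haL : a ≤ L) (hb : 0 ≤ b)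
    (hbL : b ≤ L') (hr : 3 * (L - a + b) < M.lo * X.r) :
    L - a + b ≤ M.dist (γ a) (γ' b + ((Δ : ℝ) • lat X.k + lat X.s)) := by
  by_contra! hlt
  set y := γ' b + ((Δ : ℝ) • lat X.k + lat X.s) with hy
  obtain ⟨σ, h0, h1, hσ⟩ := M.exists_segment (γ a) y
  have hD0 := M.dist_nonneg (γ a) y
  set D := M.dist (γ a) y
  have hiso : M.IsoOn σ 0 D := hσ
  obtain ⟨t, ht, q, hq⟩ := exists_hit_of_strip hD0 hiso.lipOn.continuousOn
    (by rw [h0]; exact h.mem a)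
    (by rw [h1, hy, ← add_assoc, add_sub_cancel_right]
        exact X.per.add_zsmul_mem_strip (h'.mem b) Δ)
  have d1 : M.dist (γ a) (X.β q) = t := by
    have := hσ 0 ⟨le_rfl, hD0⟩ t ht
    rw [h0, hq, zero_sub, abs_neg, abs_of_nonneg ht.1] at this
    exact this
  have d2 : M.dist (X.α (q - Δ * X.ℓ)) (γ' b) = D - t := by
    have := hσ t ht D ⟨hD0, le_rfl⟩
    rw [h1, hq, hy, ← add_assoc, M.dist_add_lat, abs_sub_comm, abs_of_nonneg (by linarith [ht.2])]
      at this
    rw [← this, show X.α q = X.α (q - Δ * X.ℓ) + lat (Δ • X.k) by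
      rw [lat_zsmul, ← X.per.add_zsmul, sub_add_cancel], ← lat_zsmul, M.dist_add_lat]
  have ht1 := ht.1
  have ht2 := ht.2
  have q1 := h.cut_right hc (v' := q) ha haL (by rw [d1]; linarith)
  have q2 := h'.cut_left hc' (u' := q - Δ * X.ℓ) hb hbL (by rw [d2]; linarith)
  rw [d1] at q1
  rw [d2] at q2
  have := hopt (q - Δ * X.ℓ) _ _ (by rwa [sub_add_cancel]) q2
  linarith

variable (X J) in
/-- A sequence of paths which are the pieces of an optimal chain. -/
structure Opt (L₀ : ℝ) (x : ℤ → ℝ) (m : ℤ → ℤ) (L : ℤ → ℝ) (γ : ℤ → ℝ → ℝ × ℝ) : Prop where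
  seg : ∀ k, X.Seg J (x k) (x (k + 1) + (m (k + 1) - m k : ℤ) * X.ℓ) (L k) (γ k)
  small : ∀ k, L k - (x (k + 1) + (m (k + 1) - m k : ℤ) * X.ℓ - x k) < M.mm X.α X.β + X.δ
  le : ∀ k, L k ≤ L₀
  opt : ∀ k y c₁ c₂, X.Q J (x k) (y + (m (k + 1) - m k : ℤ) * X.ℓ) c₁ →
    X.Q J y (x (k + 1 + 1) + (m (k + 1 + 1) - m (k + 1) : ℤ) * X.ℓ) c₂ →
    L k - (x (k + 1) + (m (k + 1) - m k : ℤ) * X.ℓ - x k) +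
      (L (k + 1) - (x (k + 1 + 1) + (m (k + 1 + 1) - m (k + 1) : ℤ) * X.ℓ - x (k + 1))) ≤ c₁ + c₂

variable (X) in
/-- The `k`-th translation in a concatenation. -/
def tr (m : ℤ → ℤ) (k : ℤ) : ℝ × ℝ := (m k : ℝ) • lat X.k + (k : ℝ) • lat X.s

lemma tr_eq (m : ℤ → ℤ) (k : ℤ) : X.tr m k = lat (m k • X.k + k • X.s) := by
  rw [tr, ← lat_zsmul, ← lat_zsmul]
  simp [lat]

lemma tr_succ (m : ℤ → ℤ) (k : ℤ) :
    X.tr m (k + 1) = ((m (k + 1) - m k : ℤ) : ℝ) • lat X.k + lat X.s + X.tr m k := by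
  simp only [tr]
  push_cast
  module

lemma zt_tr (m : ℤ → ℤ) (k : ℤ) : zt (lat X.k) (X.tr m k) = k * zt (lat X.k) (lat X.s) := by
  rw [tr, zt_add, zt_smul, zt_smul, zt_self]; ring

variable (X) in
/-- The curve `z` is the concatenation of the translates of the curves `γ k`. -/
structure Cat (m : ℤ → ℤ) (L : ℤ → ℝ) (γ : ℤ → ℝ → ℝ × ℝ) (T : ℤ → ℝ) (z : ℝ → ℝ × ℝ) :
    Prop where
  zero : T 0 = 0
  succ : ∀ k, T (k + 1) = T k + L k
  eq : ∀ k t, T k ≤ t → t ≤ T (k + 1) → z t = γ k (t - T k) + X.tr m k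
  index : ∀ t, ∃ k, T k ≤ t ∧ t < T (k + 1)

section

variable {L₀ : ℝ} {x : ℤ → ℝ} {m : ℤ → ℤ} {L : ℤ → ℝ} {γ : ℤ → ℝ → ℝ × ℝ} {T : ℤ → ℝ}
  {z : ℝ → ℝ × ℝ}

lemma Opt.exists_cat (h : X.Opt J L₀ x m L γ) : ∃ T z, X.Cat m L γ T z := by
  obtain ⟨a, ha, hL⟩ := X.exists_length_pos
  obtain ⟨T, h0, hT⟩ := exists_partial_sums L
  have hTa : ∀ k, T k + a ≤ T (k + 1) := fun k => by
    rw [hT]; linarith [hL _ _ _ _ (h.seg k).toConn]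
  have hm : StrictMono T := strictMono_int_of_lt_succ fun k => by linarith [hTa k]
  have hidx := exists_index ha hTa
  choose κ h1 h2 using hidx
  refine ⟨T, fun t => γ (κ t) (t - T (κ t)) + X.tr m (κ t), h0, hT, fun k t hk hk' => ?_,
    fun t => ⟨_, h1 t, h2 t⟩⟩
  have e1 : k ≤ κ t := Int.lt_add_one_iff.1 (hm.lt_iff_lt.1 (hk.trans_lt (h2 t)))
  have e2 : κ t ≤ k + 1 := hm.le_iff_le.1 ((h1 t).trans hk')
  rcases e2.eq_or_lt with e | e
  · have ht : t = T (k + 1) := le_antisymm hk' (e ▸ h1 t)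
    simp only [e]
    rw [← ht, sub_self, (h.seg (k + 1)).left 0 le_rfl, (h.seg k).right _ (by rw [ht, hT]; linarith),
      tr_succ, β, X.per.add_zsmul]
    module
  · have : κ t = k := by lia
    simp only [this]

namespace Cat

lemma lipOn_piece (hz : X.Cat m L γ T z) (h : X.Opt J L₀ x m L γ) (k : ℤ) :
    M.LipOn z (T k) (T (k + 1)) := fun s hs t ht => by
  rw [hz.eq k s hs.1 hs.2, hz.eq k t ht.1 ht.2, tr_eq, M.dist_add_lat]
  have := (h.seg k).lip (s - T k) (t - T k)
  rwa [sub_sub_sub_cancel_right] at this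

lemma le_succ (hz : X.Cat m L γ T z) (h : X.Opt J L₀ x m L γ) (k : ℤ) : T k ≤ T (k + 1) := by
  rw [hz.succ]; linarith [(h.seg k).nonneg]

lemma lipOn (hz : X.Cat m L γ T z) (h : X.Opt J L₀ x m L γ) (k : ℤ) :
    M.LipOn z (T k) (T (k + 1 + 1)) :=
  (hz.lipOn_piece h k).glue (hz.lipOn_piece h (k + 1))

lemma le_dist (hz : X.Cat m L γ T z) (h : X.Opt J L₀ x m L γ) {k : ℤ} {s t : ℝ} (hs : T k ≤ s)
    (hst : s ≤ t) (ht : t ≤ T (k + 1 + 1)) (hr : 3 * (t - s) < M.lo * X.r) :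
    t - s ≤ M.dist (z s) (z t) := by
  have hpiece : ∀ k, T k ≤ s → t ≤ T (k + 1) → t - s ≤ M.dist (z s) (z t) := fun k hs ht => by
    have e1 := hz.succ k
    have h1 := (h.seg k).cut (h.small k) (a := s - T k) (b := t - T k) (by linarith)
      (by linarith) (by linarith) (by linarith)
    have h2 := h.opt k _ _ _ h1 ⟨_, _, h.seg (k + 1), rfl⟩
    rw [hz.eq k s hs (by linarith), hz.eq k t (by linarith) ht, tr_eq, M.dist_add_lat]
    linarith
  rcases le_total t (T (k + 1)) with h1 | h1
  · exact hpiece k hs h1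
  rcases le_total (T (k + 1)) s with h2 | h2
  · exact hpiece (k + 1) h2 ht
  have e1 := hz.succ k
  have e2 := hz.succ (k + 1)
  have := (h.seg k).le_dist_of_junction (h.seg (k + 1)) (h.small k) (h.small (k + 1)) rfl
    (fun y c₁ c₂ => h.opt k y c₁ c₂) (a := s - T k) (b := t - T (k + 1)) (by linarith)
    (by linarith) (by linarith) (by linarith) (by linarith)
  rw [hz.eq k s hs h2, hz.eq (k + 1) t h1 ht, tr_succ, ← add_assoc, tr_eq, M.dist_add_lat]
  linarith

lemma locIso (hz : X.Cat m L γ T z) (h : X.Opt J L₀ x m L γ) : M.LocIso z := by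
  obtain ⟨a, ha, hL⟩ := X.exists_length_pos
  have hLa : ∀ k, a ≤ L k := fun k => hL _ _ _ _ (h.seg k).toConn
  have hpos := mul_pos M.lo_pos X.r_pos
  intro t
  obtain ⟨k, hk, hk'⟩ := hz.index t
  have key : ∀ k ε, T k ≤ t - ε → t + ε ≤ T (k + 1 + 1) → 0 < ε → 7 * ε ≤ M.lo * X.r →
      ∃ ε > 0, M.IsoOn z (t - ε) (t + ε) := fun k ε h1 h2 h3 h4 => by
    have hlip : M.LipOn z (t - ε) (t + ε) := (hz.lipOn h k).mono h1 h2
    refine ⟨ε, h3, hlip.isoOn ?_⟩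
    exact hz.le_dist h h1 (by linarith) h2 (by linarith)
  set ε := min (a / 2) (M.lo * X.r / 7)
  have he : 0 < ε := lt_min (by positivity) (by positivity)
  have he1 : ε ≤ a / 2 := min_le_left _ _
  have he2 : ε ≤ M.lo * X.r / 7 := min_le_right _ _
  have e1 := hz.succ k
  have e2 := hz.succ (k + 1)
  have e3 := hz.succ (k - 1)
  rw [sub_add_cancel] at e3
  rcases le_total t (T k + a / 2) with h1 | h1
  · exact key (k - 1) ε (by linarith [hLa (k - 1)])
      (by rw [sub_add_cancel]; linarith [hLa k]) he (by linarith)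
  · exact key k ε (by linarith) (by linarith [hLa (k + 1)]) he (by linarith)

lemma continuous (hz : X.Cat m L γ T z) (h : X.Opt J L₀ x m L γ) : Continuous z :=
  ((hz.locIso h).isGeodesic).1.continuous

lemma strictMono (hz : X.Cat m L γ T z) (h : X.Opt J L₀ x m L γ) : StrictMono T := by
  obtain ⟨a, ha, hL⟩ := X.exists_length_pos
  refine strictMono_int_of_lt_succ fun k => ?_
  rw [hz.succ]; linarith [hL _ _ _ _ (h.seg k).toConn]

lemma zt_le (hz : X.Cat m L γ T z) (h : X.Opt J L₀ x m L γ) {k : ℤ} {t : ℝ} (ht : t ≤ T k) :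
    zt (lat X.k) (z t) ≤ X.C + k * zt (lat X.k) (lat X.s) := by
  obtain ⟨q, h1, h2⟩ := hz.index t
  have hC : 0 ≤ X.C := (abs_nonneg _).trans (X.bound 0)
  have hq : q ≤ k := (hz.strictMono h).le_iff_le.1 (h1.trans ht)
  have hg := X.gap
  rcases hq.eq_or_lt with rfl | hq
  · have e : t - T q = 0 := by linarith
    rw [hz.eq q t h1 h2.le, e, (h.seg q).left 0 le_rfl, zt_add, zt_tr]
    linarith [(abs_le.1 (X.bound (x q))).2]
  · have hq' : (q : ℝ) + 1 ≤ k := by exact_mod_cast hq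
    rw [hz.eq q t h1 h2.le, zt_add, zt_tr]
    have e1 := zt_le_of_mem_strip X.bound ((h.seg q).mem (t - T q))
    nlinarith

lemma le_zt (hz : X.Cat m L γ T z) (h : X.Opt J L₀ x m L γ) {k : ℤ} {t : ℝ} (ht : T k ≤ t) :
    -X.C + k * zt (lat X.k) (lat X.s) ≤ zt (lat X.k) (z t) := by
  obtain ⟨q, h1, h2⟩ := hz.index t
  have hC : 0 ≤ X.C := (abs_nonneg _).trans (X.bound 0)
  have hq : k ≤ q := Int.lt_add_one_iff.1 ((hz.strictMono h).lt_iff_lt.1 (ht.trans_lt h2))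
  have hg := X.gap
  have hq' : (k : ℝ) ≤ q := by exact_mod_cast hq
  rw [hz.eq q t h1 h2.le, zt_add, zt_tr]
  have e1 := X.per.neg_le_zt_of_mem_strip X.bound ((h.seg q).mem (t - T q))
  nlinarith

lemma zt_sub_neg (hz : X.Cat m L γ T z) (h : X.Opt J L₀ x m L γ) {k : ℤ} (i : ℤ) {t : ℝ}
    (ht : t ≤ T k) : zt (lat X.k) (z t - (X.pt i + X.tr m k)) < 0 := by
  rw [zt_sub, zt_add, zt_tr, zt_pt]
  linarith [hz.zt_le h ht, X.zt_p.1]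

lemma zt_sub_pos (hz : X.Cat m L γ T z) (h : X.Opt J L₀ x m L γ) {k : ℤ} (i : ℤ) {t : ℝ}
    (ht : T (k + 1) ≤ t) : 0 < zt (lat X.k) (z t - (X.pt i + X.tr m k)) := by
  rw [zt_sub, zt_add, zt_tr, zt_pt]
  have := hz.le_zt h ht
  push_cast at this
  linarith [X.zt_p.2]

lemma le_norm_sub (hz : X.Cat m L γ T z) (h : X.Opt J L₀ x m L γ) {k i j : ℤ}
    (hav : X.Av (γ k) i j) (t : ℝ) : X.r ≤ ‖z t - (X.pt i + X.tr m k)‖ := by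
  have hr := X.r_pos
  rcases le_total t (T k) with h1 | h1
  · by_contra! hlt
    have := (X.far (x := z t - X.tr m k) (j := i) (by
      rw [sub_sub, add_comm (X.tr m k)]; linarith)).1
    rw [zt_sub, zt_tr] at this
    linarith [hz.zt_le h h1]
  rcases le_total (T (k + 1)) t with h2 | h2
  · by_contra! hlt
    have := (X.far (x := z t - X.tr m k) (j := i) (by
      rw [sub_sub, add_comm (X.tr m k)]; linarith)).2.1
    rw [zt_sub, zt_tr] at this
    have e := hz.le_zt h h2
    push_cast at e
    linarith
  · rw [hz.eq k t h1 h2, add_sub_add_right_eq_sub]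
    exact hav.2 _

lemma cls (hz : X.Cat m L γ T z) (h : X.Opt J L₀ x m L γ) {k i j : ℤ} (hav : X.Av (γ k) i j) :
    Cls (lat X.k) (X.pt i + X.tr m k) z j := by
  have hk := hz.succ k
  refine (hav.1.add_right (X.tr m k)).transfer X.w_ne (hz.continuous h) (a := T k) (b := T (k + 1))
    (s := T k) (hz.le_succ h k) (fun t ht => ?_) (fun t ht => ?_) (fun t ht => hz.zt_sub_neg h i ht)
    (fun t ht => ?_) fun t ht => hz.zt_sub_pos h i ht
  · rw [← hz.eq k t ht.1 ht.2, sub_self, norm_zero, mul_zero]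
    exact X.r_pos.trans_le (hz.le_norm_sub h hav t)
  · rw [add_sub_add_right_eq_sub]
    exact (h.seg k).zt_left i (by linarith)
  · rw [add_sub_add_right_eq_sub]
    exact (h.seg k).zt_right i (by linarith)

lemma le_of_nat (hz : X.Cat m L γ T z) (h : X.Opt J L₀ x m L γ) (k : ℕ) :
    T k ≤ k * L₀ := by
  induction k with
  | zero => simp [hz.zero]
  | succ k ih =>
    have := hz.succ k
    push_cast
    linarith [h.le k]

end Cat

end

end Conf

end TorusMetric

namespace TorusMetric

variable {M : TorusMetric}

namespace Conf

variable (X : Conf M)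

lemma exists_opt : ∃ (J N : ℤ) (L₀ B : ℝ), ∀ n : ℕ, 2 ≤ n → ∀ e : ZMod n → Bool,
    ∃ x L γ, X.Opt J L₀ x (fun k : ℤ => N * k + if e k then J else 0) L γ ∧ ∀ k, |x k| ≤ B := by
  obtain ⟨J, K, H, hlt⟩ := X.exists_costRel
  set μ := M.mm X.α X.β + X.δ
  obtain ⟨W, hW⟩ := H.exists_chain (η := (μ - cinf (X.Q J)) / 4) (by linarith)
  have hℓ := X.per.pos
  obtain ⟨N, hN⟩ := exists_nat_gt (W / X.ℓ + |(J : ℝ)|)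
  have hN' : W ≤ (N - |(J : ℝ)|) * X.ℓ := by
    rw [← div_le_iff₀ hℓ]; linarith
  set B := |μ + K| + (N + |(J : ℝ)|) * X.ℓ
  refine ⟨J, N, μ + 2 * B + (N + |(J : ℝ)|) * X.ℓ, B, fun n hn e => ?_⟩
  have : NeZero n := ⟨by lia⟩
  set E : ZMod n → ℤ := fun κ => if e κ then J else 0
  have hE : ∀ κ κ', |((E κ - E κ' : ℤ) : ℝ)| ≤ |(J : ℝ)| := fun κ κ' => by
    simp only [E]
    split_ifs <;> simp
  have hg : ∀ κ, |((N + (E (κ + 1) - E κ) : ℤ) : ℝ) * X.ℓ| ≤ (N + |(J : ℝ)|) * X.ℓ := fun κ => by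
    have := abs_le.1 (hE (κ + 1) κ)
    rw [abs_mul, abs_of_pos hℓ]
    gcongr
    rw [Int.cast_add, Int.cast_natCast]
    refine (abs_add_le _ _).trans ?_
    rw [Nat.abs_cast]
    exact add_le_add le_rfl (hE _ _)
  obtain ⟨x, c, hch, hc, hopt⟩ := hW n hn (fun κ => ((N + (E (κ + 1) - E κ) : ℤ) : ℝ) * X.ℓ)
    fun κ => hN'.trans (by
      gcongr
      have := abs_le.1 (hE (κ + 1) κ)
      push_cast at this ⊢; linarith)
  have hc' : ∀ κ, c κ < μ := fun κ => by linarith [hc κ]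
  have hx : ∀ κ, |x κ| ≤ B := fun κ => by
    have h1 := H.coer_left (hch κ)
    have h2 := H.coer_right (hch (κ - 1))
    simp only [sub_add_cancel] at h2
    have h3 := abs_le.1 (hg (κ - 1))
    rw [sub_add_cancel] at h3
    have h4 := le_abs_self (μ + K)
    have h5 := abs_nonneg (μ + K)
    have h6 : 0 ≤ (N + |(J : ℝ)|) * X.ℓ := by positivity
    rw [abs_le]
    constructor <;> linarith [hc' κ, hc' (κ - 1), h3.1, h3.2]
  choose L γ hseg hcost using hch
  have hm : ∀ k : ℤ, (N * (k + 1) + E ((k + 1 : ℤ) : ZMod n)) - (N * k + E (k : ZMod n)) =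
      N + (E ((k : ZMod n) + 1) - E (k : ZMod n)) := fun k => by push_cast; ring
  have hcs : ∀ k : ℤ, ((k + 1 : ℤ) : ZMod n) = (k : ZMod n) + 1 := fun k => by push_cast; ring
  refine ⟨fun k => x k, fun k => L k, fun k => γ k, ⟨fun k => ?_, fun k => ?_, fun k => ?_,
    fun k y c₁ c₂ h1 h2 => ?_⟩, fun k => hx _⟩
  · rw [hm, hcs]
    exact hseg k
  · rw [hm, hcs, ← hcost]
    exact hc' k
  · have h1 := abs_le.1 (hg (k : ZMod n))
    have h2 := abs_le.1 (hx (k : ZMod n))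
    have h3 := abs_le.1 (hx ((k : ZMod n) + 1))
    linarith [hcost (k : ZMod n), hc' (k : ZMod n)]
  · rw [hm] at h1 ⊢
    rw [hm] at h2 ⊢
    simp only [hcs] at h1 h2 ⊢
    rw [← hcost, ← hcost]
    have := hopt ((k : ZMod n) + 1) y c₁ c₂
    rw [add_sub_cancel_right] at this
    exact this h1 h2

/-- The geodesic flow has a family of geodesics which are indexed by words and separated. -/
theorem exists_family : ∃ L₀ > 0, ∃ B : ℝ, ∀ n : ℕ, 2 ≤ n → ∃ Z : (ZMod n → Bool) → ℝ → ℝ × ℝ,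
    (∀ e, M.IsGeodesic (Z e) ∧ ‖Z e 0‖ ≤ B) ∧
    ∀ e e', (∀ t ∈ Icc (0 : ℝ) (n * L₀), 2 * ‖Z e t - Z e' t‖ < X.r) → e = e' := by
  obtain ⟨J, N, L₀, B, H⟩ := X.exists_opt
  have hlo := M.lo_pos
  have hℓ := X.per.pos
  refine ⟨max L₀ 1, by positivity, ‖X.α 0‖ + (B + |(J : ℝ)| * X.ℓ) / M.lo, fun n hn => ?_⟩
  have : NeZero n := ⟨by lia⟩
  choose x L γ ho hx using H n hn
  choose T z hz using fun e => (ho e).exists_cat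
  refine ⟨z, fun e => ⟨((hz e).locIso (ho e)).isGeodesic, ?_⟩, ?_⟩
  · have h0 := hz e
    have ho := ho e
    have h1 := h0.eq 0 0 h0.zero.le (by have := h0.le_succ ho 0; rwa [h0.zero] at this)
    rw [h0.zero, sub_zero, (ho.seg 0).left 0 le_rfl, tr] at h1
    simp only [Int.cast_zero, zero_smul, add_zero] at h1
    rw [← X.per.add_zsmul] at h1
    have h2 := X.per.line.lip.norm_sub_le
      (x e 0 + ((N * 0 + if e 0 then J else 0 : ℤ) : ℝ) * X.ℓ) 0
    rw [← h1, sub_zero] at h2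
    have h3 : |x e 0 + ((N * 0 + if e 0 then J else 0 : ℤ) : ℝ) * X.ℓ| ≤
        B + |(J : ℝ)| * X.ℓ := by
      refine (abs_add_le _ _).trans (add_le_add (hx e 0) ?_)
      rw [abs_mul, abs_of_pos hℓ]
      refine mul_le_mul_of_nonneg_right ?_ hℓ.le
      split_ifs <;> simp
    have h4 := norm_sub_norm_le (z e 0) (X.α 0)
    have h5 : |x e 0 + ((N * 0 + if e 0 then J else 0 : ℤ) : ℝ) * X.ℓ| / M.lo ≤
      (B + |(J : ℝ)| * X.ℓ) / M.lo := by gcongr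
    linarith
  · have key : ∀ e e', (∀ t ∈ Icc (0 : ℝ) (n * max L₀ 1), 2 * ‖z e t - z e' t‖ < X.r) →
        ∀ κ, e κ = true → e' κ = true := by
      intro e e' hcl κ he
      by_contra hne
      have he' : e' κ = false := by simpa using hne
      have hcast : (((κ.val : ℕ) : ℤ) : ZMod n) = κ := by simp
      set k := ((κ.val : ℕ) : ℤ)
      have hav := ((ho e).seg k).av₀
      have hav' := ((ho e').seg k).av₁
      have c1 := (hz e).cls (ho e) hav
      have c2 := (hz e').cls (ho e') hav'
      have ep : X.pt J + X.tr (fun k : ℤ => N * k + if e' k then J else 0) k =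
          X.pt 0 + X.tr (fun k : ℤ => N * k + if e k then J else 0) k := by
        simp only [tr, pt, hcast, he, he']
        push_cast
        module
      have hbd : ∀ e, T e (k + 1) ≤ n * max L₀ 1 := fun e => by
        have h1 := (hz e).le_of_nat (ho e) (κ.val + 1)
        push_cast at h1
        refine h1.trans ?_
        have : ((κ.val : ℝ) + 1) ≤ n := by exact_mod_cast κ.val_lt
        have h3 : (0 : ℝ) ≤ κ.val + 1 := by positivity
        exact (mul_le_mul_of_nonneg_left (le_max_left _ _) h3).trans
          (mul_le_mul_of_nonneg_right this (by positivity))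
      have hT0 : ∀ e, 0 ≤ T e k := fun e => by
        rw [← (hz e).zero]
        exact ((hz e).strictMono (ho e)).monotone (Int.natCast_nonneg _)
      rw [ep] at c2
      have c3 := c1.transfer X.w_ne ((hz e').continuous (ho e')) (a := 0) (b := n * max L₀ 1)
        (s := 0) (by positivity)
        (fun t ht => by
          rw [sub_zero]
          exact (hcl t ht).trans_le ((hz e).le_norm_sub (ho e) hav t))
        (fun t ht => (hz e).zt_sub_neg (ho e) 0 (by linarith [hT0 e]))
        (fun t ht => by
          have := (hz e').zt_sub_neg (ho e') J (ht.trans (hT0 e'))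
          rwa [ep] at this)
        (fun t ht => (hz e).zt_sub_pos (ho e) 0 (by linarith [hbd e]))
        (fun t ht => by
          have := (hz e').zt_sub_pos (ho e') J ((hbd e').trans ht)
          rwa [ep] at this)
      have := c3.unique c2
      lia
    intro e e' hcl
    funext κ
    rw [Bool.eq_iff_iff]
    exact ⟨key e e' hcl κ, key e' e (fun t ht => by rw [norm_sub_rev]; exact hcl t ht) κ⟩

end Conf

end TorusMetric

namespace TorusMetric

variable {M : TorusMetric}

lemma IsLine.continuous_bu {α : ℝ → ℝ × ℝ} (h : M.IsLine α) : Continuous (M.bu α) := by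
  have hhi := M.hi_pos
  rw [continuous_iff_continuousAt]
  intro x
  refine tendsto_iff_norm_sub_tendsto_zero.2 (squeeze_zero (g := fun y => M.hi * ‖y - x‖)
    (fun _ => norm_nonneg _) (fun y => ?_) ?_)
  · have h1 := bu_sub_le h x y
    have h2 := bu_sub_le h y x
    have h3 := M.dist_le_hi y x
    rw [M.dist_comm] at h1
    rw [Real.norm_eq_abs, abs_le]
    constructor <;> linarith
  · have : Continuous fun y : ℝ × ℝ => M.hi * ‖y - x‖ := by fun_prop
    simpa using this.tendsto x

lemma LocIso.add_lat {c : ℝ → ℝ × ℝ} (h : M.LocIso c) (k : ℤ × ℤ) :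
    M.LocIso fun t => c t + lat k := fun t => by
  obtain ⟨ε, hε, hi⟩ := h t
  exact ⟨ε, hε, fun s hs u hu => by rw [M.dist_add_lat]; exact hi s hs u hu⟩

/-- A geodesic which intersects a minimal axis twice passes through a point as required. -/
lemma PerLine.nonempty_conf {k : ℤ × ℤ} {ℓ : ℝ} {α : ℝ → ℝ × ℝ} (h : M.PerLine k ℓ α)
    {c : ℝ → ℝ × ℝ} (hc : M.LocIso c) {t₁ t₂ : ℝ} (ht : t₁ < t₂) {u₁ u₂ : ℝ} (h1 : c t₁ = α u₁)
    (h2 : c t₂ = α u₂) (htr : zt (deriv α u₁) (deriv c t₁) ≠ 0) : Nonempty (Conf M) := by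
  obtain ⟨C, hC, hb, -⟩ := h.exists_bound
  obtain ⟨D, hD⟩ := (isCompact_Icc (a := t₁) (b := t₂)).exists_bound_of_continuousOn
    ((continuous_zt (lat k)).comp hc.contDiff.continuous).continuousOn
  obtain ⟨N, hN⟩ := exists_nat_gt (C + D)
  have hD0 : 0 ≤ D := (norm_nonneg _).trans (hD t₁ ⟨le_rfl, ht.le⟩)
  have hk : 1 ≤ k.1 * k.1 + k.2 * k.2 := by
    have : k ≠ 0 := fun h0 => h.lat_ne_zero (by simp [h0, lat])
    by_contra! hlt
    have h3 : k.1 * k.1 = 0 := by nlinarith [mul_self_nonneg k.1, mul_self_nonneg k.2]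
    have h4 : k.2 * k.2 = 0 := by nlinarith [mul_self_nonneg k.1, mul_self_nonneg k.2]
    exact this (Prod.ext (mul_self_eq_zero.1 h3) (mul_self_eq_zero.1 h4))
  set σ : ℤ × ℤ := (-((N : ℤ) * k.2), N * k.1) with hσ
  have hzσ : zt (lat k) (lat σ) = N * ((k.1 * k.1 + k.2 * k.2 : ℤ) : ℝ) := by
    simp only [hσ, lat, zt, crossDet]; push_cast; ring
  have hzN : (N : ℝ) ≤ zt (lat k) (lat σ) := by
    rw [hzσ]
    exact le_mul_of_one_le_right (Nat.cast_nonneg _) (by exact_mod_cast hk)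
  have hlat2 : lat (σ + σ) = lat σ + lat σ := by simp [lat]
  have hz2 : zt (lat k) (lat (σ + σ)) = 2 * zt (lat k) (lat σ) := by
    rw [hlat2, zt_add]; ring
  obtain ⟨t, htt, hgap⟩ := (h.add_lat σ).exists_gap (hc.add_lat σ) ht (u₁ := u₁) (u₂ := u₂)
    (by simp only [h1]) (by simp only [h2]) (by rwa [deriv_add_const, deriv_add_const]) (-σ) σ
  simp only [lat_neg, add_assoc, add_neg_cancel, add_zero, ← hlat2] at hgap
  set β : ℝ → ℝ × ℝ := fun u => α u + lat (σ + σ)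
  have hβ := h.add_lat (σ + σ)
  set p := c t + lat σ with hp
  set δ := (M.bu α p + M.au β p - M.mm α β) / 2 with hδ
  have hδ0 : 0 < δ := by rw [hδ]; linarith
  have e1 : ∀ᶠ x in 𝓝 p, M.mm α β + δ < M.bu α x + M.au β x :=
    (h.line.continuous_bu.add hβ.line.neg.continuous_bu).continuousAt.eventually_const_lt
      (by change M.mm α β + δ < M.bu α p + M.au β p; rw [hδ]; linarith)
  have hzc := abs_le.1 (hD t htt)
  have hzp : zt (lat k) p = zt (lat k) (c t) + zt (lat k) (lat σ) := zt_add _ _ _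
  simp only [Function.comp_apply] at hzc
  have e2 : ∀ᶠ x in 𝓝 p, C < zt (lat k) x :=
    (continuous_zt (lat k)).continuousAt.eventually_const_lt (by rw [hzp]; linarith)
  have e3 : ∀ᶠ x in 𝓝 p, zt (lat k) x < zt (lat k) (lat (σ + σ)) - C :=
    (continuous_zt (lat k)).continuousAt.eventually_lt_const (by rw [hzp]; linarith)
  obtain ⟨ε, hε, he⟩ := Metric.eventually_nhds_iff.1 (e1.and (e2.and e3))
  have he' : ∀ x, ‖x - p‖ < 2 * (ε / 2) → _ := fun x hx =>
    he (y := x) (by rw [dist_eq_norm]; linarith)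
  exact ⟨⟨k, σ + σ, ℓ, C, ε / 2, δ, α, p, h, hb, by linarith, by positivity, hδ0,
    fun x hx => (he' x hx).2, fun x hx => (he' x hx).1.le⟩⟩

/-- The configuration exists under the assumptions of the theorem. -/
lemma nonempty_conf {c α : ℝ → ℝ × ℝ} {k : ℤ × ℤ} (hc : M.IsGeodesic c) (hα : IsAxisOf M α k)
    (hmin : IsMinimal M α) {D₁ D₂ : Set ℝ} (hinf : (transInter c α D₁ D₂).Infinite) :
    Nonempty (Conf M) := by
  obtain ⟨hg, hk, ℓ, hℓ⟩ := hα
  have hline := hg.isLine hmin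
  have hper : ∃ k ℓ, M.PerLine k ℓ α := by
    rcases lt_trichotomy ℓ 0 with h | rfl | h
    · refine ⟨-k, -ℓ, by linarith, hline, fun u => ?_⟩
      have := hℓ (u + -ℓ)
      rw [neg_add_cancel_right] at this
      rw [this, lat_neg, add_neg_cancel_right]
    · have := hℓ 0
      rw [add_zero, left_eq_add] at this
      simp only [lat, Prod.mk_eq_zero, Int.cast_eq_zero] at this
      exact absurd (Prod.ext this.1 this.2) hk
    · exact ⟨k, ℓ, h, hline, hℓ⟩
  obtain ⟨k, ℓ, hp⟩ := hper
  obtain ⟨x, ⟨s, -, u, -, hs, hu, hx⟩, y, ⟨t, -, v, -, ht, hv, hy⟩, hxy⟩ := hinf.nontrivial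
  have hst : s ≠ t := fun h => hxy (by rw [← hs, ← ht, h])
  have anti : ∀ {a b : ℝ × ℝ}, crossDet a b ≠ 0 → zt b a ≠ 0 := fun {a b} h h' => h (by
    simp only [zt, crossDet] at h' ⊢; linarith)
  rcases hst.lt_or_gt with h | h
  · exact hp.nonempty_conf hc.locIso h (hs.trans hu.symm) (ht.trans hv.symm) (anti hx)
  · exact hp.nonempty_conf hc.locIso h (ht.trans hv.symm) (hs.trans hu.symm) (anti hy)

end TorusMetric

lemma norm_le_norm2 (v : ℝ × ℝ) : ‖v‖ ≤ norm2 v := by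
  rw [Prod.norm_def, norm2]
  refine max_le (Real.le_sqrt_of_sq_le ?_) (Real.le_sqrt_of_sq_le ?_)
  · rw [Real.norm_eq_abs, sq_abs]
    nlinarith [sq_nonneg v.2]
  · rw [Real.norm_eq_abs, sq_abs]
    nlinarith [sq_nonneg v.1]

lemma phaseDist_self_nonpos (p : (ℝ × ℝ) × (ℝ × ℝ)) : phaseDist p p ≤ 0 := by
  refine csInf_le ⟨0, ?_⟩ ⟨0, ?_⟩
  · rintro _ ⟨k, rfl⟩
    exact add_nonneg (Real.sqrt_nonneg _) (Real.sqrt_nonneg _)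
  · simp [lat, norm2]

lemma exists_lat_of_phaseDist_lt {p q : (ℝ × ℝ) × (ℝ × ℝ)} {ε : ℝ} (h : phaseDist p q < ε) :
    ∃ k : ℤ × ℤ, ‖p.1 - q.1 - lat k‖ < ε := by
  obtain ⟨_, ⟨k, rfl⟩, hk⟩ := exists_lt_of_csInf_lt (by exact ⟨_, 0, rfl⟩) h
  refine ⟨k, ?_⟩
  rw [sub_sub]
  have h2 : 0 ≤ norm2 (p.2 - q.2) := Real.sqrt_nonneg _
  linarith [norm_le_norm2 (p.1 - (q.1 + lat k))]

lemma eq_of_norm_lat_sub_lt {k k' : ℤ × ℤ} (h : ‖lat k - lat k'‖ < 1) : k = k' := by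
  rw [Prod.norm_def, max_lt_iff] at h
  simp only [lat, Prod.fst_sub, Prod.snd_sub, Real.norm_eq_abs] at h
  have h1 : |k.1 - k'.1| < 1 := by exact_mod_cast h.1
  have h2 : |k.2 - k'.2| < 1 := by exact_mod_cast h.2
  rw [Int.abs_lt_one_iff, sub_eq_zero] at h1 h2
  exact Prod.ext h1 h2

lemma finite_norm_lat_le (K : ℝ) : {k : ℤ × ℤ | ‖lat k‖ ≤ K}.Finite := by
  refine (Set.finite_Icc ((-⌈K⌉, -⌈K⌉) : ℤ × ℤ) (⌈K⌉, ⌈K⌉)).subset fun k hk => ?_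
  have h : max ‖(k.1 : ℝ)‖ ‖(k.2 : ℝ)‖ ≤ K := hk
  rw [max_le_iff, Real.norm_eq_abs, Real.norm_eq_abs, abs_le, abs_le] at h
  have hc := Int.le_ceil K
  obtain ⟨⟨h1, h2⟩, h3, h4⟩ := h
  have e1 : -⌈K⌉ ≤ k.1 := by exact_mod_cast (by push_cast; linarith : ((-⌈K⌉ : ℤ) : ℝ) ≤ k.1)
  have e2 : k.1 ≤ ⌈K⌉ := by exact_mod_cast (by linarith : (k.1 : ℝ) ≤ (⌈K⌉ : ℤ))
  have e3 : -⌈K⌉ ≤ k.2 := by exact_mod_cast (by push_cast; linarith : ((-⌈K⌉ : ℤ) : ℝ) ≤ k.2)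
  have e4 : k.2 ≤ ⌈K⌉ := by exact_mod_cast (by linarith : (k.2 : ℝ) ≤ (⌈K⌉ : ℤ))
  exact ⟨⟨e1, e3⟩, e2, e4⟩

/-- A path that stays close to the lattice stays close to a single lattice point. -/
lemma exists_lat_forall_norm_sub_lt {f : ℝ → ℝ × ℝ} (hf : Continuous f) {T δ : ℝ} (hT : 0 ≤ T)
    (hδ : δ ≤ 1 / 4) (h : ∀ t ∈ Icc 0 T, ∃ k, ‖f t - lat k‖ < δ) :
    ∃ k, ∀ t ∈ Icc 0 T, ‖f t - lat k‖ < δ := by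
  choose! κ hκ using h
  refine ⟨κ 0, fun t ht => ?_⟩
  have hcont : ContinuousOn κ (Icc 0 T) := by
    intro s hs
    have hev : ∀ᶠ u in 𝓝[Icc 0 T] s, κ u = κ s := by
      have h1 : ∀ᶠ u in 𝓝 s, ‖f u - f s‖ < 1 / 2 := by
        have := Metric.continuous_iff'.1 hf s (1 / 2) (by norm_num)
        simpa [dist_eq_norm] using this
      filter_upwards [self_mem_nhdsWithin, mem_nhdsWithin_of_mem_nhds h1] with u hu h1
      apply eq_of_norm_lat_sub_lt
      calc ‖lat (κ u) - lat (κ s)‖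
          = ‖(f s - lat (κ s)) - (f u - lat (κ u)) + (f u - f s)‖ := by congr 1; abel
        _ ≤ ‖f s - lat (κ s)‖ + ‖f u - lat (κ u)‖ + ‖f u - f s‖ :=
            (norm_add_le _ _).trans (by gcongr; exact norm_sub_le _ _)
        _ < 1 := by linarith [hκ s hs, hκ u hu]
    exact tendsto_nhds_of_eventually_eq hev
  have := isPreconnected_Icc.constant hcont ht (left_mem_Icc.2 hT)
  rw [← this]
  exact hκ t ht

/-- A maximal subset of a finite type with respect to a separation relation is spanning. -/
lemma exists_separated_spanning {ι : Type*} [Fintype ι] (S : ι → ι → Prop) :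
    ∃ A : Finset ι, (∀ a ∈ A, ∀ b ∈ A, a ≠ b → S a b) ∧
      ∀ e, e ∉ A → ∃ a ∈ A, ¬ (S e a ∧ S a e) := by
  classical
  obtain ⟨A, hA⟩ := Set.Finite.exists_maximal
    (s := {A : Finset ι | ∀ a ∈ A, ∀ b ∈ A, a ≠ b → S a b}) (Set.toFinite _)
    ⟨∅, by simp⟩
  refine ⟨A, hA.prop, fun e he => ?_⟩
  by_contra! hcon
  refine he (hA.le_of_ge (y := insert e A) ?_ (Finset.subset_insert _ _)
    (Finset.mem_insert_self _ _))
  intro a ha b hb hab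
  rw [Finset.mem_insert] at ha hb
  rcases ha with rfl | ha <;> rcases hb with rfl | hb
  · exact absurd rfl hab
  · exact (hcon b hb).1
  · exact (hcon a ha).2
  · exact hA.prop a ha b hb hab

lemma elog_mono : Monotone elog := by
  intro x y hxy
  unfold elog
  rcases eq_or_ne x 0 with hx | hx
  · simp [hx]
  rcases eq_or_ne y ⊤ with hy | hy
  · simp [hy]
  have hy0 : y ≠ 0 := (hx.bot_lt.trans_le hxy).ne'
  have hxt : x ≠ ⊤ := (hxy.trans_lt hy.lt_top).ne
  rw [if_neg hx, if_neg hxt, if_neg hy0, if_neg hy]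
  exact EReal.coe_le_coe_iff.2 (Real.log_le_log (ENNReal.toReal_pos hx hxt)
    (ENNReal.toReal_mono hy hxy))

lemma elog_natCast {n : ℕ} (hn : n ≠ 0) : elog n = (Real.log n : ℝ) := by
  simp [elog, hn]

namespace TorusMetric

variable {M : TorusMetric}

/-- A family of `2 ^ n` geodesics starting in a bounded region, any two of which differ by at
least `r / 2` up to time `n * L₀`, contains about `2 ^ n` members separated on the torus. -/
lemma two_pow_le_sepCount {W : Type*} [Fintype W] {Z : W → ℝ → ℝ × ℝ} {B r ε T : ℝ} {m : ℕ}
    (hr : 0 < r) (hε : 2 * ε ≤ 1 / 4) (hεr : 2 * ε ≤ r / 4) (hε0 : 0 < ε) (hT : 0 ≤ T)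
    (hm : {k : ℤ × ℤ | ‖lat k‖ ≤ 2 * B + 1}.ncard ≤ m)
    (hZ : ∀ e, M.IsGeodesic (Z e) ∧ ‖Z e 0‖ ≤ B)
    (hsep : ∀ e e', (∀ t ∈ Icc (0:ℝ) T, 2 * ‖Z e t - Z e' t‖ < r) → e = e') :
    ∃ N : ℕ, Fintype.card W ≤ N * m ∧ (N : ℝ≥0∞) ≤ sepCount M ε T := by
  classical
  obtain ⟨A, hA, hspan⟩ := exists_separated_spanning fun e e' =>
    ∃ t ∈ Icc (0 : ℝ) T, ε < phaseDist (Z e t, deriv (Z e) t) (Z e' t, deriv (Z e') t)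
  have hinj : Function.Injective Z := fun e e' h => hsep e e' fun t _ => by simp [h, hr]
  refine ⟨A.card, ?_, ?_⟩
  · have hK := finite_norm_lat_le (2 * B + 1)
    have hclose : ∀ e e', (∀ t ∈ Icc (0 : ℝ) T,
        phaseDist (Z e t, deriv (Z e) t) (Z e' t, deriv (Z e') t) ≤ ε) →
        ∃ κ, ∀ t ∈ Icc (0 : ℝ) T, ‖Z e t - Z e' t - lat κ‖ < 2 * ε := fun e e' h =>
      exists_lat_forall_norm_sub_lt
        ((hZ e).1.1.continuous.sub (hZ e').1.1.continuous) hT hε fun t ht =>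
        exists_lat_of_phaseDist_lt (p := (Z e t, deriv (Z e) t)) (q := (Z e' t, deriv (Z e') t))
          ((h t ht).trans_lt (by linarith))
    have hnear : ∀ e, ∃ p : W × (ℤ × ℤ), p.1 ∈ A ∧
        ∀ t ∈ Icc (0 : ℝ) T, ‖Z e t - Z p.1 t - lat p.2‖ < 2 * ε := by
      intro e
      by_cases he : e ∈ A
      · obtain ⟨κ, hκ⟩ := hclose e e fun t _ => (phaseDist_self_nonpos _).trans hε0.le
        exact ⟨(e, κ), he, hκ⟩
      · obtain ⟨a, ha, h⟩ := hspan e he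
        rw [not_and_or] at h
        push Not at h
        rcases h with h | h
        · obtain ⟨κ, hκ⟩ := hclose e a h
          exact ⟨(a, κ), ha, hκ⟩
        · obtain ⟨κ, hκ⟩ := hclose a e h
          refine ⟨(a, -κ), ha, fun t ht => ?_⟩
          rw [lat_neg, ← norm_neg]
          refine lt_of_eq_of_lt ?_ (hκ t ht)
          congr 1
          abel
    choose p hpA hp using hnear
    have hmem : ∀ e ∈ Finset.univ, p e ∈ A ×ˢ hK.toFinset := by
      intro e _
      rw [Finset.mem_product, Set.Finite.mem_toFinset]
      refine ⟨hpA e, ?_⟩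
      have h0 := hp e 0 (left_mem_Icc.2 hT)
      change ‖lat (p e).2‖ ≤ 2 * B + 1
      calc ‖lat (p e).2‖
          = ‖Z e 0 - Z (p e).1 0 - (Z e 0 - Z (p e).1 0 - lat (p e).2)‖ := by congr 1; abel
        _ ≤ ‖Z e 0‖ + ‖Z (p e).1 0‖ + ‖Z e 0 - Z (p e).1 0 - lat (p e).2‖ :=
            (norm_sub_le _ _).trans (by gcongr; exact norm_sub_le _ _)
        _ ≤ 2 * B + 1 := by linarith [(hZ e).2, (hZ (p e).1).2]
    have hpinj : Set.InjOn p (Finset.univ : Finset W) := by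
      intro e _ e' _ hee
      refine hsep e e' fun t ht => ?_
      have h1 := hp e t ht
      have h2 := hp e' t ht
      rw [← hee] at h2
      have : ‖Z e t - Z e' t‖ ≤ ‖Z e t - Z (p e).1 t - lat (p e).2‖ +
          ‖Z e' t - Z (p e).1 t - lat (p e).2‖ := by
        refine le_trans (le_of_eq ?_) (norm_sub_le _ _)
        congr 1
        abel
      linarith
    have hcard := Finset.card_le_card_of_injOn p hmem hpinj
    rw [Finset.card_product, ← Set.ncard_eq_toFinset_card _ hK] at hcard
    exact hcard.trans (Nat.mul_le_mul_left _ hm)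
  · have hF : IsSeparated M ε T (A.image Z) := by
      refine ⟨?_, ?_⟩
      · intro c hc
        obtain ⟨e, -, rfl⟩ := Finset.mem_image.1 hc
        exact (hZ e).1
      · intro c hc c' hc' hne
        obtain ⟨e, he, rfl⟩ := Finset.mem_image.1 hc
        obtain ⟨e', he', rfl⟩ := Finset.mem_image.1 hc'
        exact hA e he e' he' fun h => hne (h ▸ rfl)
    rw [← Finset.card_image_of_injective A hinj]
    exact le_iSup₂ (f := fun (F : Finset (ℝ → ℝ × ℝ)) (_ : IsSeparated M ε T F) =>
      (F.card : ℝ≥0∞)) (A.image Z) hF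

theorem Conf.topEnt_pos (X : Conf M) : 0 < topEnt M := by
  obtain ⟨L₀, hL₀, B, hfam⟩ := X.exists_family
  set m : ℕ := {k : ℤ × ℤ | ‖lat k‖ ≤ 2 * B + 1}.ncard + 1 with hm
  have hr := X.r_pos
  obtain ⟨ε, hε0, hε1, hε2⟩ : ∃ ε : ℝ, 0 < ε ∧ 2 * ε ≤ 1 / 4 ∧ 2 * ε ≤ X.r / 4 := by
    refine ⟨min (1 / 8) (X.r / 8), by positivity, ?_, ?_⟩
    · linarith [min_le_left (1 / 8) (X.r / 8)]
    · linarith [min_le_right (1 / 8) (X.r / 8)]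
  have hlog2 : 0 < Real.log 2 := Real.log_pos one_lt_two
  have hm0 : (0 : ℝ) < m := by exact_mod_cast Nat.succ_pos _
  have hlower : ∀ᶠ T : ℝ in atTop, ((Real.log 2 / (2 * L₀) : ℝ) : EReal) ≤
      ((T⁻¹ : ℝ) : EReal) * elog (sepCount M ε T) := by
    filter_upwards [eventually_ge_atTop (2 * L₀),
      eventually_ge_atTop (2 * L₀ * (Real.log 2 + Real.log m) / Real.log 2)] with T hT1 hT2
    have hTpos : 0 < T := by linarith
    have hn1 : (⌊T / L₀⌋₊ : ℝ) ≤ T / L₀ := Nat.floor_le (by positivity)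
    have hn2 : T / L₀ < ⌊T / L₀⌋₊ + 1 := Nat.lt_floor_add_one _
    have hn : 2 ≤ ⌊T / L₀⌋₊ := Nat.le_floor (by
      rw [le_div_iff₀ hL₀]
      exact_mod_cast hT1)
    set n := ⌊T / L₀⌋₊
    have : NeZero n := ⟨by lia⟩
    obtain ⟨Z, hZ, hsep⟩ := hfam n hn
    obtain ⟨N, hN, hNs⟩ := two_pow_le_sepCount (T := T) (m := m) hr hε1 hε2 hε0 hTpos.le
      (Nat.le_succ _) hZ fun e e' h => hsep e e' fun t ht =>
        h t ⟨ht.1, ht.2.trans ((le_div_iff₀ hL₀).1 hn1)⟩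
    rw [Fintype.card_fun, Fintype.card_bool, ZMod.card] at hN
    have hN0 : N ≠ 0 := by
      rintro rfl
      simp at hN
    have hNpos : (0 : ℝ) < N := by exact_mod_cast Nat.pos_of_ne_zero hN0
    have hlogN : n * Real.log 2 ≤ Real.log N + Real.log m := by
      rw [← Real.log_mul hNpos.ne' hm0.ne', ← Real.log_pow]
      exact Real.log_le_log (by positivity) (by exact_mod_cast hN)
    have hkey : Real.log 2 / (2 * L₀) ≤ T⁻¹ * Real.log N := by
      rw [div_le_iff₀ hlog2] at hT2
      rw [inv_mul_eq_div, div_le_div_iff₀ (by positivity) hTpos]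
      rw [div_lt_iff₀ hL₀] at hn2
      nlinarith
    calc ((Real.log 2 / (2 * L₀) : ℝ) : EReal)
        ≤ ((T⁻¹ * Real.log N : ℝ) : EReal) := EReal.coe_le_coe_iff.2 hkey
      _ = ((T⁻¹ : ℝ) : EReal) * elog N := by rw [EReal.coe_mul, elog_natCast hN0]
      _ ≤ _ := mul_le_mul_of_nonneg_left (elog_mono hNs)
          (EReal.coe_nonneg.2 (inv_nonneg.2 hTpos.le))
  calc (0 : EReal) < ((Real.log 2 / (2 * L₀) : ℝ) : EReal) :=
        EReal.coe_pos.2 (by positivity)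
    _ ≤ limsup (fun T : ℝ => ((T⁻¹ : ℝ) : EReal) * elog (sepCount M ε T)) atTop :=
        le_limsup_of_frequently_le' hlower.frequently
    _ ≤ topEnt M := le_iSup₂ (f := fun (ε : ℝ) (_ : 0 < ε) =>
        limsup (fun T : ℝ => ((T⁻¹ : ℝ) : EReal) * elog (sepCount M ε T)) atTop) ε hε0

end TorusMetric

/-- Let `(T², g)` be a Riemannian torus and `c` a geodesic ray on the universal covering
(the forward ray `c|_{[0,∞)}` of a complete geodesic) which intersects a minimal axis `α`
and a disjoint translate `τ α` each infinitely many times (transversally).  Then the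
geodesic flow of `g` has positive topological entropy. -/
theorem stmt10 (M : TorusMetric) (c α : ℝ → ℝ × ℝ) (τ₀ : ℤ × ℤ)
    (hc : M.IsGeodesic c) (hα : IsAxisOf M α τ₀) (hmin : IsMinimal M α)
    (τ : ℤ × ℤ) (hτ : τ ≠ 0)
    (hdisj : Set.range (transl τ α) ∩ Set.range α = ∅)
    (hinf₁ : (transInter c α (Set.Ici 0) Set.univ).Infinite)
    (hinf₂ : (transInter c (transl τ α) (Set.Ici 0) Set.univ).Infinite) :
    0 < topEnt M := by
  obtain ⟨X⟩ := TorusMetric.nonempty_conf hc hα hmin hinf₁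
  exact X.topEnt_pos
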